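/- arXiv:2206.09801 — 2 statements merged into one kernel-verified Lean document; each statement's English description precedes it below -/
import Mathlib

section
/- Regard F(z,J) = (z²−3z+9)(z²−11z+25)³ − J·(z−8) as a polynomial of degree 8 in z over the rational function field ℚ(J) in one indeterminate J. Then F is irreducible over ℚ(J), and the Galois group of its splitting field over ℚ(J) is isomorphic to PGL₂(𝔽₇), the projective general linear group of 2×2 matrices over the field with 7 elements (a group of order 336). -/
open Polynomial

/-- The projective general linear group `PGL₂(𝔽₇)`: the quotient of `GL₂(𝔽₇)`
by its center. -/
abbrev PGL2F7 : Type :=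
  Matrix.GeneralLinearGroup (Fin 2) (ZMod 7) ⧸
    Subgroup.center (Matrix.GeneralLinearGroup (Fin 2) (ZMod 7))

/-- `F(z,J) = (z²-3z+9)(z²-11z+25)³ - J·(z-8)` as a polynomial in `z` over the
rational function field `ℚ(J)`. -/
noncomputable def FzJ : Polynomial (RatFunc ℚ) :=
  (X ^ 2 - 3 * X + 9) * (X ^ 2 - 11 * X + 25) ^ 3 - C RatFunc.X * (X - 8)

/-! ### Part A: the group theory of `PGL₂(𝔽₇)` acting on the projective line -/

namespace PartA

/-- The projective line over the field with seven elements. -/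
abbrev PL : Type := OnePoint (ZMod 7)

abbrev GL27 : Type := Matrix.GeneralLinearGroup (Fin 2) (ZMod 7)

instance instFactPrimeSeven : Fact (Nat.Prime 7) := ⟨by norm_num⟩

instance instDecEqPL : DecidableEq PL := inferInstanceAs (DecidableEq (Option (ZMod 7)))

/-- Homogeneous coordinates. -/
def rep (x : PL) : ZMod 7 × ZMod 7 := OnePoint.elim x (1, 0) (fun t => (t, 1))

/-- The determinant pairing of two points. -/
def dt (x y : PL) : ZMod 7 := (rep x).1 * (rep y).2 - (rep x).2 * (rep y).1

/-- The orientation of a triple of points: the cube is the quadratic character. -/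
def sg (x y z : PL) : ZMod 7 := (dt x y * dt y z * dt z x) ^ 3

lemma dt_eq_zero : ∀ x y : PL, dt x y = 0 → x = y := by decide

lemma dt_self (x : PL) : dt x x = 0 := by simp [dt, mul_comm]

lemma pow_six : ∀ a : ZMod 7, a ≠ 0 → a ^ 6 = 1 := by decide

lemma sg_key2 : ∀ y : PL, sg OnePoint.infty (0 : ZMod 7) y = sg OnePoint.infty (0 : ZMod 7) (2 : ZMod 7) →
    sg OnePoint.infty (1 : ZMod 7) y = sg OnePoint.infty (1 : ZMod 7) (2 : ZMod 7) →
    y = ((2 : ZMod 7) : PL) := by decide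

lemma sg_key : ∀ x y : PL, sg OnePoint.infty (0 : ZMod 7) y = sg OnePoint.infty (0 : ZMod 7) x →
    sg OnePoint.infty (1 : ZMod 7) y = sg OnePoint.infty (1 : ZMod 7) x →
    sg OnePoint.infty (2 : ZMod 7) y = sg OnePoint.infty (2 : ZMod 7) x → y = x := by decide

lemma rep_smul (g : GL27) (x : PL) : ∃ l : ZMod 7, l ≠ 0 ∧
    g 0 0 * (rep x).1 + g 0 1 * (rep x).2 = l * (rep (g • x)).1 ∧
    g 1 0 * (rep x).1 + g 1 1 * (rep x).2 = l * (rep (g • x)).2 := by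
  have hdet := g.det_ne_zero
  rw [Matrix.det_fin_two] at hdet
  induction x using OnePoint.rec with
  | infty =>
    rw [OnePoint.smul_infty_eq_ite]
    split_ifs with h
    · refine ⟨g 0 0, ?_, ?_⟩
      · intro h0; apply hdet; rw [h, h0]; ring
      · simp [rep, h]
    · refine ⟨g 1 0, h, ?_⟩
      simp [rep]
      field_simp
  | coe t =>
    rw [OnePoint.smul_some_eq_ite]
    split_ifs with h
    · refine ⟨g 0 0 * t + g 0 1, ?_, ?_⟩
      · intro h0; apply hdet
        by_cases hc : g 1 0 = 0
        · rw [hc] at h ⊢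
          have : g 1 1 = 0 := by simpa using h
          rw [this]; ring
        · have : g 1 0 * (g 0 0 * g 1 1 - g 0 1 * g 1 0) = 0 := by
            linear_combination g 0 0 * g 1 0 * h - (g 1 0) ^ 2 * h0
          exact (mul_eq_zero.mp this).resolve_left hc
      · simpa [rep] using h
    · refine ⟨g 1 0 * t + g 1 1, h, ?_⟩
      simp [rep]
      rw [mul_comm (g 1 0 * t + g 1 1), div_mul_cancel₀ _ h]

lemma smul_eq_of (g : GL27) (x y : PL)
    (h : (g 0 0 * (rep x).1 + g 0 1 * (rep x).2) * (rep y).2 =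
      (g 1 0 * (rep x).1 + g 1 1 * (rep x).2) * (rep y).1) : g • x = y := by
  obtain ⟨l, hl, h1, h2⟩ := rep_smul g x
  apply dt_eq_zero
  rw [h1, h2] at h
  have : l * dt (g • x) y = 0 := by unfold dt; linear_combination h
  exact (mul_eq_zero.mp this).resolve_left hl

lemma sg_smul (g : GL27) (x y z : PL) :
    sg (g • x) (g • y) (g • z) = (g.1.det) ^ 3 * sg x y z := by
  obtain ⟨l, hl, h1, h2⟩ := rep_smul g x
  obtain ⟨m, hm, h3, h4⟩ := rep_smul g y
  obtain ⟨n, hn, h5, h6⟩ := rep_smul g z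
  have e1 : g.1.det * dt x y = l * m * dt (g • x) (g • y) := by
    rw [Matrix.det_fin_two]; unfold dt
    linear_combination (l * (rep (g • x)).1) * h4 + h1 * (g 1 0 * (rep y).1 + g 1 1 * (rep y).2) -
      (l * (rep (g • x)).2) * h3 - h2 * (g 0 0 * (rep y).1 + g 0 1 * (rep y).2)
  have e2 : g.1.det * dt y z = m * n * dt (g • y) (g • z) := by
    rw [Matrix.det_fin_two]; unfold dt
    linear_combination (m * (rep (g • y)).1) * h6 + h3 * (g 1 0 * (rep z).1 + g 1 1 * (rep z).2) -
      (m * (rep (g • y)).2) * h5 - h4 * (g 0 0 * (rep z).1 + g 0 1 * (rep z).2)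
  have e3 : g.1.det * dt z x = n * l * dt (g • z) (g • x) := by
    rw [Matrix.det_fin_two]; unfold dt
    linear_combination (n * (rep (g • z)).1) * h2 + h5 * (g 1 0 * (rep x).1 + g 1 1 * (rep x).2) -
      (n * (rep (g • z)).2) * h1 - h6 * (g 0 0 * (rep x).1 + g 0 1 * (rep x).2)
  have e : (g.1.det * dt x y * (g.1.det * dt y z) * (g.1.det * dt z x)) ^ 3 =
      l ^ 6 * m ^ 6 * n ^ 6 * sg (g • x) (g • y) (g • z) := by
    rw [e1, e2, e3]; unfold sg; ring
  rw [pow_six l hl, pow_six m hm, pow_six n hn] at e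
  have hd : (g.1.det) ^ 6 = 1 := pow_six _ g.det_ne_zero
  calc sg (g • x) (g • y) (g • z) = (g.1.det * dt x y * (g.1.det * dt y z) * (g.1.det * dt z x)) ^ 3 := by
        rw [e]; ring
    _ = (g.1.det) ^ 6 * (g.1.det) ^ 3 * sg x y z := by unfold sg; ring
    _ = _ := by rw [hd, one_mul]

/-- The permutation representation. -/
def psi : GL27 →* Equiv.Perm PL := MulAction.toPermHom GL27 PL

lemma psi_apply (g : GL27) (x : PL) : psi g x = g • x := rfl

lemma mem_center_iff (g : GL27) : g ∈ Subgroup.center GL27 ↔ g 0 1 = 0 ∧ g 1 0 = 0 ∧ g 0 0 = g 1 1 := by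
  rw [Matrix.GeneralLinearGroup.mem_center_iff_val_mem_range_scalar]
  constructor
  · rintro ⟨a, ha⟩
    have h : ∀ i j, g i j = Matrix.scalar (Fin 2) a i j := fun i j => by rw [ha]
    simp [h]
  · rintro ⟨h1, h2, h3⟩
    refine ⟨g 0 0, ?_⟩
    ext i j
    fin_cases i <;> fin_cases j <;> simp [h1, h2, h3]

lemma ker_psi : psi.ker = Subgroup.center GL27 := by
  ext g
  rw [mem_center_iff, MonoidHom.mem_ker]
  constructor
  · intro h
    have hf : ∀ x : PL, g • x = x := fun x => by rw [← psi_apply, h]; rfl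
    have h10 : g 1 0 = 0 := OnePoint.smul_infty_eq_self_iff.mp (hf _)
    obtain ⟨l, hl, h1, h2⟩ := rep_smul g ((0 : ZMod 7) : PL)
    obtain ⟨m, hm, h3, h4⟩ := rep_smul g ((1 : ZMod 7) : PL)
    rw [hf] at h1 h2 h3 h4
    simp [rep] at h1 h2 h3 h4
    refine ⟨h1, h10, ?_⟩
    rw [h1] at h3; rw [h10] at h4
    rw [← h4] at h3; simpa using h3
  · rintro ⟨h1, h2, h3⟩
    ext x
    rw [psi_apply]
    apply smul_eq_of
    rw [h1, h2, h3, Equiv.Perm.one_apply]; ring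

lemma exists_gl (a b c : PL) (hab : a ≠ b) (hbc : b ≠ c) (hca : c ≠ a) :
    ∃ g : GL27, g • (OnePoint.infty : PL) = a ∧ g • ((0 : ZMod 7) : PL) = b ∧
      g • ((1 : ZMod 7) : PL) = c := by
  have h1 : dt a b ≠ 0 := fun h => hab (dt_eq_zero _ _ h)
  have h2 : dt c b ≠ 0 := fun h => hbc (dt_eq_zero _ _ h).symm
  have h3 : dt a c ≠ 0 := fun h => hca (dt_eq_zero _ _ h).symm
  let M : Matrix (Fin 2) (Fin 2) (ZMod 7) :=
    !![dt c b * (rep a).1, dt a c * (rep b).1; dt c b * (rep a).2, dt a c * (rep b).2]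
  have hM : M.det ≠ 0 := by
    have : M.det = dt c b * dt a c * dt a b := by
      rw [Matrix.det_fin_two]; simp [M]
      conv_rhs => rw [show dt a b = (rep a).1 * (rep b).2 - (rep a).2 * (rep b).1 from rfl]
      ring
    rw [this]
    exact mul_ne_zero (mul_ne_zero h2 h3) h1
  refine ⟨Matrix.GeneralLinearGroup.mkOfDetNeZero M hM, smul_eq_of _ _ _ ?_, smul_eq_of _ _ _ ?_,
    smul_eq_of _ _ _ ?_⟩
  · simp [Matrix.GeneralLinearGroup.mkOfDetNeZero, M, rep]; ring
  · simp [Matrix.GeneralLinearGroup.mkOfDetNeZero, M, rep]; ring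
  · have e1 : (rep ((1 : ZMod 7) : PL)).1 = 1 := rfl
    have e2 : (rep ((1 : ZMod 7) : PL)).2 = 1 := rfl
    rw [e1, e2]
    simp [Matrix.GeneralLinearGroup.mkOfDetNeZero, M, dt]; ring

/-- Being an (anti-)automorphism of the orientation relation. -/
def Good (π : Equiv.Perm PL) : Prop :=
  (∀ x y z, sg (π x) (π y) (π z) = sg x y z) ∨ (∀ x y z, sg (π x) (π y) (π z) = - sg x y z)

lemma cube_pm : ∀ a : ZMod 7, a ≠ 0 → a ^ 3 = 1 ∨ a ^ 3 = -1 := by decide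

lemma good_mem_range (π : Equiv.Perm PL) (h : Good π) : ∃ g : GL27, psi g = π := by
  obtain ⟨g, h1, h2, h3⟩ := exists_gl (π OnePoint.infty) (π (0 : ZMod 7)) (π (1 : ZMod 7))
    (by rw [π.injective.ne_iff]; decide) (by rw [π.injective.ne_iff]; decide)
    (by rw [π.injective.ne_iff]; decide)
  refine ⟨g, ?_⟩
  let τ : Equiv.Perm PL := (psi g)⁻¹ * π
  have hτ : ∀ x, g • (τ x) = π x := fun x => by
    rw [← psi_apply]; simp [τ]
  have t1 : τ OnePoint.infty = OnePoint.infty := by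
    apply MulAction.injective g; show g • _ = g • _; rw [hτ, h1]
  have t2 : τ (0 : ZMod 7) = ((0 : ZMod 7) : PL) := by
    apply MulAction.injective g; show g • _ = g • _; rw [hτ, h2]
  have t3 : τ (1 : ZMod 7) = ((1 : ZMod 7) : PL) := by
    apply MulAction.injective g; show g • _ = g • _; rw [hτ, h3]
  have hd := cube_pm _ g.det_ne_zero
  have hs : ∃ e : ZMod 7, ∀ x y z, sg (τ x) (τ y) (τ z) = e * sg x y z := by
    have key : ∀ x y z, (g.1.det) ^ 3 * sg (τ x) (τ y) (τ z) = sg (π x) (π y) (π z) := fun x y z => by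
      rw [← sg_smul, hτ, hτ, hτ]
    rcases h with h | h
    · refine ⟨(g.1.det) ^ 3, fun x y z => ?_⟩
      have := h x y z
      rw [← this, ← key, ← mul_assoc, ← pow_add, pow_six _ g.det_ne_zero, one_mul]
    · refine ⟨- (g.1.det) ^ 3, fun x y z => ?_⟩
      have := h x y z
      rw [neg_mul, ← mul_neg, ← this, ← key, ← mul_assoc, ← pow_add, pow_six _ g.det_ne_zero, one_mul]
  obtain ⟨e, he⟩ := hs
  have he1 : e = 1 := by
    have := he OnePoint.infty (0 : ZMod 7) (1 : ZMod 7)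
    rw [t1, t2, t3] at this
    have h0 : sg OnePoint.infty (0 : ZMod 7) (1 : ZMod 7) ≠ 0 := by decide
    exact (mul_right_cancel₀ h0 (by rw [one_mul]; exact this)).symm
  subst he1
  simp only [one_mul] at he
  have t4 : τ (2 : ZMod 7) = ((2 : ZMod 7) : PL) := by
    apply sg_key2
    · have := he OnePoint.infty (0 : ZMod 7) (2 : ZMod 7)
      rwa [t1, t2] at this
    · have := he OnePoint.infty (1 : ZMod 7) (2 : ZMod 7)
      rwa [t1, t3] at this
  have t5 : ∀ x, τ x = x := fun x => by
    apply sg_key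
    · have := he OnePoint.infty (0 : ZMod 7) x
      rwa [t1, t2] at this
    · have := he OnePoint.infty (1 : ZMod 7) x
      rwa [t1, t3] at this
    · have := he OnePoint.infty (2 : ZMod 7) x
      rwa [t1, t4] at this
  ext x
  rw [psi_apply, ← hτ, t5]

lemma card_GL27 : Nat.card GL27 = 2016 := by
  rw [Matrix.card_GL_field]
  simp [Fin.prod_univ_two]

/-- Upper and lower unipotents. -/
def up (t : ZMod 7) : GL27 := Matrix.GeneralLinearGroup.mkOfDetNeZero !![1, t; 0, 1] (by simp)
def lo (t : ZMod 7) : GL27 := Matrix.GeneralLinearGroup.mkOfDetNeZero !![1, 0; t, 1] (by simp)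

lemma up_val (t : ZMod 7) : (up t).1 = !![1, t; 0, 1] := rfl
lemma lo_val (t : ZMod 7) : (lo t).1 = !![1, 0; t, 1] := rfl

lemma up_add (s t : ZMod 7) : up s * up t = up (s + t) := by
  ext i j
  rw [Units.val_mul, up_val, up_val, up_val]
  fin_cases i <;> fin_cases j <;> simp [add_comm]

lemma lo_add (s t : ZMod 7) : lo s * lo t = lo (s + t) := by
  ext i j
  rw [Units.val_mul, lo_val, lo_val, lo_val]
  fin_cases i <;> fin_cases j <;> simp

lemma up_pow (s : ZMod 7) (n : ℕ) : up s ^ n = up (n * s) := by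
  induction n with
  | zero => ext i j; fin_cases i <;> fin_cases j <;> simp [up_val]
  | succ n ih => rw [pow_succ, ih, up_add]; congr 1; push_cast; ring

lemma lo_pow (s : ZMod 7) (n : ℕ) : lo s ^ n = lo (n * s) := by
  induction n with
  | zero => ext i j; fin_cases i <;> fin_cases j <;> simp [lo_val]
  | succ n ih => rw [pow_succ, ih, lo_add]; congr 1; push_cast; ring

lemma cast_ne_zero_of (n : ℕ) (h0 : 0 < n) (h6 : n ≤ 6) : (n : ZMod 7) ≠ 0 := by
  intro h
  rw [ZMod.natCast_eq_zero_iff] at h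
  have := Nat.le_of_dvd h0 h
  omega

lemma up_mem (H : Subgroup GL27) (hi0 : H.index ≠ 0) (hi : H.index ≤ 6) (t : ZMod 7) : up t ∈ H := by
  obtain ⟨n, h0, h1, h2⟩ := Subgroup.exists_pow_mem_of_index_ne_zero hi0 (up 1)
  have hn := cast_ne_zero_of n h0 (h1.trans hi)
  have := H.pow_mem h2 ((t / n : ZMod 7)).val
  rw [up_pow, up_pow] at this
  simpa [hn] using this

lemma lo_mem (H : Subgroup GL27) (hi0 : H.index ≠ 0) (hi : H.index ≤ 6) (t : ZMod 7) : lo t ∈ H := by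
  obtain ⟨n, h0, h1, h2⟩ := Subgroup.exists_pow_mem_of_index_ne_zero hi0 (lo 1)
  have hn := cast_ne_zero_of n h0 (h1.trans hi)
  have := H.pow_mem h2 ((t / n : ZMod 7)).val
  rw [lo_pow, lo_pow] at this
  simpa [hn] using this

lemma sl_mem (H : Subgroup GL27) (hi0 : H.index ≠ 0) (hi : H.index ≤ 6) (g : GL27)
    (hg : g.1.det = 1) : g ∈ H := by
  have main : ∀ g : GL27, g.1.det = 1 → g 1 0 ≠ 0 → g ∈ H := by
    intro g hg hc
    have : g = up ((g 0 0 - 1) / g 1 0) * lo (g 1 0) * up ((g 1 1 - 1) / g 1 0) := by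
      rw [Matrix.det_fin_two] at hg
      ext i j
      rw [Units.val_mul, Units.val_mul, up_val, lo_val, up_val]
      have h01 : g 0 1 = (g 0 0 * g 1 1 - 1) / g 1 0 := by
        field_simp
        linear_combination -hg
      fin_cases i <;> fin_cases j
      · simp; field_simp; ring
      · simp; rw [h01]; field_simp; ring
      · simp
      · simp; field_simp; ring
    rw [this]
    exact H.mul_mem (H.mul_mem (up_mem H hi0 hi _) (lo_mem H hi0 hi _)) (up_mem H hi0 hi _)
  by_cases hc : g 1 0 = 0
  · have h2 := main (lo 1 * g) (by rw [Units.val_mul, Matrix.det_mul, hg, lo_val]; simp) (by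
      rw [Matrix.det_fin_two, hc] at hg
      rw [Units.val_mul, lo_val, Matrix.mul_apply]
      simp [Fin.sum_univ_two, hc]
      intro h; rw [h] at hg; simp at hg)
    exact (H.mul_mem_cancel_left (lo_mem H hi0 hi 1)).mp h2
  · exact main g hg hc

lemma cube_one : ∀ a : ZMod 7, a ^ 3 = 1 → ∃ l : ZMod 7, l ≠ 0 ∧ l * l = a := by decide

lemma mem_of_cube_one (H : Subgroup GL27) (hi0 : H.index ≠ 0) (hi : H.index ≤ 6)
    (hZ : Subgroup.center GL27 ≤ H) (g : GL27) (hg : g.1.det ^ 3 = 1) : g ∈ H := by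
  obtain ⟨l, hl, hl2⟩ := cube_one _ hg
  let d : GL27 := Matrix.GeneralLinearGroup.mkOfDetNeZero !![l, 0; 0, l] (by simp [hl])
  have hd : d ∈ H := hZ ((mem_center_iff _).mpr (by
    simp [d, Matrix.GeneralLinearGroup.mkOfDetNeZero]))
  have hdd : d.1.det = l * l := by
    simp [d, Matrix.GeneralLinearGroup.mkOfDetNeZero]
  have : d⁻¹ * g ∈ H := by
    apply sl_mem H hi0 hi
    have h1 : d.1.det * (d⁻¹ * g).1.det = g.1.det := by
      rw [← Matrix.det_mul, ← Units.val_mul, mul_inv_cancel_left]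
    rw [hdd, ← hl2] at h1
    exact mul_left_cancel₀ (mul_ne_zero hl hl) (by rw [h1, mul_one])
  exact (H.mul_mem_cancel_left (H.inv_mem hd)).mp this

theorem group_main {G : Type*} [Group G] (Φ : G →* Equiv.Perm PL) (hinj : Function.Injective Φ)
    (hgood : ∀ σ, Good (Φ σ))
    (hodd : ∃ σ, ∀ x y z, sg (Φ σ x) (Φ σ y) (Φ σ z) = - sg x y z)
    (hcard : 56 ≤ Nat.card G) : Nonempty (G ≃* PGL2F7) := by
  have hle : Φ.range ≤ psi.range := by
    rintro _ ⟨σ, rfl⟩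
    exact good_mem_range _ (hgood σ)
  let H : Subgroup GL27 := Φ.range.comap psi
  have hZ : Subgroup.center GL27 ≤ H := by
    rw [← ker_psi]; exact MonoidHom.ker_le_comap psi _
  have hcenter : Nat.card (Subgroup.center GL27) = 6 := by
    rw [Matrix.GeneralLinearGroup.center_eq_range_scalar]
    rw [← Nat.card_congr (MonoidHom.ofInjective (f := Matrix.GeneralLinearGroup.scalar (Fin 2) (R := ZMod 7)) ?_).toEquiv]
    · rw [Nat.card_eq_fintype_card, ZMod.card_units]
    · intro a b hab
      have := congrArg (fun g : GL27 => g 0 0) hab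
      ext
      simpa using this
  have hHcard : Nat.card H = 6 * Nat.card G := by
    have e1 : Nat.card H = Nat.card (psi.subgroupMap H).ker * Nat.card (psi.subgroupMap H).range := by
      rw [← Subgroup.index_ker, Subgroup.card_mul_index]
    have e2 : Nat.card (psi.subgroupMap H).range = Nat.card G := by
      rw [MonoidHom.range_eq_top.mpr (psi.subgroupMap_surjective H), Subgroup.card_top]
      have : H.map psi = Φ.range := by
        rw [Subgroup.map_comap_eq, inf_eq_right.mpr hle]
      rw [this]
      exact (Nat.card_congr (MonoidHom.ofInjective hinj).toEquiv).symm
    have e3 : Nat.card (psi.subgroupMap H).ker = 6 := by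
      rw [← hcenter]
      have h3 : (psi.subgroupMap H).ker = (Subgroup.center GL27).subgroupOf H := by
        ext x
        rw [MonoidHom.mem_ker, Subgroup.mem_subgroupOf, ← ker_psi, MonoidHom.mem_ker]
        rw [Subtype.ext_iff]; rfl
      rw [h3]
      exact Nat.card_congr (Subgroup.subgroupOfEquivOfLe hZ).toEquiv
    rw [e1, e2, e3]
  have hmul := H.card_mul_index
  rw [card_GL27, hHcard] at hmul
  have hi0 : H.index ≠ 0 := by intro h; rw [h] at hmul; omega
  have hi : H.index ≤ 6 := by
    by_contra hcon
    have : 56 * 7 ≤ Nat.card G * H.index := Nat.mul_le_mul hcard (by omega)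
    nlinarith
  have hH : ∀ g : GL27, g ∈ H := by
    intro g
    rcases cube_pm _ g.det_ne_zero with h | h
    · exact mem_of_cube_one H hi0 hi hZ g h
    · obtain ⟨σ, hσ⟩ := hodd
      obtain ⟨k, hk⟩ := good_mem_range _ (hgood σ)
      have hkH : k ∈ H := ⟨σ, hk.symm⟩
      have hkd : k.1.det ^ 3 = -1 := by
        have h1 := sg_smul k OnePoint.infty (0 : ZMod 7) (1 : ZMod 7)
        rw [← psi_apply, ← psi_apply, ← psi_apply, hk, hσ] at h1
        have h0 : sg OnePoint.infty (0 : ZMod 7) (1 : ZMod 7) ≠ 0 := by decide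
        exact mul_right_cancel₀ h0 (by rw [← h1, neg_one_mul])
      have : k * g ∈ H := by
        apply mem_of_cube_one H hi0 hi hZ
        rw [Units.val_mul, Matrix.det_mul, mul_pow, hkd, h]; norm_num
      exact (H.mul_mem_cancel_left hkH).mp this
  have hrange : Φ.range = psi.range := by
    apply le_antisymm hle
    rintro _ ⟨g, rfl⟩
    exact hH g
  refine ⟨(MonoidHom.ofInjective hinj).trans ?_⟩
  refine (MulEquiv.subgroupCongr hrange).trans ?_
  refine (QuotientGroup.quotientKerEquivRange psi).symm.trans ?_
  exact QuotientGroup.quotientMulEquivOfEq ker_psi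

end PartA


namespace PartB
open PartA

def pf {R : Type*} [CommRing R] (u v w : R) : R :=
    5793270 + 12949132 * u + 9716945 * u ^ 2 - 8738317 * v + 3614730 * u ^ 3 - 6566784 * u * v +
      3295446 * w + 764190 * u ^ 4 - 2066981 * u ^ 2 * v + 496748 * v ^ 2 + 1429225 * u * w +
      95760 * u ^ 5 - 341544 * u ^ 3 * v + 193004 * u * v ^ 2 + 257320 * u ^ 2 * w - 82348 * v * w +
      6965 * u ^ 6 - 30779 * u ^ 4 * v + 28777 * u ^ 2 * v ^ 2 - 3689 * v ^ 3 + 22876 * u ^ 3 * w -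
      17262 * u * v * w + 266 * u ^ 7 - 1414 * u ^ 5 * v + 1932 * u ^ 3 * v ^ 2 - 686 * u * v ^ 3 +
      952 * u ^ 4 * w - 1190 * u ^ 2 * v * w + 252 * v ^ 2 * w + 4 * u ^ 8 - 26 * u ^ 6 * v +
      53 * u ^ 4 * v ^ 2 - 46 * u ^ 2 * v ^ 3 + 18 * v ^ 4 + 12 * u ^ 5 * w - 15 * u ^ 3 * v * w

def pg {R : Type*} [CommRing R] (u v w : R) : R :=
    -(45346) - 26159 * u - 6356 * u ^ 2 + 2604 * v - 832 * u ^ 3 + 931 * u * v - 253 * w -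
      60 * u ^ 4 + 128 * u ^ 2 * v - 44 * v ^ 2 - 38 * u * w - 2 * u ^ 5 + 7 * u ^ 3 * v -
      6 * u * v ^ 2 - 2 * u ^ 2 * w + 2 * v * w

def pR1 {R : Type*} [CommRing R] (u v w : R) : R :=
    4018 + 8624 * u + 5915 * u ^ 2 - 5915 * v + 1904 * u ^ 3 - 3808 * u * v + 1904 * w +
      322 * u ^ 4 - 966 * u ^ 2 * v + 322 * v ^ 2 + 644 * u * w + 28 * u ^ 5 - 112 * u ^ 3 * v +
      84 * u * v ^ 2 + 84 * u ^ 2 * w - 56 * v * w + u ^ 6 - 5 * u ^ 4 * v + 6 * u ^ 2 * v ^ 2 -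
      v ^ 3 + 4 * u ^ 3 * w - 6 * u * v * w + w ^ 2

def pR2 {R : Type*} [CommRing R] (u v w : R) : R :=
    49 + 8624 * w + 5915 * u * w + 1904 * u ^ 2 * w - 1904 * v * w + 322 * u ^ 3 * w -
      644 * u * v * w + 322 * w ^ 2 + 28 * u ^ 4 * w - 84 * u ^ 2 * v * w + 28 * v ^ 2 * w +
      56 * u * w ^ 2 + u ^ 5 * w - 4 * u ^ 3 * v * w + 3 * u * v ^ 2 * w + 3 * u ^ 2 * w ^ 2 -
      2 * v * w ^ 2

def qa {R : Type*} [CommRing R] (u v w : R) : R :=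
    8351596554 + 19412304520 * u + 15789642939 * u ^ 2 - 12901375375 * v + 6628679036 * u ^ 3 -
      11074480984 * u * v + 5314377516 * w + 1661424870 * u ^ 4 - 4139020984 * u ^ 2 * v +
      774566422 * v ^ 2 + 2698247230 * u * w + 264795412 * u ^ 5 - 868956396 * u ^ 3 * v +
      398199284 * u * v ^ 2 + 565949216 * u ^ 2 * w - 53519368 * v * w + 27393905 * u ^ 6 -
      111222657 * u ^ 4 * v + 86907800 * u ^ 2 * v ^ 2 - 9367197 * v ^ 3 + 57225756 * u ^ 3 * w +
      223706 * u * v * w - 12097701 * w ^ 2 + 1820084 * u ^ 7 - 8844164 * u ^ 5 * v +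
      10240916 * u ^ 3 * v ^ 2 - 3050124 * u * v ^ 3 + 1937488 * u ^ 4 * w +
      4447212 * u ^ 2 * v * w - 1241464 * v ^ 2 * w - 3634092 * u * w ^ 2 + 74284 * u ^ 8 -
      426104 * u ^ 6 * v + 691194 * u ^ 4 * v ^ 2 - 416612 * u ^ 2 * v ^ 3 + 82684 * v ^ 4 -
      145824 * u ^ 5 * w + 929054 * u ^ 3 * v * w - 571536 * u * v ^ 2 * w -
      464184 * u ^ 2 * w ^ 2 + 191268 * v * w ^ 2 + 1680 * u ^ 9 - 11368 * u ^ 7 * v +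
      25284 * u ^ 5 * v ^ 2 - 26264 * u ^ 3 * v ^ 3 + 12264 * u * v ^ 4 - 16240 * u ^ 6 * w +
      77756 * u ^ 4 * v * w - 78120 * u ^ 2 * v ^ 2 * w + 11760 * v ^ 3 * w -
      28728 * u ^ 3 * w ^ 2 + 28728 * u * v * w ^ 2 + 16 * u ^ 10 - 128 * u ^ 8 * v +
      392 * u ^ 6 * v ^ 2 - 688 * u ^ 4 * v ^ 3 + 720 * u ^ 2 * v ^ 4 - 324 * v ^ 5 -
      484 * u ^ 7 * w + 2632 * u ^ 5 * v * w - 4180 * u ^ 3 * v ^ 2 * w + 2088 * u * v ^ 3 * w -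
      756 * u ^ 4 * w ^ 2 + 1512 * u ^ 2 * v * w ^ 2 - 756 * v ^ 2 * w ^ 2

def qb {R : Type*} [CommRing R] (u v w : R) : R :=
    107394672 + 261788576 * u + 236700968 * u ^ 2 - 192644480 * v + 103805520 * u ^ 3 -
      166516896 * u * v + 41562192 * w + 25652032 * u ^ 4 - 60684316 * u ^ 2 * v +
      14637700 * v ^ 2 + 20284040 * u * w + 3819984 * u ^ 5 - 11932200 * u ^ 3 * v +
      6648488 * u * v ^ 2 + 4335240 * u ^ 2 * w - 1930712 * v * w + 344904 * u ^ 6 -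
      1345932 * u ^ 4 * v + 1238412 * u ^ 2 * v ^ 2 - 178640 * v ^ 3 + 478268 * u ^ 3 * w -
      469644 * u * v * w + 17696 * u ^ 7 - 83832 * u ^ 5 * v + 111832 * u ^ 3 * v ^ 2 -
      40544 * u * v ^ 3 + 27048 * u ^ 4 * w - 43848 * u ^ 2 * v * w + 10416 * v ^ 2 * w +
      404 * u ^ 8 - 2284 * u ^ 6 * v + 4096 * u ^ 4 * v ^ 2 - 2544 * u ^ 2 * v ^ 3 + 272 * v ^ 4 +
      628 * u ^ 5 * w - 1476 * u ^ 3 * v * w + 792 * u * v ^ 2 * w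

/-- The polynomial `P(t)`; in terms of `t = z - 8` the equation is `P(t) = J t`. -/
def pP {R : Type*} [CommRing R] (t : R) : R := (t ^ 2 + 13 * t + 49) * (t ^ 2 + 5 * t + 1) ^ 3

def dl {R : Type*} [CommRing R] (a b c : R) : R := (a - b) * (b - c) * (c - a)

def fa {R : Type*} [CommRing R] (a b c : R) : R := pf (a + b + c) (a * b + b * c + c * a) (a * b * c)

def ga {R : Type*} [CommRing R] (a b c : R) : R := pg (a + b + c) (a * b + b * c + c * a) (a * b * c)

lemma map_fa {R S : Type*} [CommRing R] [CommRing S] (φ : R →+* S) (a b c : R) :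
    φ (fa a b c) = fa (φ a) (φ b) (φ c) := by
  simp only [fa, pf, map_add, map_sub, map_mul, map_pow, map_neg, map_ofNat]

lemma map_ga {R S : Type*} [CommRing R] [CommRing S] (φ : R →+* S) (a b c : R) :
    φ (ga a b c) = ga (φ a) (φ b) (φ c) := by
  simp only [ga, pg, map_add, map_sub, map_mul, map_pow, map_neg, map_ofNat]

lemma map_dl {R S : Type*} [CommRing R] [CommRing S] (φ : R →+* S) (a b c : R) :
    φ (dl a b c) = dl (φ a) (φ b) (φ c) := by
  simp only [dl, map_sub, map_mul]

set_option maxHeartbeats 4000000 in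
lemma cert {R : Type*} [CommRing R] (u v w : R) :
    pf u v w ^ 2 + 7 * (u ^ 2 * v ^ 2 - 4 * v ^ 3 - 4 * u ^ 3 * w + 18 * u * v * w - 27 * w ^ 2) *
      pg u v w ^ 2 = qa u v w * pR1 u v w + qb u v w * pR2 u v w := by
  unfold pf pg qa qb pR1 pR2
  ring

lemma rel1 {E : Type*} [Field E] (J a b c : E) (hab : a ≠ b) (hbc : b ≠ c) (hca : c ≠ a)
    (ha : pP a = J * a) (hb : pP b = J * b) (hc : pP c = J * c) :
    pR1 (a + b + c) (a * b + b * c + c * a) (a * b * c) = 0 := by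
  have h : dl a b c ≠ 0 :=
    mul_ne_zero (mul_ne_zero (sub_ne_zero.mpr hab) (sub_ne_zero.mpr hbc)) (sub_ne_zero.mpr hca)
  refine (mul_eq_zero.mp (?_ : dl a b c * _ = 0)).resolve_left h
  unfold pP at ha hb hc
  unfold dl pR1
  linear_combination (-(b - c)) * ha - (c - a) * hb - (a - b) * hc

lemma rel2 {E : Type*} [Field E] (J a b c : E) (hab : a ≠ b) (hbc : b ≠ c) (hca : c ≠ a)
    (ha : pP a = J * a) (hb : pP b = J * b) (hc : pP c = J * c) :
    pR2 (a + b + c) (a * b + b * c + c * a) (a * b * c) = 0 := by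
  have h : dl a b c ≠ 0 :=
    mul_ne_zero (mul_ne_zero (sub_ne_zero.mpr hab) (sub_ne_zero.mpr hbc)) (sub_ne_zero.mpr hca)
  refine (mul_eq_zero.mp (?_ : dl a b c * _ = 0)).resolve_left h
  unfold pP at ha hb hc
  unfold dl pR2
  linear_combination (-(b - c) * b * c) * ha - (c - a) * c * a * hb - (a - b) * a * b * hc

lemma rel {E : Type*} [Field E] (J a b c : E) (hab : a ≠ b) (hbc : b ≠ c) (hca : c ≠ a)
    (ha : pP a = J * a) (hb : pP b = J * b) (hc : pP c = J * c) :
    fa a b c ^ 2 = -7 * (dl a b c * ga a b c) ^ 2 := by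
  have h1 := rel1 J a b c hab hbc hca ha hb hc
  have h2 := rel2 J a b c hab hbc hca ha hb hc
  have h3 := cert (a + b + c) (a * b + b * c + c * a) (a * b * c)
  rw [h1, h2] at h3
  have h4 : dl a b c ^ 2 = (a + b + c) ^ 2 * (a * b + b * c + c * a) ^ 2 -
      4 * (a * b + b * c + c * a) ^ 3 - 4 * (a + b + c) ^ 3 * (a * b * c) +
      18 * (a + b + c) * (a * b + b * c + c * a) * (a * b * c) - 27 * (a * b * c) ^ 2 := by
    unfold dl; ring
  rw [← h4] at h3
  unfold fa ga
  linear_combination h3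

/-- The eight roots modulo 107 (for `J = 82`), labelled by the projective line. -/
def rt (x : PL) : ℤ := OnePoint.elim x 17 (fun t => [21, 60, 80, 65, 82, 84, 98].getD t.val 0)

/-- The orientation as an integer sign. -/
def sgZ (x y z : PL) : ℤ := if sg x y z = 1 then 1 else -1

lemma rt_root : ∀ x : PL, (pP (rt x) - 82 * rt x) % 107 = 0 := by decide +kernel

lemma rt_inj : ∀ x y : PL, (rt x - rt y) % 107 = 0 → x = y := by decide +kernel

lemma rt_check : ∀ x y z : PL, x ≠ y → y ≠ z → z ≠ x →
    (fa (rt x) (rt y) (rt z) + sgZ x y z * 10 * (dl (rt x) (rt y) (rt z) * ga (rt x) (rt y) (rt z))) % 107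
      ≠ 0 := by decide +kernel


/-- The defining polynomial in the coordinate `t = z - 8`. -/
noncomputable def PJ {R : Type*} [CommRing R] (j : R) : R[X] :=
  (X ^ 2 + 13 * X + 49) * (X ^ 2 + 5 * X + 1) ^ 3 - C j * X

lemma PJ_eval {R : Type*} [CommRing R] (j t : R) : (PJ j).eval t = pP t - j * t := by
  simp [PJ, pP]

lemma map_pP {R S : Type*} [CommRing R] [CommRing S] (φ : R →+* S) (a : R) :
    φ (pP a) = pP (φ a) := by
  simp only [pP, map_add, map_mul, map_pow, map_ofNat, map_one]

lemma PJ_map {R S : Type*} [CommRing R] [CommRing S] (φ : R →+* S) (j : R) :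
    (PJ j).map φ = PJ (φ j) := by
  simp [PJ, Polynomial.map_mul, Polynomial.map_pow]

lemma PJ_monic_deg {R : Type*} [CommRing R] [Nontrivial R] (j : R) :
    (PJ j).Monic ∧ (PJ j).natDegree = 8 := by
  have h1 : (X ^ 2 + 13 * X + 49 : R[X]).natDegree = 2 := by
    have : (X ^ 2 + 13 * X + 49 : R[X]) = X ^ 2 + C 13 * X + C 49 := by
      rw [map_ofNat, map_ofNat]
    rw [this]; compute_degree!
  have h1m : (X ^ 2 + 13 * X + 49 : R[X]).Monic := by
    have : (X ^ 2 + 13 * X + 49 : R[X]) = X ^ 2 + C 13 * X + C 49 := by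
      rw [map_ofNat, map_ofNat]
    rw [this]; monicity!
  have h2 : (X ^ 2 + 5 * X + 1 : R[X]).natDegree = 2 := by
    have : (X ^ 2 + 5 * X + 1 : R[X]) = X ^ 2 + C 5 * X + C 1 := by
      rw [map_ofNat, map_one]
    rw [this]; compute_degree!
  have h2m : (X ^ 2 + 5 * X + 1 : R[X]).Monic := by
    have : (X ^ 2 + 5 * X + 1 : R[X]) = X ^ 2 + C 5 * X + C 1 := by
      rw [map_ofNat, map_one]
    rw [this]; monicity!
  have h3m : ((X ^ 2 + 13 * X + 49) * (X ^ 2 + 5 * X + 1) ^ 3 : R[X]).Monic := h1m.mul (h2m.pow 3)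
  have h3 : ((X ^ 2 + 13 * X + 49) * (X ^ 2 + 5 * X + 1) ^ 3 : R[X]).natDegree = 8 := by
    rw [h1m.natDegree_mul (h2m.pow 3), h2m.natDegree_pow, h1, h2]
  have h4 : (C j * X : R[X]).natDegree ≤ 1 := (natDegree_C_mul_le _ _).trans natDegree_X_le
  have h5 : (C j * X : R[X]).degree < ((X ^ 2 + 13 * X + 49) * (X ^ 2 + 5 * X + 1) ^ 3 : R[X]).degree := by
    apply degree_lt_degree; omega
  refine ⟨h3m.sub_of_left h5, ?_⟩
  unfold PJ
  rw [natDegree_sub_eq_left_of_natDegree_lt (by omega), h3]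

universe u

/-- Existence of a reduction modulo a prime over `(107, J - 82)`. -/
lemma reduction_hom {E : Type u} [Field E] (J : E) (hJ : Transcendental ℤ J) :
    ∃ (B : Subring E) (D : Type u) (_ : CommRing D) (_ : IsDomain D) (φ : B →+* D) (hJB : J ∈ B),
      φ ⟨J, hJB⟩ = 82 ∧ (∀ n : ℤ, (n : D) = 0 → n % 107 = 0) ∧ (107 : D) = 0 ∧
      (∀ x : E, IsIntegral B x → x ∈ B) := by
  let : Algebra ℤ[X] E := (aeval J).toRingHom.toAlgebra
  have hal : ∀ p : ℤ[X], algebraMap ℤ[X] E p = aeval J p := fun p => rfl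
  have : Fact (Nat.Prime 107) := ⟨by norm_num⟩
  let ψ : ℤ[X] →+* ZMod 107 := eval₂RingHom (Int.castRingHom (ZMod 107)) 82
  let B := integralClosure ℤ[X] E
  have hP : (RingHom.ker ψ).IsPrime := RingHom.ker_isPrime ψ
  have hk : RingHom.ker (algebraMap ℤ[X] B) ≤ RingHom.ker ψ := by
    intro p hp
    have h0 : algebraMap ℤ[X] B p = 0 := hp
    have h1 : aeval J p = 0 := by
      rw [← hal, IsScalarTower.algebraMap_apply ℤ[X] B E, h0, map_zero]
    have : p = 0 := (transcendental_iff.mp hJ) p h1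
    rw [this]; exact Ideal.zero_mem _
  obtain ⟨Q, hQ, hQP⟩ := Ideal.exists_ideal_over_prime_of_isIntegral_of_isDomain (S := B)
    (RingHom.ker ψ) hk
  have key : ∀ p : ℤ[X], algebraMap ℤ[X] B p ∈ Q ↔ ψ p = 0 := by
    intro p
    rw [← RingHom.mem_ker, ← hQP, Ideal.mem_comap]
  have hJB : J ∈ B.toSubring := by
    have : algebraMap ℤ[X] E X ∈ B := B.algebraMap_mem X
    rwa [hal, aeval_X] at this
  have hJX : (⟨J, hJB⟩ : B) = algebraMap ℤ[X] B X := by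
    apply Subtype.ext
    change J = algebraMap ℤ[X] E X
    rw [hal, aeval_X]
  refine ⟨B.toSubring, B ⧸ Q, inferInstance, inferInstance, Ideal.Quotient.mk Q, hJB, ?_, ?_, ?_, ?_⟩
  · have h : Ideal.Quotient.mk Q (algebraMap ℤ[X] B (X - 82)) = 0 := by
      rw [Ideal.Quotient.eq_zero_iff_mem, key]
      simp [ψ]
    change Ideal.Quotient.mk Q (⟨J, hJB⟩ : B) = 82
    rw [hJX]
    rw [map_sub, map_sub, sub_eq_zero] at h
    rw [h, map_ofNat, map_ofNat]
  · intro n hn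
    have h : Ideal.Quotient.mk Q (algebraMap ℤ[X] B (n : ℤ[X])) = 0 := by
      rw [map_intCast, map_intCast, hn]
    rw [Ideal.Quotient.eq_zero_iff_mem, key] at h
    have h2 : ((n : ℤ) : ZMod 107) = 0 := by simpa [ψ] using h
    rw [ZMod.intCast_zmod_eq_zero_iff_dvd] at h2
    omega
  · have h : Ideal.Quotient.mk Q (algebraMap ℤ[X] B (107 : ℤ[X])) = 0 := by
      rw [Ideal.Quotient.eq_zero_iff_mem, key]
      rw [map_ofNat]; rfl
    rwa [map_ofNat, map_ofNat] at h
  · intro x hx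
    change x ∈ B
    exact isIntegral_trans (A := B) x hx

lemma reduction {E : Type*} [Field E] [IsAlgClosed E] (J : E) (hJ : Transcendental ℤ J) :
    ∃ (lab : PL → E) (s : E), Function.Injective lab ∧ (∀ x, pP (lab x) = J * lab x) ∧
      (∀ t, pP t = J * t → ∃ x, lab x = t) ∧ s ^ 2 = -7 ∧
      ∀ x y z, x ≠ y → y ≠ z → z ≠ x → fa (lab x) (lab y) (lab z) +
        sgZ x y z * s * (dl (lab x) (lab y) (lab z) * ga (lab x) (lab y) (lab z)) ≠ 0 := by
  classical
  obtain ⟨B, D, _, _, φ, hJB, hφJ, hintg, h107, hcl⟩ := reduction_hom J hJ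
  have h107' : ∀ n : ℤ, n % 107 = 0 → (n : D) = 0 := by
    intro n hn
    obtain ⟨k, rfl⟩ := Int.dvd_of_emod_eq_zero hn
    push_cast; rw [h107, zero_mul]
  obtain ⟨hmon, hdeg⟩ := PJ_monic_deg J
  have hrt : ∀ t, t ∈ (PJ J).roots ↔ pP t = J * t := by
    intro t
    rw [mem_roots hmon.ne_zero, IsRoot.def, PJ_eval, sub_eq_zero]
  have hB : ∀ t, pP t = J * t → t ∈ B := by
    intro t ht
    apply hcl
    refine ⟨PJ (⟨J, hJB⟩ : B), (PJ_monic_deg _).1, ?_⟩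
    rw [← eval_map, PJ_map, PJ_eval, ht]
    exact sub_self _
  obtain ⟨sB, hsB⟩ : ∃ sB : Multiset B, sB.map (fun b : B => (b : E)) = (PJ J).roots := by
    refine ⟨(PJ J).roots.attach.map (fun r => ⟨r.1, hB _ ((hrt _).1 r.2)⟩), ?_⟩
    rw [Multiset.map_map]
    exact Multiset.attach_map_val _
  have hprod : ∀ b : B, (sB.map (fun r => b - r)).prod = pP b - ⟨J, hJB⟩ * b := by
    intro b
    have h1 : PJ J = ((PJ J).roots.map (fun a => X - C a)).prod :=
      (IsAlgClosed.splits (PJ J)).eq_prod_roots_of_monic hmon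
    have h2 : pP (b : E) - J * b = ((PJ J).roots.map (fun a => (b : E) - a)).prod := by
      rw [← PJ_eval]
      conv_lhs => rw [h1]
      rw [eval_multiset_prod, Multiset.map_map]
      simp
    apply Subtype.ext
    have h3 : ((pP b - ⟨J, hJB⟩ * b : B) : E) = pP (b : E) - J * b := by
      have := map_pP B.subtype b
      change B.subtype (pP b) - J * b = _
      rw [this]; rfl
    rw [h3, h2, ← hsB, Multiset.map_map]
    change B.subtype _ = _
    rw [map_multiset_prod, Multiset.map_map]
    simp
  have hex : ∀ x : PL, ∃ r : B, pP (r : E) = J * r ∧ φ r = (rt x : D) := by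
    intro x
    have h1 := congrArg φ (hprod ((rt x : ℤ) : B))
    have h2 : φ (pP ((rt x : ℤ) : B) - ⟨J, hJB⟩ * ((rt x : ℤ) : B)) = 0 := by
      rw [map_sub, map_mul, hφJ, map_pP, map_intCast]
      have h3 := h107' _ (rt_root x)
      have h4 := map_pP (Int.castRingHom D) (rt x)
      simp only [eq_intCast] at h4
      rw [← h3, ← h4]
      push_cast
      rfl
    rw [h2, map_multiset_prod, Multiset.map_map, Multiset.prod_eq_zero_iff, Multiset.mem_map] at h1
    obtain ⟨r, hr, h3⟩ := h1
    refine ⟨r, ?_, ?_⟩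
    · rw [← hrt, ← hsB]; exact Multiset.mem_map_of_mem _ hr
    · have h4 : φ (((rt x : ℤ) : B) - r) = 0 := h3
      rw [map_sub, map_intCast, sub_eq_zero] at h4
      exact h4.symm
  choose l hl1 hl2 using hex
  have hinj : Function.Injective (fun x => (l x : E)) := by
    intro x y hxy
    have h : l x = l y := Subtype.ext hxy
    apply rt_inj
    apply hintg
    push_cast
    rw [← hl2, ← hl2, h, sub_self]
  obtain ⟨s, hs, hsφ⟩ : ∃ s : B, s ^ 2 = -7 ∧ φ s = 10 := by
    obtain ⟨s1, hs1⟩ := IsAlgClosed.exists_pow_nat_eq (-7 : E) (n := 2) (by norm_num)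
    have hs1B : s1 ∈ B := by
      apply hcl
      refine IsIntegral.of_pow (n := 2) (by norm_num) ?_
      rw [hs1]
      have : (-7 : E) = algebraMap B E (-7) := by rw [map_neg, map_ofNat]
      rw [this]; exact isIntegral_algebraMap
    have hs2 : (⟨s1, hs1B⟩ : B) ^ 2 = -7 := by
      apply Subtype.ext
      push_cast
      exact hs1
    have h3 : (φ ⟨s1, hs1B⟩) ^ 2 = 10 ^ 2 := by
      rw [← map_pow, hs2, map_neg, map_ofNat]
      linear_combination -h107
    rcases sq_eq_sq_iff_eq_or_eq_neg.mp h3 with h | h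
    · exact ⟨_, hs2, h⟩
    · refine ⟨-⟨s1, hs1B⟩, by rw [neg_sq, hs2], by rw [map_neg, h, neg_neg]⟩
  refine ⟨fun x => l x, s, hinj, hl1, ?_, ?_, ?_⟩
  · intro t ht
    have hcard : (PJ J).roots.toFinset.card ≤ 8 :=
      (Multiset.toFinset_card_le _).trans ((card_roots' _).trans hdeg.le)
    have hsub : Finset.univ.image (fun x => (l x : E)) ⊆ (PJ J).roots.toFinset := by
      intro y hy
      obtain ⟨x, -, rfl⟩ := Finset.mem_image.mp hy
      rw [Multiset.mem_toFinset, hrt]; exact hl1 x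
    have hc2 : (Finset.univ.image (fun x => (l x : E))).card = 8 := by
      rw [Finset.card_image_of_injective _ hinj]
      rfl
    have := Finset.eq_of_subset_of_card_le hsub (by omega)
    have ht2 : t ∈ (PJ J).roots.toFinset := by rw [Multiset.mem_toFinset, hrt]; exact ht
    rw [← this] at ht2
    obtain ⟨x, -, hx⟩ := Finset.mem_image.mp ht2
    exact ⟨x, hx⟩
  · have := congrArg B.subtype hs
    rwa [map_pow, map_neg, map_ofNat] at this
  · intro x y z hxy hyz hzx h0
    apply rt_check x y z hxy hyz hzx
    apply hintg
    have h1 : fa (l x) (l y) (l z) +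
        sgZ x y z * s * (dl (l x) (l y) (l z) * ga (l x) (l y) (l z)) = 0 := by
      apply B.subtype_injective
      rw [map_zero, map_add, map_mul, map_mul, map_mul, map_fa, map_dl, map_ga, map_intCast]
      exact h0
    have h2 := congrArg φ h1
    rw [map_add, map_mul, map_mul, map_mul, map_fa, map_dl, map_ga, map_intCast, hl2, hl2, hl2, hsφ,
      map_zero] at h2
    rw [← h2]
    have e1 := map_fa (Int.castRingHom D) (rt x) (rt y) (rt z)
    have e2 := map_ga (Int.castRingHom D) (rt x) (rt y) (rt z)
    have e3 := map_dl (Int.castRingHom D) (rt x) (rt y) (rt z)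
    simp only [eq_intCast] at e1 e2 e3
    push_cast
    rw [e1, e2, e3]

lemma PJ_irreducible : Irreducible (PJ (RatFunc.X : RatFunc ℚ)) := by
  have h1 : PJ (RatFunc.X : RatFunc ℚ) = (PJ (X : ℚ[X])).map (algebraMap ℚ[X] (RatFunc ℚ)) := by
    rw [PJ_map, RatFunc.algebraMap_X]
  rw [h1, ← (PJ_monic_deg (X : ℚ[X])).1.irreducible_iff_irreducible_map_fraction_map]
  have h2 : PJ (X : ℚ[X]) = Bivariate.swap (C (-X) * X + C (pP (X : ℚ[X]))) := by
    simp only [PJ, pP, map_add, map_mul, map_neg, map_pow, Bivariate.swap_Y, Bivariate.swap_X,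
      map_ofNat, map_one]
    ring
  rw [h2, MulEquiv.irreducible_iff]
  apply irreducible_C_mul_X_add_C (neg_ne_zero.mpr X_ne_zero)
  apply IsCoprime.isRelPrime
  refine ⟨C (1 / 49) * (X ^ 7 + 28 * X ^ 6 + 322 * X ^ 5 + 1904 * X ^ 4 + 5915 * X ^ 3 +
    8624 * X ^ 2 + 4018 * X + 748), C (1 / 49), ?_⟩
  have h3 : (C (1 / 49) : ℚ[X]) * 49 = 1 := by
    rw [← map_ofNat C 49, ← map_mul]; norm_num
  rw [pP]
  linear_combination h3

/-- Coefficients for the inverted divided difference. -/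
noncomputable def RV {R : Type*} [CommRing R] (t : R) : R[X] :=
  C 1 + C (t + 28) * X + C (t ^ 2 + 28 * t + 322) * X ^ 2 +
  C (t ^ 3 + 28 * t ^ 2 + 322 * t + 1904) * X ^ 3 +
  C (t ^ 4 + 28 * t ^ 3 + 322 * t ^ 2 + 1904 * t + 5915) * X ^ 4 +
  C (t ^ 5 + 28 * t ^ 4 + 322 * t ^ 3 + 1904 * t ^ 2 + 5915 * t + 8624) * X ^ 5 +
  C (t ^ 6 + 28 * t ^ 5 + 322 * t ^ 4 + 1904 * t ^ 3 + 5915 * t ^ 2 + 8624 * t + 4018) * X ^ 6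

noncomputable def QV : ℚ[X][X] := X ^ 7 - C (C (1 / 49) * X) * RV (X : ℚ[X])

lemma RV_deg {R : Type*} [CommRing R] (t : R) : (RV t).natDegree ≤ 6 := by
  unfold RV
  compute_degree!

lemma QV_monic_deg : QV.Monic ∧ QV.natDegree = 7 := by
  have h : (C (C (1 / 49 : ℚ) * X) * RV (X : ℚ[X]) : ℚ[X][X]).natDegree ≤ 6 :=
    (natDegree_C_mul_le _ _).trans (RV_deg _)
  have h7 : (X ^ 7 : ℚ[X][X]).natDegree = 7 := natDegree_X_pow 7
  refine ⟨(monic_X_pow 7).sub_of_left ?_, ?_⟩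
  · apply degree_lt_degree; omega
  · unfold QV
    rw [natDegree_sub_eq_left_of_natDegree_lt (by omega), h7]

lemma QV_irreducible : Irreducible QV := by
  obtain ⟨hm, hd⟩ := QV_monic_deg
  have hp : (Ideal.span {(X : ℚ[X])}).IsPrime := by
    rw [Ideal.span_singleton_prime X_ne_zero]; exact prime_X
  refine IsEisensteinAt.irreducible (𝓟 := Ideal.span {(X : ℚ[X])}) ⟨?_, ?_, ?_⟩ hp hm.isPrimitive
    (by omega)
  · rw [hm.leadingCoeff]
    exact fun h => hp.ne_top ((Ideal.eq_top_iff_one _).mpr h)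
  · intro n hn
    rw [hd] at hn
    rw [QV, coeff_sub, coeff_X_pow, if_neg (by omega), coeff_C_mul, zero_sub,
      Ideal.mem_span_singleton]
    exact ⟨-(C (1 / 49) * (RV (X : ℚ[X])).coeff n), by ring⟩
  · have h0 : QV.coeff 0 = - (C (1 / 49) * X) := by
      rw [QV, coeff_sub, coeff_C_mul]
      simp [RV]
    rw [h0, Ideal.span_singleton_pow, Ideal.mem_span_singleton]
    rintro ⟨p, hp⟩
    have := congrArg (fun q => q.coeff 1) hp
    simp [coeff_X_pow_mul'] at this

lemma QV_irred_map {M : Type*} [Field M] (θ : ℚ[X] →+* M) (hinj : Function.Injective θ)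
    (hsurj : ∀ m, ∃ a b, m = θ a / θ b) : Irreducible (QV.map θ) := by
  let : Algebra ℚ[X] M := θ.toAlgebra
  have : IsFractionRing ℚ[X] M := by
    have : FaithfulSMul ℚ[X] M := (faithfulSMul_iff_algebraMap_injective _ _).mpr hinj
    apply IsFractionRing.of_field
    intro z
    obtain ⟨a, b, h⟩ := hsurj z
    exact ⟨a, b, h⟩
  exact (QV_monic_deg.1.irreducible_iff_irreducible_map_fraction_map (K := M)).mp QV_irreducible

lemma QV_root {M : Type*} [Field M] [CharZero M] (J t w : M) (htw : w ≠ t) (ht : pP t = J * t)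
    (hw : pP w = J * w) (hw0 : w ≠ 0) :
    w⁻¹ ^ 7 - t / 49 * (RV t).eval w⁻¹ = 0 := by
  have h0 : w - t ≠ 0 := sub_ne_zero.mpr htw
  have h49 : (49 : M) ≠ 0 := by norm_num
  unfold pP at ht hw
  simp only [RV, eval_add, eval_mul, eval_C, eval_pow, eval_X]
  field_simp
  apply mul_left_cancel₀ h0
  linear_combination w * ht - t * hw

lemma transcJ {N : Type*} [Field N] [CharZero N] [Algebra (RatFunc ℚ) N] :
    Transcendental ℚ (algebraMap (RatFunc ℚ) N RatFunc.X) := by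
  intro h
  have h2 : IsAlgebraic ℚ (RatFunc.X : RatFunc ℚ) :=
    (isAlgebraic_algebraMap_iff (algebraMap (RatFunc ℚ) N).injective).mp h
  refine RatFunc.transcendental_X (K := ℚ) ?_
  convert h2
  exact Subsingleton.elim _ _

lemma pP_zero {M : Type*} [Field M] [CharZero M] (J t : M) (h : pP t = J * t) : t ≠ 0 := by
  rintro rfl
  norm_num [pP] at h

lemma degree_bound {N : Type*} [Field N] [CharZero N] [Algebra (RatFunc ℚ) N]
    [FiniteDimensional (RatFunc ℚ) N] (t w : N) (htw : w ≠ t)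
    (ht : pP t = algebraMap (RatFunc ℚ) N RatFunc.X * t)
    (hw : pP w = algebraMap (RatFunc ℚ) N RatFunc.X * w) :
    56 ≤ Module.finrank (RatFunc ℚ) N := by
  set J := algebraMap (RatFunc ℚ) N RatFunc.X with hJ
  have ht0 := pP_zero J t ht
  have hw0 := pP_zero J w hw
  have hJt : J = pP t / t := by rw [ht]; field_simp
  let M := IntermediateField.adjoin (RatFunc ℚ) {t}
  have h8 : Module.finrank (RatFunc ℚ) M = 8 := by
    have hintg : IsIntegral (RatFunc ℚ) t := IsIntegral.of_finite _ _
    rw [IntermediateField.adjoin.finrank hintg, ← minpoly.eq_of_irreducible_of_monic PJ_irreducible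
      (p := PJ RatFunc.X) (x := t) ?_ (PJ_monic_deg _).1, (PJ_monic_deg _).2]
    rw [aeval_def, ← eval_map, PJ_map, PJ_eval, ht, sub_self]
  have htM : t ∈ M := IntermediateField.mem_adjoin_simple_self _ t
  let tM : M := ⟨t, htM⟩
  let θ : ℚ[X] →+* M := eval₂RingHom (algebraMap ℚ M) tM
  let θN : ℚ[X] →+* N := M.val.toRingHom.comp θ
  have hθN : ∀ p, θN p = aeval t p := by
    intro p
    change M.val.toRingHom (eval₂ (algebraMap ℚ M) tM p) = _
    rw [hom_eval₂, aeval_def]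
    congr 1
  have hinjN : Function.Injective θN := by
    rw [injective_iff_map_eq_zero]
    intro p hp
    rw [hθN] at hp
    by_contra hp0
    have h1 : t ∈ algebraicClosure ℚ N := by
      rw [mem_algebraicClosure_iff]; exact ⟨p, hp0, hp⟩
    have h2 : J ∈ algebraicClosure ℚ N := by
      rw [hJt, pP]
      have hn : ∀ n : ℕ, (n : N) ∈ algebraicClosure ℚ N := fun n => natCast_mem _ n
      have h13 := hn 13
      have h49 := hn 49
      have h5 := hn 5
      push_cast at h13 h49 h5
      exact div_mem (mul_mem (add_mem (add_mem (pow_mem h1 2) (mul_mem h13 h1)) h49)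
        (pow_mem (add_mem (add_mem (pow_mem h1 2) (mul_mem h5 h1)) (one_mem _)) 3)) h1
    rw [mem_algebraicClosure_iff] at h2
    exact transcJ h2
  have hinj : Function.Injective θ := fun a b h => hinjN (congrArg M.val.toRingHom h)
  let L : FractionRing ℚ[X] →+* N := IsFractionRing.lift hinjN
  have hL : ∀ p, L (algebraMap _ _ p) = θN p := fun p => IsFractionRing.lift_algebraMap hinjN p
  have htS : t ∈ L.fieldRange := ⟨algebraMap _ _ X, by rw [hL, hθN, aeval_X]⟩
  have hq : ∀ q : ℚ, (algebraMap ℚ N q) ∈ L.fieldRange :=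
    fun q => ⟨algebraMap _ _ (C q), by rw [hL, hθN, aeval_C]⟩
  have hJS : J ∈ L.fieldRange := by
    rw [hJt]
    refine div_mem ⟨algebraMap _ _ (pP (X : ℚ[X])), ?_⟩ htS
    rw [hL, map_pP, hθN, aeval_X]
  have hpS : ∀ p : ℚ[X], algebraMap (RatFunc ℚ) N (algebraMap ℚ[X] (RatFunc ℚ) p) ∈ L.fieldRange := by
    intro p
    induction p using Polynomial.induction_on' with
    | add p q hp hq => rw [map_add, map_add]; exact add_mem hp hq
    | monomial n a =>
      rw [← C_mul_X_pow_eq_monomial, map_mul, map_mul, map_pow, map_pow, RatFunc.algebraMap_X]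
      refine mul_mem ?_ (pow_mem hJS n)
      convert hq a using 1
      exact congrArg (fun f : ℚ →+* N => f a) (Subsingleton.elim
        (((algebraMap (RatFunc ℚ) N).comp (algebraMap ℚ[X] (RatFunc ℚ))).comp C) (algebraMap ℚ N))
  have hMS : ∀ m : N, m ∈ M → m ∈ L.fieldRange := by
    intro m hm
    induction hm using IntermediateField.adjoin_induction with
    | mem x hx => rw [Set.mem_singleton_iff.mp hx]; exact htS
    | algebraMap x =>
      rw [← RatFunc.num_div_denom x, map_div₀]
      exact div_mem (hpS _) (hpS _)
    | add x y _ _ hx hy => exact add_mem hx hy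
    | inv x _ hx => exact inv_mem hx
    | mul x y _ _ hx hy => exact mul_mem hx hy
  have hsurj : ∀ m : M, ∃ a b, m = θ a / θ b := by
    intro m
    obtain ⟨f, hf⟩ := hMS m m.2
    obtain ⟨a, b, -, rfl⟩ := IsFractionRing.div_surjective (A := ℚ[X]) f
    refine ⟨a, b, ?_⟩
    apply Subtype.ext
    rw [← hf, map_div₀, hL, hL]
    rfl
  have hirr := QV_irred_map θ hinj hsurj
  have h7 : 7 ≤ Module.finrank M N := by
    have hintg : IsIntegral M w⁻¹ := IsIntegral.of_finite _ _
    have hmin : QV.map θ = minpoly M w⁻¹ := by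
      refine minpoly.eq_of_irreducible_of_monic hirr ?_ (QV_monic_deg.1.map θ)
      rw [aeval_def, ← eval_map, Polynomial.map_map]
      change eval _ (QV.map θN) = 0
      have h1 : QV.map θN = X ^ 7 - C (t / 49) * RV t := by
        have hu : θN (C (1 / 49) * X) = t / 49 := by
          rw [map_mul, hθN, hθN, aeval_X, aeval_C, map_div₀, map_one, map_ofNat]; ring
        rw [QV, Polynomial.map_sub, Polynomial.map_mul, Polynomial.map_pow, map_X, map_C, hu]
        simp only [RV, Polynomial.map_add, Polynomial.map_mul,
          Polynomial.map_pow, map_X, map_C, hθN, map_add, map_mul, map_pow, map_ofNat, aeval_X,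
          map_one, Polynomial.map_ofNat, Polynomial.map_one]
      rw [h1]
      simp only [eval_sub, eval_pow, eval_X, eval_mul, eval_C]
      exact QV_root J t w htw ht hw hw0
    have h2 := minpoly.natDegree_le (A := M) w⁻¹
    rw [← hmin, QV_monic_deg.1.natDegree_map, QV_monic_deg.2] at h2
    exact h2
  have := Module.finrank_mul_finrank (RatFunc ℚ) M N
  rw [h8] at this
  omega

lemma FzJ_eq : FzJ = (PJ (RatFunc.X : RatFunc ℚ)).comp (X - C 8) := by
  simp only [FzJ, PJ, sub_comp, mul_comp, add_comp, pow_comp, X_comp, C_comp, ofNat_comp, one_comp,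
    map_ofNat]
  ring

lemma FzJ_irr : Irreducible FzJ := by
  have h : FzJ = Polynomial.algEquivAevalXAddC (-8 : RatFunc ℚ) (PJ RatFunc.X) := by
    rw [FzJ_eq, Polynomial.algEquivAevalXAddC_apply, aeval_def, comp, map_neg, sub_eq_add_neg]
    rfl
  rw [h, MulEquiv.irreducible_iff]
  exact PJ_irreducible

lemma FzJ_root {N : Type*} [Field N] [Algebra (RatFunc ℚ) N] (z : N) :
    z ∈ FzJ.rootSet N ↔ pP (z - 8) = algebraMap (RatFunc ℚ) N RatFunc.X * (z - 8) := by
  rw [mem_rootSet_of_ne FzJ_irr.ne_zero, FzJ_eq, aeval_comp, aeval_sub, aeval_X, aeval_C, map_ofNat,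
    aeval_def, ← eval_map, PJ_map, PJ_eval, sub_eq_zero]

lemma FzJ_card : 56 ≤ Nat.card FzJ.Gal := by
  have hsep : FzJ.Separable := FzJ_irr.separable
  rw [Gal.card_of_separable hsep]
  have hd : FzJ.natDegree = 8 := by
    rw [FzJ_eq, natDegree_comp, (PJ_monic_deg _).2, natDegree_X_sub_C]
  have hc := card_rootSet_eq_natDegree hsep (SplittingField.splits FzJ)
  rw [hd] at hc
  have : Nontrivial (FzJ.rootSet FzJ.SplittingField) :=
    Fintype.one_lt_card_iff_nontrivial.mp (by omega)
  obtain ⟨⟨t, ht⟩, ⟨w, hw⟩, htw⟩ := exists_pair_ne (FzJ.rootSet FzJ.SplittingField)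
  rw [FzJ_root] at ht hw
  have : CharZero FzJ.SplittingField :=
    charZero_of_injective_algebraMap (algebraMap (RatFunc ℚ) FzJ.SplittingField).injective
  refine degree_bound (t - 8) (w - 8) ?_ ht hw
  intro h
  apply htw
  apply Subtype.ext
  exact (sub_left_injective h).symm

lemma sgZ_cast : ∀ x y z : PL, x ≠ y → y ≠ z → z ≠ x → sg x y z = ((sgZ x y z : ℤ) : ZMod 7) := by
  decide +kernel

lemma sg_degen : ∀ x y z : PL, ¬ (x ≠ y ∧ y ≠ z ∧ z ≠ x) → sg x y z = 0 := by
  decide +kernel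

lemma sgZ_sq (x y z : PL) : sgZ x y z ^ 2 = 1 := by
  unfold sgZ; split_ifs <;> norm_num

lemma sign_eq {E : Type*} [Field E] (J : E) (lab : PL → E) (s : E)
    (hinj : Function.Injective lab) (hroot : ∀ x, pP (lab x) = J * lab x) (hs : s ^ 2 = -7)
    (hne : ∀ x y z, x ≠ y → y ≠ z → z ≠ x → fa (lab x) (lab y) (lab z) +
        sgZ x y z * s * (dl (lab x) (lab y) (lab z) * ga (lab x) (lab y) (lab z)) ≠ 0)
    (x y z : PL) (hxy : x ≠ y) (hyz : y ≠ z) (hzx : z ≠ x) :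
    fa (lab x) (lab y) (lab z) =
      sgZ x y z * s * (dl (lab x) (lab y) (lab z) * ga (lab x) (lab y) (lab z)) ∧
    s * (dl (lab x) (lab y) (lab z) * ga (lab x) (lab y) (lab z)) ≠ 0 := by
  have h := hne x y z hxy hyz hzx
  have hr := rel J _ _ _ (hinj.ne hxy) (hinj.ne hyz) (hinj.ne hzx) (hroot x) (hroot y) (hroot z)
  have hq : ((sgZ x y z : ℤ) : E) ^ 2 = 1 := by exact_mod_cast congrArg (Int.cast (R := E)) (sgZ_sq x y z)
  generalize fa (lab x) (lab y) (lab z) = A at *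
  generalize dl (lab x) (lab y) (lab z) * ga (lab x) (lab y) (lab z) = B at *
  generalize ((sgZ x y z : ℤ) : E) = e at *
  have h1 : A = e * s * B := by
    have : (A + e * s * B) * (A - e * s * B) = 0 := by
      linear_combination hr - e ^ 2 * B ^ 2 * hs + 7 * B ^ 2 * hq
    exact sub_eq_zero.mp ((mul_eq_zero.mp this).resolve_left h)
  refine ⟨h1, ?_⟩
  intro h0
  apply h
  rw [h1, mul_assoc, h0]; ring

lemma perm_sign {E : Type*} [Field E] [CharZero E] (J : E) (lab : PL → E) (s : E)
    (hinj : Function.Injective lab) (hroot : ∀ x, pP (lab x) = J * lab x) (hs : s ^ 2 = -7)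
    (hne : ∀ x y z, x ≠ y → y ≠ z → z ≠ x → fa (lab x) (lab y) (lab z) +
        sgZ x y z * s * (dl (lab x) (lab y) (lab z) * ga (lab x) (lab y) (lab z)) ≠ 0)
    (σ : E →+* E) (π : Equiv.Perm PL) (hπ : ∀ x, σ (lab x) = lab (π x)) (ε : ℤ)
    (hε : σ s = ε * s) (x y z : PL) :
    sg (π x) (π y) (π z) = (ε : ZMod 7) * sg x y z := by
  by_cases hd : x ≠ y ∧ y ≠ z ∧ z ≠ x
  · obtain ⟨hxy, hyz, hzx⟩ := hd
    have h1 := (sign_eq J lab s hinj hroot hs hne x y z hxy hyz hzx).1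
    have hxy' := π.injective.ne hxy
    have hyz' := π.injective.ne hyz
    have hzx' := π.injective.ne hzx
    obtain ⟨h2, h3⟩ := sign_eq J lab s hinj hroot hs hne _ _ _ hxy' hyz' hzx'
    have h4 := congrArg σ h1
    rw [map_mul, map_mul, map_mul, map_fa, map_dl, map_ga, map_intCast, hπ, hπ, hπ, hε, h2] at h4
    have h5 : ((sgZ (π x) (π y) (π z) : ℤ) : E) = ((ε * sgZ x y z : ℤ) : E) := by
      apply mul_right_cancel₀ h3
      push_cast
      linear_combination h4
    have h6 : sgZ (π x) (π y) (π z) = ε * sgZ x y z := by exact_mod_cast h5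
    rw [sgZ_cast _ _ _ hxy' hyz' hzx', sgZ_cast _ _ _ hxy hyz hzx, h6]
    push_cast
    rfl
  · rw [sg_degen x y z hd, sg_degen, mul_zero]
    simpa [π.injective.eq_iff] using hd

lemma not_sq (k : RatFunc ℚ) : k ^ 2 ≠ -7 := by
  intro hk
  have hi : IsIntegral ℚ[X] (k ^ 2) := by
    have : k ^ 2 = algebraMap ℚ[X] (RatFunc ℚ) (-7) := by rw [hk, map_neg, map_ofNat]
    rw [this]; exact isIntegral_algebraMap
  obtain ⟨p, rfl⟩ := IsIntegrallyClosed.exists_algebraMap_eq_of_isIntegral_pow (by norm_num) hi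
  have h2 : p ^ 2 = -7 := by
    apply IsFractionRing.injective ℚ[X] (RatFunc ℚ)
    rw [map_pow, hk, map_neg, map_ofNat]
  have h3 := congrArg (eval 0) h2
  simp only [eval_pow, eval_neg, eval_ofNat] at h3
  nlinarith [sq_nonneg (eval 0 p)]

theorem main_aux {E : Type*} [Field E] [CharZero E] [Algebra (RatFunc ℚ) E] [IsAlgClosed E]
    [IsGalois (RatFunc ℚ) E] : Nonempty (FzJ.Gal ≃* PGL2F7) := by
  let J : E := algebraMap (RatFunc ℚ) E RatFunc.X
  have hJ : Transcendental ℤ J := by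
    intro h
    exact transcJ (N := E) (h.extendScalars (Int.cast_injective (α := ℚ)))
  obtain ⟨lab, s, hinj, hroot, hall, hs, hne⟩ := reduction J hJ
  have hfact : Fact ((FzJ.map (algebraMap (RatFunc ℚ) E)).Splits) := ⟨IsAlgClosed.splits _⟩
  let e : PL ≃ FzJ.rootSet E := Equiv.ofBijective
    (fun x => ⟨lab x + 8, by rw [FzJ_root, add_sub_cancel_right]; exact hroot x⟩) (by
      constructor
      · intro x y hxy
        exact hinj (add_right_cancel (Subtype.ext_iff.mp hxy))
      · rintro ⟨z, hz⟩
        rw [FzJ_root] at hz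
        obtain ⟨x, hx⟩ := hall _ hz
        exact ⟨x, Subtype.ext (by simp [hx])⟩)
  have he : ∀ x, (e x : E) = lab x + 8 := fun x => rfl
  let Φ : FzJ.Gal →* Equiv.Perm PL :=
    (e.symm.permCongrHom).toMonoidHom.comp (Gal.galActionHom FzJ E)
  have hΦ : ∀ (σ : E ≃ₐ[RatFunc ℚ] E) (x : PL),
      (σ : E →+* E) (lab x) = lab (Φ (Gal.restrict FzJ E σ) x) := by
    intro σ x
    have h1 := Gal.galActionHom_restrict (p := FzJ) (E := E) σ (e x)
    have h2 : e (Φ (Gal.restrict FzJ E σ) x) =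
        Gal.galActionHom FzJ E (Gal.restrict FzJ E σ) (e x) := by
      change e (e.symm _) = _
      rw [Equiv.apply_symm_apply]
      rfl
    rw [← h2, he, he, map_add, map_ofNat] at h1
    exact (add_right_cancel h1).symm
  have hsσ : ∀ σ : E ≃ₐ[RatFunc ℚ] E, σ s = s ∨ σ s = -s := by
    intro σ
    apply sq_eq_sq_iff_eq_or_eq_neg.mp
    rw [← map_pow, hs, map_neg, map_ofNat]
  have hsgn : ∀ (σ : E ≃ₐ[RatFunc ℚ] E) (ε : ℤ), σ s = ε * s → ∀ x y z,
      sg (Φ (Gal.restrict FzJ E σ) x) (Φ (Gal.restrict FzJ E σ) y)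
        (Φ (Gal.restrict FzJ E σ) z) = (ε : ZMod 7) * sg x y z :=
    fun σ ε hε x y z => perm_sign J lab s hinj hroot hs hne (σ : E →+* E) _ (hΦ σ) ε hε x y z
  refine PartA.group_main Φ ?_ ?_ ?_ FzJ_card
  · exact (MulEquiv.injective e.symm.permCongrHom).comp (Gal.galActionHom_injective FzJ E)
  · intro τ
    obtain ⟨σ, rfl⟩ := Gal.restrict_surjective FzJ E τ
    rcases hsσ σ with h | h
    · left
      intro x y z
      have := hsgn σ 1 (by rw [h]; simp) x y z
      simpa using this
    · right
      intro x y z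
      have := hsgn σ (-1) (by rw [h]; simp) x y z
      simpa using this
  · have hex : ∃ σ : E ≃ₐ[RatFunc ℚ] E, σ s ≠ s := by
      by_contra! hcon
      have := (InfiniteGalois.mem_bot_iff_fixed (k := RatFunc ℚ) s).mpr hcon
      rw [IntermediateField.mem_bot] at this
      obtain ⟨k, hk⟩ := this
      apply not_sq k
      apply (algebraMap (RatFunc ℚ) E).injective
      rw [map_pow, hk, hs, map_neg, map_ofNat]
    obtain ⟨σ, hσ⟩ := hex
    refine ⟨Gal.restrict FzJ E σ, fun x y z => ?_⟩
    have := hsgn σ (-1) (by rw [(hsσ σ).resolve_left hσ]; simp) x y z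
    simpa using this

theorem main : Irreducible FzJ ∧ Nonempty (FzJ.Gal ≃* PGL2F7) :=
  ⟨FzJ_irr, main_aux (E := AlgebraicClosure (RatFunc ℚ))⟩

end PartB

/-- Lemma 3(a): `F(z,J)` is irreducible over `ℚ(J)` and the Galois group of its
splitting field over `ℚ(J)` is isomorphic to `PGL₂(𝔽₇)`. -/
theorem FzJ_gal_eq_PGL2F7 :
    Irreducible FzJ ∧ Nonempty (FzJ.Gal ≃* PGL2F7) := by
  exact PartB.main
end

section
/- Let l ≠ 7 be a prime, and regard F(z,J) = (z²−3z+9)(z²−11z+25)³ − J·(z−8) as a polynomial of degree 8 in z over the rational function field 𝔽_l(J). Then F is separable over 𝔽_l(J), and the Galois group of its splitting field over 𝔽_l(J) is isomorphic to a subgroup of PGL₂(𝔽₇), the projective general linear group of 2×2 matrices over the field with 7 elements. -/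
open Polynomial

/-- `F(z,J) = (z²-3z+9)(z²-11z+25)³ - J·(z-8)` as a polynomial in `z` over the
rational function field `𝔽_l(J)`. -/
noncomputable def FzJmod (l : ℕ) [Fact (Nat.Prime l)] : Polynomial (RatFunc (ZMod l)) :=
  (X ^ 2 - 3 * X + 9) * (X ^ 2 - 11 * X + 25) ^ 3 - C RatFunc.X * (X - 8)

set_option maxHeartbeats 4000000

theorem id_klein {R : Type*} [CommRing R] (q x y z : R) (hq : 1+q+q^2+q^3+q^4+q^5+q^6=0) : ((q-q^6)*x+(q^2-q^5)*y+(q^4-q^3)*z)^3*((q^2-q^5)*x+(q^4-q^3)*y+(q-q^6)*z)+((q^2-q^5)*x+(q^4-q^3)*y+(q-q^6)*z)^3*((q^4-q^3)*x+(q-q^6)*y+(q^2-q^5)*z)+((q^4-q^3)*x+(q-q^6)*y+(q^2-q^5)*z)^3*((q-q^6)*x+(q^2-q^5)*y+(q^4-q^3)*z) = 49*(x^3*y+y^3*z+z^3*x) := by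
  linear_combination (((1)*q^5 + (-1)*q^6 + (-1)*q^8 + (-2)*q^10 + (6)*q^11 + (-2)*q^12 + (-1)*q^14 + (-1)*q^16 + (1)*q^17)*x^4 + (-49 + (49)*q^1 + (2)*q^6 + (-49)*q^7 + (50)*q^8 + (-15)*q^9 + (15)*q^10 + (-13)*q^11 + (15)*q^12 + (-15)*q^13 + (1)*q^14 + (2)*q^16)*x^3*y + ((1)*q^4 + (-1)*q^5 + (-3)*q^7 + (4)*q^8 + (1)*q^9 + (-5)*q^10 + (6)*q^11 + (-5)*q^12 + (1)*q^13 + (4)*q^14 + (-3)*q^15 + (-1)*q^17 + (1)*q^18)*x^3*z + ((-3)*q^6 + (6)*q^7 + (-3)*q^8 + (6)*q^9 + (-18)*q^10 + (24)*q^11 + (-18)*q^12 + (6)*q^13 + (-3)*q^14 + (6)*q^15 + (-3)*q^16)*x^2*y^2 + ((3)*q^5 + (-9)*q^7 + (6)*q^8 + (-3)*q^9 + (-6)*q^10 + (18)*q^11 + (-6)*q^12 + (-3)*q^13 + (6)*q^14 + (-9)*q^15 + (3)*q^17)*x^2*y*z + ((-3)*q^6 + (6)*q^7 + (-3)*q^8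 + (6)*q^9 + (-18)*q^10 + (24)*q^11 + (-18)*q^12 + (6)*q^13 + (-3)*q^14 + (6)*q^15 + (-3)*q^16)*x^2*z^2 + ((1)*q^4 + (-1)*q^5 + (-3)*q^7 + (4)*q^8 + (1)*q^9 + (-5)*q^10 + (6)*q^11 + (-5)*q^12 + (1)*q^13 + (4)*q^14 + (-3)*q^15 + (-1)*q^17 + (1)*q^18)*x*y^3 + ((3)*q^5 + (-9)*q^7 + (6)*q^8 + (-3)*q^9 + (-6)*q^10 + (18)*q^11 + (-6)*q^12 + (-3)*q^13 + (6)*q^14 + (-9)*q^15 + (3)*q^17)*x*y^2*z + ((3)*q^5 + (-9)*q^7 + (6)*q^8 + (-3)*q^9 + (-6)*q^10 + (18)*q^11 + (-6)*q^12 + (-3)*q^13 + (6)*q^14 + (-9)*q^15 + (3)*q^17)*x*y*z^2 + (-49 + (49)*q^1 + (2)*q^6 + (-49)*q^7 + (50)*q^8 + (-15)*q^9 + (15)*q^10 + (-13)*q^11 + (15)*q^12 + (-15)*q^13 + (1)*q^14 + (2)*q^16)*x*z^3 + ((1)*q^5 + (-1)*q^6 + (-1)*q^8 + (-2)*q^10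 + (6)*q^11 + (-2)*q^12 + (-1)*q^14 + (-1)*q^16 + (1)*q^17)*y^4 + (-49 + (49)*q^1 + (2)*q^6 + (-49)*q^7 + (50)*q^8 + (-15)*q^9 + (15)*q^10 + (-13)*q^11 + (15)*q^12 + (-15)*q^13 + (1)*q^14 + (2)*q^16)*y^3*z + ((-3)*q^6 + (6)*q^7 + (-3)*q^8 + (6)*q^9 + (-18)*q^10 + (24)*q^11 + (-18)*q^12 + (6)*q^13 + (-3)*q^14 + (6)*q^15 + (-3)*q^16)*y^2*z^2 + ((1)*q^4 + (-1)*q^5 + (-3)*q^7 + (4)*q^8 + (1)*q^9 + (-5)*q^10 + (6)*q^11 + (-5)*q^12 + (1)*q^13 + (4)*q^14 + (-3)*q^15 + (-1)*q^17 + (1)*q^18)*y*z^3 + ((1)*q^5 + (-1)*q^6 + (-1)*q^8 + (-2)*q^10 + (6)*q^11 + (-2)*q^12 + (-1)*q^14 + (-1)*q^16 + (1)*q^17)*z^4)*hq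

theorem id_prod {R : Type*} [CommRing R] (q x y z : R) (hq : 1+q+q^2+q^3+q^4+q^5+q^6=0) : ((q-q^6)*x+(q^2-q^5)*y+(q^4-q^3)*z)*((q^2-q^5)*x+(q^4-q^3)*y+(q-q^6)*z)*((q^4-q^3)*x+(q-q^6)*y+(q^2-q^5)*z) = (q-q^6+(q^2-q^5)+(q^4-q^3))*((1)*x^3 + (-1)*x^2*y + (-2)*x^2*z + (-2)*x*y^2 + (-1)*x*y*z + (-1)*x*z^2 + (1)*y^3 + (-1)*y^2*z + (-2)*y*z^2 + (1)*z^3) := by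
  linear_combination (((-1)*q^1 + (2)*q^3 + (-2)*q^4 + (2)*q^5 + (-1)*q^6 + (1)*q^7 + (-2)*q^8 + (1)*q^9)*x^3 + ((1)*q^1 + (-2)*q^3 + (3)*q^4 + (-3)*q^5 + (1)*q^8 + (1)*q^10 + (-1)*q^11)*x^2*y + ((2)*q^1 + (-4)*q^3 + (4)*q^4 + (-4)*q^5 + (1)*q^6 + (1)*q^7 + (1)*q^8 + (-1)*q^9)*x^2*z + ((2)*q^1 + (-4)*q^3 + (4)*q^4 + (-4)*q^5 + (1)*q^6 + (1)*q^7 + (1)*q^8 + (-1)*q^9)*x*y^2 + ((1)*q^1 + (-1)*q^3 + (1)*q^4 + (-2)*q^5 + (-2)*q^6 + (6)*q^7 + (-5)*q^8 + (2)*q^9 + (1)*q^11 + (-1)*q^12)*x*y*z + ((1)*q^1 + (-2)*q^3 + (3)*q^4 + (-3)*q^5 + (1)*q^8 + (1)*q^10 + (-1)*q^11)*x*z^2 + ((-1)*q^1 + (2)*q^3 + (-2)*q^4 + (2)*q^5 + (-1)*q^6 + (1)*q^7 + (-2)*q^8 + (1)*q^9)*y^3 + ((1)*q^1 + (-2)*q^3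 + (3)*q^4 + (-3)*q^5 + (1)*q^8 + (1)*q^10 + (-1)*q^11)*y^2*z + ((2)*q^1 + (-4)*q^3 + (4)*q^4 + (-4)*q^5 + (1)*q^6 + (1)*q^7 + (1)*q^8 + (-1)*q^9)*y*z^2 + ((-1)*q^1 + (2)*q^3 + (-2)*q^4 + (2)*q^5 + (-1)*q^6 + (1)*q^7 + (-2)*q^8 + (1)*q^9)*z^3)*hq

theorem id_nab {R : Type*} [CommRing R] (q x y z : R) (hq : 1+q+q^2+q^3+q^4+q^5+q^6=0) : ((q-q^6)*x+(q^2-q^5)*y+(q^4-q^3)*z)*((q^2-q^5)*x+(q^4-q^3)*y+(q-q^6)*z)^5+((q^2-q^5)*x+(q^4-q^3)*y+(q-q^6)*z)*((q^4-q^3)*x+(q-q^6)*y+(q^2-q^5)*z)^5+((q^4-q^3)*x+(q-q^6)*y+(q^2-q^5)*z)*((q-q^6)*x+(q^2-q^5)*y+(q^4-q^3)*z)^5-5*((q-q^6)*x+(q^2-q^5)*y+(q^4-q^3)*z)^2*((q^2-q^5)*x+(q^4-q^3)*y+(q-q^6)*z)^2*((q^4-q^3)*x+(q-q^6)*y+(q^2-q^5)*z)^2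 = -343*(x*y^5+y*z^5+z*x^5-5*x^2*y^2*z^2) := by
  linear_combination (((-1)*q^8 + (2)*q^9 + (-1)*q^10 + (1)*q^11 + (-6)*q^12 + (20)*q^13 + (-30)*q^14 + (24)*q^15 + (-29)*q^16 + (49)*q^17 + (-58)*q^18 + (49)*q^19 + (-29)*q^20 + (24)*q^21 + (-30)*q^22 + (20)*q^23 + (-6)*q^24 + (1)*q^25 + (-1)*q^26 + (2)*q^27 + (-1)*q^28)*x^6 + ((1)*q^6 + (-1)*q^7 + (-5)*q^9 + (20)*q^10 + (-31)*q^11 + (17)*q^12 + (-20)*q^13 + (49)*q^14 + (-41)*q^15 + (31)*q^16 + (-30)*q^17 + (20)*q^18 + (-30)*q^19 + (31)*q^20 + (-41)*q^21 + (49)*q^22 + (-20)*q^23 + (17)*q^24 + (-31)*q^25 + (20)*q^26 + (-5)*q^27 + (-1)*q^29 + (1)*q^30)*x^5*y + (343 + (-343)*q^1 + (344)*q^7 + (-344)*q^8 + (9)*q^10 + (-19)*q^11 + (20)*q^12 + (-41)*q^13 + (366)*q^14 + (-380)*q^15 + (174)*q^16 + (-190)*q^17 + (171)*q^18 + (-190)*q^19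 + (174)*q^20 + (-37)*q^21 + (23)*q^22 + (-41)*q^23 + (20)*q^24 + (-19)*q^25 + (9)*q^26 + (-1)*q^28 + (1)*q^29)*x^5*z + ((5)*q^7 + (-10)*q^8 + (5)*q^9 + (-15)*q^10 + (35)*q^11 + (-25)*q^12 + (20)*q^13 + (-50)*q^14 + (55)*q^15 + (-25)*q^16 + (40)*q^17 + (-70)*q^18 + (40)*q^19 + (-25)*q^20 + (55)*q^21 + (-50)*q^22 + (20)*q^23 + (-25)*q^24 + (35)*q^25 + (-15)*q^26 + (5)*q^27 + (-10)*q^28 + (5)*q^29)*x^4*y^2 + ((15)*q^9 + (-35)*q^10 + (15)*q^11 + (-35)*q^12 + (155)*q^13 + (-210)*q^14 + (175)*q^15 + (-205)*q^16 + (280)*q^17 + (-310)*q^18 + (280)*q^19 + (-205)*q^20 + (175)*q^21 + (-210)*q^22 + (155)*q^23 + (-35)*q^24 + (15)*q^25 + (-35)*q^26 + (15)*q^27)*x^4*y*z + ((5)*q^9 + (10)*q^10 + (-25)*q^11 + (-35)*q^12 + (55)*q^13 + (-30)*q^14 + (65)*q^15 + (-25)*q^16 + (60)*q^17 + (-160)*q^18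 + (60)*q^19 + (-25)*q^20 + (65)*q^21 + (-30)*q^22 + (55)*q^23 + (-35)*q^24 + (-25)*q^25 + (10)*q^26 + (5)*q^27)*x^4*z^2 + ((10)*q^8 + (-10)*q^9 + (-10)*q^10 + (-10)*q^11 + (10)*q^12 + (30)*q^13 + (-10)*q^15 + (-20)*q^16 + (20)*q^18 + (-20)*q^20 + (-10)*q^21 + (30)*q^23 + (10)*q^24 + (-10)*q^25 + (-10)*q^26 + (-10)*q^27 + (10)*q^28)*x^3*y^3 + ((-10)*q^7 + (10)*q^8 + (-10)*q^9 + (70)*q^10 + (-90)*q^11 + (110)*q^12 + (-280)*q^13 + (360)*q^14 + (-290)*q^15 + (360)*q^16 + (-600)*q^17 + (740)*q^18 + (-600)*q^19 + (360)*q^20 + (-290)*q^21 + (360)*q^22 + (-280)*q^23 + (110)*q^24 + (-90)*q^25 + (70)*q^26 + (-10)*q^27 + (10)*q^28 + (-10)*q^29)*x^3*y^2*z + ((-10)*q^8 + (-20)*q^10 + (90)*q^11 + (20)*q^12 + (-60)*q^13 + (-100)*q^14 + (40)*q^15 + (-10)*q^16 + (-70)*q^17 + (240)*q^18 + (-70)*q^19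 + (-10)*q^20 + (40)*q^21 + (-100)*q^22 + (-60)*q^23 + (20)*q^24 + (90)*q^25 + (-20)*q^26 + (-10)*q^28)*x^3*y*z^2 + ((10)*q^8 + (-10)*q^9 + (-10)*q^10 + (-10)*q^11 + (10)*q^12 + (30)*q^13 + (-10)*q^15 + (-20)*q^16 + (20)*q^18 + (-20)*q^20 + (-10)*q^21 + (30)*q^23 + (10)*q^24 + (-10)*q^25 + (-10)*q^26 + (-10)*q^27 + (10)*q^28)*x^3*z^3 + ((5)*q^9 + (10)*q^10 + (-25)*q^11 + (-35)*q^12 + (55)*q^13 + (-30)*q^14 + (65)*q^15 + (-25)*q^16 + (60)*q^17 + (-160)*q^18 + (60)*q^19 + (-25)*q^20 + (65)*q^21 + (-30)*q^22 + (55)*q^23 + (-35)*q^24 + (-25)*q^25 + (10)*q^26 + (5)*q^27)*x^2*y^4 + ((-10)*q^8 + (-20)*q^10 + (90)*q^11 + (20)*q^12 + (-60)*q^13 + (-100)*q^14 + (40)*q^15 + (-10)*q^16 + (-70)*q^17 + (240)*q^18 + (-70)*q^19 + (-10)*q^20 + (40)*q^21 + (-100)*q^22 + (-60)*q^23 + (20)*q^24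 + (90)*q^25 + (-20)*q^26 + (-10)*q^28)*x^2*y^3*z + (-1715 + (1715)*q^1 + (-5)*q^6 + (-1710)*q^7 + (1715)*q^8 + (20)*q^9 + (-80)*q^10 + (90)*q^11 + (-100)*q^12 + (305)*q^13 + (-1995)*q^14 + (2060)*q^15 + (-985)*q^16 + (985)*q^17 + (-845)*q^18 + (985)*q^19 + (-985)*q^20 + (345)*q^21 + (-280)*q^22 + (305)*q^23 + (-100)*q^24 + (90)*q^25 + (-80)*q^26 + (20)*q^27 + (5)*q^29 + (-5)*q^30)*x^2*y^2*z^2 + ((-10)*q^7 + (10)*q^8 + (-10)*q^9 + (70)*q^10 + (-90)*q^11 + (110)*q^12 + (-280)*q^13 + (360)*q^14 + (-290)*q^15 + (360)*q^16 + (-600)*q^17 + (740)*q^18 + (-600)*q^19 + (360)*q^20 + (-290)*q^21 + (360)*q^22 + (-280)*q^23 + (110)*q^24 + (-90)*q^25 + (70)*q^26 + (-10)*q^27 + (10)*q^28 + (-10)*q^29)*x^2*y*z^3 + ((5)*q^7 + (-10)*q^8 + (5)*q^9 + (-15)*q^10 + (35)*q^11 + (-25)*q^12 + (20)*q^13 +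 (-50)*q^14 + (55)*q^15 + (-25)*q^16 + (40)*q^17 + (-70)*q^18 + (40)*q^19 + (-25)*q^20 + (55)*q^21 + (-50)*q^22 + (20)*q^23 + (-25)*q^24 + (35)*q^25 + (-15)*q^26 + (5)*q^27 + (-10)*q^28 + (5)*q^29)*x^2*z^4 + (343 + (-343)*q^1 + (344)*q^7 + (-344)*q^8 + (9)*q^10 + (-19)*q^11 + (20)*q^12 + (-41)*q^13 + (366)*q^14 + (-380)*q^15 + (174)*q^16 + (-190)*q^17 + (171)*q^18 + (-190)*q^19 + (174)*q^20 + (-37)*q^21 + (23)*q^22 + (-41)*q^23 + (20)*q^24 + (-19)*q^25 + (9)*q^26 + (-1)*q^28 + (1)*q^29)*x*y^5 + ((15)*q^9 + (-35)*q^10 + (15)*q^11 + (-35)*q^12 + (155)*q^13 + (-210)*q^14 + (175)*q^15 + (-205)*q^16 + (280)*q^17 + (-310)*q^18 + (280)*q^19 + (-205)*q^20 + (175)*q^21 + (-210)*q^22 + (155)*q^23 + (-35)*q^24 + (15)*q^25 + (-35)*q^26 + (15)*q^27)*x*y^4*z + ((-10)*q^7 + (10)*q^8 + (-10)*q^9 +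 (70)*q^10 + (-90)*q^11 + (110)*q^12 + (-280)*q^13 + (360)*q^14 + (-290)*q^15 + (360)*q^16 + (-600)*q^17 + (740)*q^18 + (-600)*q^19 + (360)*q^20 + (-290)*q^21 + (360)*q^22 + (-280)*q^23 + (110)*q^24 + (-90)*q^25 + (70)*q^26 + (-10)*q^27 + (10)*q^28 + (-10)*q^29)*x*y^3*z^2 + ((-10)*q^8 + (-20)*q^10 + (90)*q^11 + (20)*q^12 + (-60)*q^13 + (-100)*q^14 + (40)*q^15 + (-10)*q^16 + (-70)*q^17 + (240)*q^18 + (-70)*q^19 + (-10)*q^20 + (40)*q^21 + (-100)*q^22 + (-60)*q^23 + (20)*q^24 + (90)*q^25 + (-20)*q^26 + (-10)*q^28)*x*y^2*z^3 + ((15)*q^9 + (-35)*q^10 + (15)*q^11 + (-35)*q^12 + (155)*q^13 + (-210)*q^14 + (175)*q^15 + (-205)*q^16 + (280)*q^17 + (-310)*q^18 + (280)*q^19 + (-205)*q^20 + (175)*q^21 + (-210)*q^22 + (155)*q^23 + (-35)*q^24 + (15)*q^25 + (-35)*q^26 + (15)*q^27)*x*y*z^4 + ((1)*q^6 + (-1)*q^7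 + (-5)*q^9 + (20)*q^10 + (-31)*q^11 + (17)*q^12 + (-20)*q^13 + (49)*q^14 + (-41)*q^15 + (31)*q^16 + (-30)*q^17 + (20)*q^18 + (-30)*q^19 + (31)*q^20 + (-41)*q^21 + (49)*q^22 + (-20)*q^23 + (17)*q^24 + (-31)*q^25 + (20)*q^26 + (-5)*q^27 + (-1)*q^29 + (1)*q^30)*x*z^5 + ((-1)*q^8 + (2)*q^9 + (-1)*q^10 + (1)*q^11 + (-6)*q^12 + (20)*q^13 + (-30)*q^14 + (24)*q^15 + (-29)*q^16 + (49)*q^17 + (-58)*q^18 + (49)*q^19 + (-29)*q^20 + (24)*q^21 + (-30)*q^22 + (20)*q^23 + (-6)*q^24 + (1)*q^25 + (-1)*q^26 + (2)*q^27 + (-1)*q^28)*y^6 + ((1)*q^6 + (-1)*q^7 + (-5)*q^9 + (20)*q^10 + (-31)*q^11 + (17)*q^12 + (-20)*q^13 + (49)*q^14 + (-41)*q^15 + (31)*q^16 + (-30)*q^17 + (20)*q^18 + (-30)*q^19 + (31)*q^20 + (-41)*q^21 + (49)*q^22 + (-20)*q^23 + (17)*q^24 + (-31)*q^25 + (20)*q^26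 + (-5)*q^27 + (-1)*q^29 + (1)*q^30)*y^5*z + ((5)*q^7 + (-10)*q^8 + (5)*q^9 + (-15)*q^10 + (35)*q^11 + (-25)*q^12 + (20)*q^13 + (-50)*q^14 + (55)*q^15 + (-25)*q^16 + (40)*q^17 + (-70)*q^18 + (40)*q^19 + (-25)*q^20 + (55)*q^21 + (-50)*q^22 + (20)*q^23 + (-25)*q^24 + (35)*q^25 + (-15)*q^26 + (5)*q^27 + (-10)*q^28 + (5)*q^29)*y^4*z^2 + ((10)*q^8 + (-10)*q^9 + (-10)*q^10 + (-10)*q^11 + (10)*q^12 + (30)*q^13 + (-10)*q^15 + (-20)*q^16 + (20)*q^18 + (-20)*q^20 + (-10)*q^21 + (30)*q^23 + (10)*q^24 + (-10)*q^25 + (-10)*q^26 + (-10)*q^27 + (10)*q^28)*y^3*z^3 + ((5)*q^9 + (10)*q^10 + (-25)*q^11 + (-35)*q^12 + (55)*q^13 + (-30)*q^14 + (65)*q^15 + (-25)*q^16 + (60)*q^17 + (-160)*q^18 + (60)*q^19 + (-25)*q^20 + (65)*q^21 + (-30)*q^22 + (55)*q^23 + (-35)*q^24 + (-25)*q^25 +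 (10)*q^26 + (5)*q^27)*y^2*z^4 + (343 + (-343)*q^1 + (344)*q^7 + (-344)*q^8 + (9)*q^10 + (-19)*q^11 + (20)*q^12 + (-41)*q^13 + (366)*q^14 + (-380)*q^15 + (174)*q^16 + (-190)*q^17 + (171)*q^18 + (-190)*q^19 + (174)*q^20 + (-37)*q^21 + (23)*q^22 + (-41)*q^23 + (20)*q^24 + (-19)*q^25 + (9)*q^26 + (-1)*q^28 + (1)*q^29)*y*z^5 + ((-1)*q^8 + (2)*q^9 + (-1)*q^10 + (1)*q^11 + (-6)*q^12 + (20)*q^13 + (-30)*q^14 + (24)*q^15 + (-29)*q^16 + (49)*q^17 + (-58)*q^18 + (49)*q^19 + (-29)*q^20 + (24)*q^21 + (-30)*q^22 + (20)*q^23 + (-6)*q^24 + (1)*q^25 + (-1)*q^26 + (2)*q^27 + (-1)*q^28)*z^6)*hq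

theorem id_w3 {R : Type*} [CommRing R] (x y z : R) (hf : x^3*y+y^3*z+z^3*x=0) : (-(x^2*y^3+y^2*z^3+z^2*x^3))^3 = ((x*y^5+y*z^5+z*x^5-5*x^2*y^2*z^2)^2+13*(x*y^5+y*z^5+z*x^5-5*x^2*y^2*z^2)*(x*y*z)^2+49*(x*y*z)^4)*(x*y*z) := by
  linear_combination ((-1)*x^8*z^3 + (-5)*x^5*y^2*z^4 + (-5)*x^4*y^5*z^2 + (-1)*x^3*y^8 + (-5)*x^2*y^4*z^5 + (-1)*y^3*z^8)*hf

theorem id_w03 {R : Type*} [CommRing R] (x y z : R) (hf : x^3*y+y^3*z+z^3*x=0) : ((1)*x^5 + (2)*x^4*y + (1)*x^4*z + (-4)*x^3*y^2 + (1)*x^3*z^2 + (1)*x^2*y^3 + (6)*x^2*y^2*z + (6)*x^2*y*z^2 + (-4)*x^2*z^3 + (1)*x*y^4 + (6)*x*y^2*z^2 + (2)*x*z^4 + (1)*y^5 + (2)*y^4*z + (-4)*y^3*z^2 + (1)*y^2*z^3 + (1)*y*z^4 + (1)*z^5)^3 = (49*(x*y^5+y*z^5+z*x^5-5*x^2*y^2*z^2)^2+13*(x*y^5+y*z^5+z*x^5-5*x^2*y^2*z^2)*((1)*x^3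 + (-1)*x^2*y + (-2)*x^2*z + (-2)*x*y^2 + (-1)*x*y*z + (-1)*x*z^2 + (1)*y^3 + (-1)*y^2*z + (-2)*y*z^2 + (1)*z^3)^2+((1)*x^3 + (-1)*x^2*y + (-2)*x^2*z + (-2)*x*y^2 + (-1)*x*y*z + (-1)*x*z^2 + (1)*y^3 + (-1)*y^2*z + (-2)*y*z^2 + (1)*z^3)^4)*((1)*x^3 + (-1)*x^2*y + (-2)*x^2*z + (-2)*x*y^2 + (-1)*x*y*z + (-1)*x*z^2 + (1)*y^3 + (-1)*y^2*z + (-2)*y*z^2 + (1)*z^3) := by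
  linear_combination ((11)*x^11 + (16)*x^10*z + (-72)*x^9*y^2 + (10)*x^9*y*z + (38)*x^9*z^2 + (50)*x^8*y^3 + (47)*x^8*y^2*z + (132)*x^8*y*z^2 + (49)*x^8*z^3 + (177)*x^7*y^4 + (-176)*x^7*y^2*z^2 + (480)*x^7*y*z^3 + (57)*x^7*z^4 + (-210)*x^6*y^5 + (-364)*x^6*y^4*z + (-434)*x^6*y^3*z^2 + (308)*x^6*y^2*z^3 + (-119)*x^6*y*z^4 + (-56)*x^6*z^5 + (-56)*x^5*y^6 + (308)*x^5*y^5*z + (1267)*x^5*y^4*z^2 + (224)*x^5*y^3*z^3 + (245)*x^5*y^2*z^4 + (308)*x^5*y*z^5 + (-210)*x^5*z^6 + (57)*x^4*y^7 + (-119)*x^4*y^6*z + (245)*x^4*y^5*z^2 + (70)*x^4*y^4*z^3 + (70)*x^4*y^3*z^4 + (1267)*x^4*y^2*z^5 + (-364)*x^4*y*z^6 + (177)*x^4*z^7 + (49)*x^3*y^8 + (480)*x^3*y^7*z + (308)*x^3*y^6*z^2 + (224)*x^3*y^5*z^3 + (70)*x^3*y^4*z^4 + (224)*x^3*y^3*z^5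 + (-434)*x^3*y^2*z^6 + (50)*x^3*z^8 + (38)*x^2*y^9 + (132)*x^2*y^8*z + (-176)*x^2*y^7*z^2 + (-434)*x^2*y^6*z^3 + (1267)*x^2*y^5*z^4 + (245)*x^2*y^4*z^5 + (308)*x^2*y^3*z^6 + (-176)*x^2*y^2*z^7 + (47)*x^2*y*z^8 + (-72)*x^2*z^9 + (16)*x*y^10 + (10)*x*y^9*z + (47)*x*y^8*z^2 + (-364)*x*y^6*z^4 + (308)*x*y^5*z^5 + (-119)*x*y^4*z^6 + (480)*x*y^3*z^7 + (132)*x*y^2*z^8 + (10)*x*y*z^9 + (11)*y^11 + (-72)*y^9*z^2 + (50)*y^8*z^3 + (177)*y^7*z^4 + (-210)*y^6*z^5 + (-56)*y^5*z^6 + (57)*y^4*z^7 + (49)*y^3*z^8 + (38)*y^2*z^9 + (16)*y*z^10 + (11)*z^11)*hf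

theorem id_C {R : Type*} [CommRing R] (x y z : R) (hf : x^3*y+y^3*z+z^3*x=0) : (-(x^2*y^3+y^2*z^3+z^2*x^3))*((x*y^5+y*z^5+z*x^5-5*x^2*y^2*z^2)^2+245*(x*y^5+y*z^5+z*x^5-5*x^2*y^2*z^2)*(x*y*z)^2+2401*(x*y*z)^4)*((1)*x^3 + (-1)*x^2*y + (-2)*x^2*z + (-2)*x*y^2 + (-1)*x*y*z + (-1)*x*z^2 + (1)*y^3 + (-1)*y^2*z + (-2)*y*z^2 + (1)*z^3) = ((1)*x^5 + (2)*x^4*y + (1)*x^4*z + (-4)*x^3*y^2 + (1)*x^3*z^2 + (1)*x^2*y^3 + (6)*x^2*y^2*z + (6)*x^2*y*z^2 + (-4)*x^2*z^3 + (1)*x*y^4 + (6)*x*y^2*z^2 + (2)*x*z^4 + (1)*y^5 + (2)*y^4*z + (-4)*y^3*z^2 + (1)*y^2*z^3 + (1)*y*z^4 + (1)*z^5)*((x*y^5+y*z^5+z*x^5-5*x^2*y^2*z^2)^2+5*(x*y^5+y*z^5+z*x^5-5*x^2*y^2*z^2)*((1)*x^3 + (-1)*x^2*y + (-2)*x^2*z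 + (-2)*x*y^2 + (-1)*x*y*z + (-1)*x*z^2 + (1)*y^3 + (-1)*y^2*z + (-2)*y*z^2 + (1)*z^3)^2+((1)*x^3 + (-1)*x^2*y + (-2)*x^2*z + (-2)*x*y^2 + (-1)*x*y*z + (-1)*x*z^2 + (1)*y^3 + (-1)*y^2*z + (-2)*y*z^2 + (1)*z^3)^4)*(x*y*z) := by
  linear_combination ((-1)*x^15*z + (2)*x^14*y*z + (2)*x^14*z^2 + (14)*x^13*y^2*z + (1)*x^13*z^3 + (-37)*x^12*y^3*z + (-53)*x^12*y^2*z^2 + (-4)*x^12*y*z^3 + (-1)*x^12*z^4 + (-42)*x^11*y^4*z + (66)*x^11*y^3*z^2 + (84)*x^11*y^2*z^3 + (-16)*x^11*y*z^4 + (170)*x^10*y^5*z + (220)*x^10*y^4*z^2 + (10)*x^10*y^2*z^4 + (-109)*x^10*y*z^5 + (-315)*x^9*y^5*z^2 + (-690)*x^9*y^4*z^3 + (-90)*x^9*y^3*z^4 + (9)*x^9*y^2*z^5 + (180)*x^9*y*z^6 + (-294)*x^8*y^7*z + (-216)*x^8*y^6*z^2 + (510)*x^8*y^5*z^3 + (540)*x^8*y^4*z^4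 + (-72)*x^8*y^3*z^5 + (126)*x^8*y*z^7 + (126)*x^7*y^8*z + (300)*x^7*y^7*z^2 + (840)*x^7*y^6*z^3 + (-24)*x^7*y^4*z^5 + (-564)*x^7*y^3*z^6 + (300)*x^7*y^2*z^7 + (-294)*x^7*y*z^8 + (180)*x^6*y^9*z + (-564)*x^6*y^7*z^3 + (-756)*x^6*y^6*z^4 + (210)*x^6*y^5*z^5 + (-756)*x^6*y^4*z^6 + (840)*x^6*y^3*z^7 + (-216)*x^6*y^2*z^8 + (-109)*x^5*y^10*z + (9)*x^5*y^9*z^2 + (-72)*x^5*y^8*z^3 + (-24)*x^5*y^7*z^4 + (210)*x^5*y^6*z^5 + (210)*x^5*y^5*z^6 + (510)*x^5*y^3*z^8 + (-315)*x^5*y^2*z^9 + (170)*x^5*y*z^10 + (-1)*x^4*y^12 + (-16)*x^4*y^11*z + (10)*x^4*y^10*z^2 + (-90)*x^4*y^9*z^3 + (540)*x^4*y^8*z^4 + (-756)*x^4*y^6*z^6 + (-24)*x^4*y^5*z^7 + (540)*x^4*y^4*z^8 + (-690)*x^4*y^3*z^9 + (220)*x^4*y^2*z^10 + (-42)*x^4*y*z^11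 + (1)*x^3*y^13 + (-4)*x^3*y^12*z + (84)*x^3*y^11*z^2 + (-690)*x^3*y^9*z^4 + (510)*x^3*y^8*z^5 + (840)*x^3*y^7*z^6 + (-564)*x^3*y^6*z^7 + (-72)*x^3*y^5*z^8 + (-90)*x^3*y^4*z^9 + (66)*x^3*y^2*z^11 + (-37)*x^3*y*z^12 + (2)*x^2*y^14 + (-53)*x^2*y^12*z^2 + (66)*x^2*y^11*z^3 + (220)*x^2*y^10*z^4 + (-315)*x^2*y^9*z^5 + (-216)*x^2*y^8*z^6 + (300)*x^2*y^7*z^7 + (9)*x^2*y^5*z^9 + (10)*x^2*y^4*z^10 + (84)*x^2*y^3*z^11 + (-53)*x^2*y^2*z^12 + (14)*x^2*y*z^13 + (-1)*x*y^15 + (2)*x*y^14*z + (14)*x*y^13*z^2 + (-37)*x*y^12*z^3 + (-42)*x*y^11*z^4 + (170)*x*y^10*z^5 + (-294)*x*y^8*z^7 + (126)*x*y^7*z^8 + (180)*x*y^6*z^9 + (-109)*x*y^5*z^10 + (-16)*x*y^4*z^11 + (-4)*x*y^3*z^12 + (2)*x*y*z^14 + (-1)*y^4*z^12 + (1)*y^3*z^13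 + (2)*y^2*z^14 + (-1)*y*z^15)*hf

noncomputable section

/-- The Klein quartic. -/
def fK {L : Type*} [Field L] (P : L × L × L) : L := P.1^3*P.2.1+P.2.1^3*P.2.2+P.2.2^3*P.1

/-- Its Hessian covariant. -/
def nb {L : Type*} [Field L] (P : L × L × L) : L :=
  P.1*P.2.1^5+P.2.1*P.2.2^5+P.2.2*P.1^5-5*P.1^2*P.2.1^2*P.2.2^2

/-- The product of the coordinates. -/
def dl {L : Type*} [Field L] (P : L × L × L) : L := P.1*P.2.1*P.2.2

/-- The Hauptmodul of `X_0(7)` on the Klein quartic. -/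
def tt {L : Type*} [Field L] (P : L × L × L) : L := 49*dl P^2/nb P

/-- The involution. -/
def Sm {L : Type*} [Field L] (q : L) (P : L × L × L) : L × L × L :=
  ((q-q^6)*P.1+(q^2-q^5)*P.2.1+(q^4-q^3)*P.2.2,
   (q^2-q^5)*P.1+(q^4-q^3)*P.2.1+(q-q^6)*P.2.2,
   (q^4-q^3)*P.1+(q-q^6)*P.2.1+(q^2-q^5)*P.2.2)

/-- The diagonal element of order 7. -/
def Dm {L : Type*} [Field L] (q : L) (P : L × L × L) : L × L × L := (q*P.1, q^4*P.2.1, q^2*P.2.2)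

/-- The cyclic shift. -/
def Hm {L : Type*} [Field L] (P : L × L × L) : L × L × L := (P.2.1, P.2.2, P.1)

/-- Scaling. -/
def sm {L : Type*} [Field L] (c : L) (P : L × L × L) : L × L × L := (c*P.1, c*P.2.1, c*P.2.2)

/-- The square root of `-7`. -/
def sqm7 {L : Type*} [Field L] (q : L) : L := q-q^6+(q^2-q^5)+(q^4-q^3)

/-- The eight conjugates of the Hauptmodul. -/
def Tl {L : Type*} [Field L] (q : L) (P : L × L × L) (a : OnePoint (ZMod 7)) : L :=
  a.elim (tt P) (fun k => tt (Sm q (Dm (q^k.val) P)))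

/-- Generic points. -/
def Good {L : Type*} [Field L] (P : L × L × L) : Prop := fK P = 0 ∧ nb P ≠ 0

theorem SDS1 {L : Type*} [Field L] (q : L) (hq : 1+q+q^2+q^3+q^4+q^5+q^6=0) (P : L × L × L) :
    Sm q (Dm (q^1) (Sm q P)) = sm (-(sqm7 q)) (Dm (q^5) (Hm (Hm (Sm q (Dm (q^5) P))))) := by
  obtain ⟨x, y, z⟩ := P
  simp only [Sm, Dm, sm, Hm, sqm7, Prod.mk.injEq]
  refine ⟨?_, ?_, ?_⟩
  · linear_combination (((1)*q^3 + (-1)*q^4 + (-2)*q^9 + (4)*q^10 + (-4)*q^11 + (2)*q^12 + (1)*q^13 + (-1)*q^14)*x + ((1)*q^4 + (-1)*q^5 + (-1)*q^6 + (1)*q^7 + (-2)*q^9 + (3)*q^10 + (1)*q^11 + (-1)*q^12 + (-3)*q^13 + (2)*q^14 + (-2)*q^16 + (3)*q^17 + (1)*q^18 + (-1)*q^19 + (-3)*q^20 + (2)*q^21 + (-2)*q^23 + (3)*q^24 + (1)*q^25 + (-1)*q^26 + (-2)*q^27 + (2)*q^28 + (-2)*q^29 + (1)*q^31)*y + ((-1)*q^5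 + (2)*q^6 + (-1)*q^7 + (1)*q^8 + (-1)*q^9 + (1)*q^10 + (-3)*q^11 + (3)*q^13 + (-1)*q^14 + (2)*q^15 + (-2)*q^16 + (1)*q^17 + (-2)*q^18 + (1)*q^20)*z)*hq
  · linear_combination (((1)*q^4 + (-1)*q^5 + (-1)*q^6 + (1)*q^7 + (-2)*q^9 + (3)*q^10 + (1)*q^11 + (-1)*q^12 + (-3)*q^13 + (2)*q^14 + (-2)*q^16 + (3)*q^17 + (1)*q^18 + (-1)*q^19 + (-3)*q^20 + (2)*q^21 + (-2)*q^23 + (3)*q^24 + (1)*q^25 + (-1)*q^26 + (-2)*q^27 + (2)*q^28 + (-2)*q^29 + (1)*q^31)*x + ((1)*q^4 + (-1)*q^6 + (-2)*q^8 + (3)*q^10 + (-1)*q^11 + (2)*q^12 + (-2)*q^13 + (1)*q^14 + (-3)*q^15 + (3)*q^17 + (-1)*q^18 + (2)*q^19 + (-2)*q^20 + (1)*q^21 + (-3)*q^22 + (3)*q^24 + (-1)*q^25 + (2)*q^26 + (-2)*q^27 + (1)*q^28 + (-3)*q^29 + (3)*q^31 + (-1)*q^32 + (2)*q^33 + (-2)*q^34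 + (1)*q^35 + (-3)*q^36 + (3)*q^38 + (-1)*q^39 + (2)*q^40 + (-2)*q^41 + (1)*q^42 + (-2)*q^43 + (1)*q^45)*y + ((1)*q^5 + (-2)*q^6 + (2)*q^7 + (-3)*q^8 + (4)*q^9 + (-4)*q^10 + (2)*q^11 + (1)*q^12 + (-1)*q^14 + (-2)*q^15 + (4)*q^16 + (-4)*q^17 + (2)*q^18 + (1)*q^19 + (-1)*q^21 + (-2)*q^22 + (4)*q^23 + (-4)*q^24 + (2)*q^25 + (1)*q^26 + (-1)*q^28 + (-2)*q^29 + (4)*q^30 + (-4)*q^31 + (2)*q^32 + (1)*q^33 + (-1)*q^34)*z)*hq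
  · linear_combination (((-1)*q^5 + (2)*q^6 + (-1)*q^7 + (1)*q^8 + (-1)*q^9 + (1)*q^10 + (-3)*q^11 + (3)*q^13 + (-1)*q^14 + (2)*q^15 + (-2)*q^16 + (1)*q^17 + (-2)*q^18 + (1)*q^20)*x + ((1)*q^5 + (-2)*q^6 + (2)*q^7 + (-3)*q^8 + (4)*q^9 + (-4)*q^10 + (2)*q^11 + (1)*q^12 + (-1)*q^14 + (-2)*q^15 + (4)*q^16 + (-4)*q^17 + (2)*q^18 + (1)*q^19 + (-1)*q^21 + (-2)*q^22 + (4)*q^23 + (-4)*q^24 + (2)*q^25 + (1)*q^26 + (-1)*q^28 + (-2)*q^29 + (4)*q^30 + (-4)*q^31 + (2)*q^32 + (1)*q^33 + (-1)*q^34)*y + ((2)*q^6 + (-1)*q^7 + (-3)*q^8 + (1)*q^9 + (1)*q^10 + (-2)*q^11 + (3)*q^12 + (1)*q^13 + (-1)*q^14 + (-3)*q^15 + (2)*q^16 + (-2)*q^18 + (3)*q^19 + (1)*q^20 + (-1)*q^21 + (-2)*q^22 + (2)*q^23 + (-2)*q^24 + (1)*q^26)*z)*hq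

theorem SDS2 {L : Type*} [Field L] (q : L) (hq : 1+q+q^2+q^3+q^4+q^5+q^6=0) (P : L × L × L) :
    Sm q (Dm (q^2) (Sm q P)) = sm (-(sqm7 q)) (Dm (q^6) (Hm (Sm q (Dm (q^6) P)))) := by
  obtain ⟨x, y, z⟩ := P
  simp only [Sm, Dm, sm, Hm, sqm7, Prod.mk.injEq]
  refine ⟨?_, ?_, ?_⟩
  · linear_combination (((1)*q^4 + (-1)*q^5 + (-2)*q^9 + (3)*q^10 + (-2)*q^11 + (3)*q^12 + (-2)*q^13 + (1)*q^14 + (-2)*q^15 + (1)*q^17)*x + ((1)*q^5 + (-1)*q^6 + (-2)*q^8 + (3)*q^9 + (-2)*q^10 + (1)*q^11 + (1)*q^12 + (-1)*q^14 + (-2)*q^15 + (4)*q^16 + (-4)*q^17 + (2)*q^18 + (1)*q^19 + (-1)*q^21 + (-2)*q^22 + (4)*q^23 + (-4)*q^24 + (2)*q^25 + (1)*q^26 + (-1)*q^28 + (-2)*q^29 + (4)*q^30 + (-4)*q^31 + (2)*q^32 + (1)*q^33 + (-1)*q^34)*y + ((-1)*q^6 + (2)*q^7 + (-1)*q^8 +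 (-1)*q^9 + (2)*q^10 + (1)*q^11 + (-2)*q^12 + (-2)*q^13 + (2)*q^14 + (-2)*q^16 + (3)*q^17 + (1)*q^18 + (-1)*q^19 + (-2)*q^20 + (2)*q^21 + (-2)*q^22 + (1)*q^24)*z)*hq
  · linear_combination (((1)*q^5 + (-1)*q^6 + (-2)*q^8 + (3)*q^9 + (-2)*q^10 + (1)*q^11 + (1)*q^12 + (-1)*q^14 + (-2)*q^15 + (4)*q^16 + (-4)*q^17 + (2)*q^18 + (1)*q^19 + (-1)*q^21 + (-2)*q^22 + (4)*q^23 + (-4)*q^24 + (2)*q^25 + (1)*q^26 + (-1)*q^28 + (-2)*q^29 + (4)*q^30 + (-4)*q^31 + (2)*q^32 + (1)*q^33 + (-1)*q^34)*x + ((2)*q^6 + (-2)*q^7 + (-2)*q^9 + (2)*q^10 + (-2)*q^11 + (3)*q^12 + (1)*q^13 + (-1)*q^14 + (-3)*q^15 + (2)*q^16 + (-2)*q^18 + (3)*q^19 + (1)*q^20 + (-1)*q^21 + (-3)*q^22 + (2)*q^23 + (-2)*q^25 + (3)*q^26 + (1)*q^27 + (-1)*q^28 + (-3)*q^29 + (2)*q^30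 + (-2)*q^32 + (3)*q^33 + (1)*q^34 + (-1)*q^35 + (-3)*q^36 + (2)*q^37 + (-2)*q^39 + (3)*q^40 + (1)*q^41 + (-1)*q^42 + (-3)*q^43 + (2)*q^44 + (-2)*q^46 + (3)*q^47 + (1)*q^48 + (-1)*q^49 + (-2)*q^50 + (2)*q^51 + (-2)*q^52 + (1)*q^54)*y + ((1)*q^8 + (-1)*q^9 + (-1)*q^11 + (-1)*q^12 + (3)*q^13 + (-1)*q^14 + (2)*q^15 + (-2)*q^16 + (1)*q^17 + (-3)*q^18 + (3)*q^20 + (-1)*q^21 + (2)*q^22 + (-2)*q^23 + (1)*q^24 + (-3)*q^25 + (3)*q^27 + (-1)*q^28 + (2)*q^29 + (-2)*q^30 + (1)*q^31 + (-3)*q^32 + (3)*q^34 + (-1)*q^35 + (2)*q^36 + (-2)*q^37 + (1)*q^38 + (-2)*q^39 + (1)*q^41)*z)*hq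
  · linear_combination (((-1)*q^6 + (2)*q^7 + (-1)*q^8 + (-1)*q^9 + (2)*q^10 + (1)*q^11 + (-2)*q^12 + (-2)*q^13 + (2)*q^14 + (-2)*q^16 + (3)*q^17 + (1)*q^18 + (-1)*q^19 + (-2)*q^20 + (2)*q^21 + (-2)*q^22 + (1)*q^24)*x + ((1)*q^8 + (-1)*q^9 + (-1)*q^11 + (-1)*q^12 + (3)*q^13 + (-1)*q^14 + (2)*q^15 + (-2)*q^16 + (1)*q^17 + (-3)*q^18 + (3)*q^20 + (-1)*q^21 + (2)*q^22 + (-2)*q^23 + (1)*q^24 + (-3)*q^25 + (3)*q^27 + (-1)*q^28 + (2)*q^29 + (-2)*q^30 + (1)*q^31 + (-3)*q^32 + (3)*q^34 + (-1)*q^35 + (2)*q^36 + (-2)*q^37 + (1)*q^38 + (-2)*q^39 + (1)*q^41)*y + ((2)*q^8 + (-4)*q^9 + (4)*q^10 + (-4)*q^11 + (2)*q^12 + (1)*q^14 + (-1)*q^15 + (-2)*q^16 + (4)*q^17 + (-4)*q^18 + (2)*q^19 + (1)*q^20 + (-1)*q^22 + (-2)*q^23 + (4)*q^24 + (-4)*q^25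 + (2)*q^26 + (1)*q^27 + (-1)*q^28)*z)*hq

theorem SDS3 {L : Type*} [Field L] (q : L) (hq : 1+q+q^2+q^3+q^4+q^5+q^6=0) (P : L × L × L) :
    Sm q (Dm (q^3) (Sm q P)) = sm (-(sqm7 q)) (Dm (q^4) (Sm q (Dm (q^4) P))) := by
  obtain ⟨x, y, z⟩ := P
  simp only [Sm, Dm, sm, Hm, sqm7, Prod.mk.injEq]
  refine ⟨?_, ?_, ?_⟩
  · linear_combination (((1)*q^5 + (-1)*q^6 + (-1)*q^10 + (2)*q^11 + (-2)*q^13 + (1)*q^14 + (-1)*q^15 + (1)*q^16)*x + ((1)*q^6 + (-1)*q^7 + (-1)*q^9 + (1)*q^11 + (1)*q^13 + (-3)*q^16 + (3)*q^18 + (-1)*q^19 + (2)*q^20 + (-2)*q^21 + (1)*q^22 + (-2)*q^23 + (1)*q^25)*y + ((-1)*q^7 + (2)*q^8 + (-1)*q^9 + (-1)*q^11 + (3)*q^12 + (-3)*q^13 + (1)*q^14 + (1)*q^15 + (-2)*q^16 + (1)*q^17)*z)*hq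
  · linear_combination (((1)*q^6 + (-1)*q^7 + (-1)*q^9 + (1)*q^11 + (1)*q^13 + (-3)*q^16 + (3)*q^18 + (-1)*q^19 + (2)*q^20 + (-2)*q^21 + (1)*q^22 + (-2)*q^23 + (1)*q^25)*x + ((1)*q^7 + (-1)*q^9 + (-2)*q^10 + (2)*q^11 + (-1)*q^13 + (2)*q^14 + (-1)*q^16 + (-2)*q^17 + (4)*q^18 + (-4)*q^19 + (2)*q^20 + (1)*q^21 + (-1)*q^23 + (-2)*q^24 + (4)*q^25 + (-4)*q^26 + (2)*q^27 + (1)*q^28 + (-1)*q^30 + (-2)*q^31 + (4)*q^32 + (-4)*q^33 + (2)*q^34 + (1)*q^35 + (-1)*q^36)*y + ((-1)*q^8 + (3)*q^9 + (-2)*q^10 + (1)*q^11 + (-3)*q^12 + (2)*q^13 + (-1)*q^14 + (2)*q^16 + (1)*q^17 + (-1)*q^18 + (-3)*q^19 + (2)*q^20 + (-2)*q^22 + (3)*q^23 + (1)*q^24 + (-1)*q^25 + (-2)*q^26 + (2)*q^27 + (-2)*q^28 + (1)*q^30)*z)*hq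
  · linear_combination (((-1)*q^7 + (2)*q^8 + (-1)*q^9 + (-1)*q^11 + (3)*q^12 + (-3)*q^13 + (1)*q^14 + (1)*q^15 + (-2)*q^16 + (1)*q^17)*x + ((-1)*q^8 + (3)*q^9 + (-2)*q^10 + (1)*q^11 + (-3)*q^12 + (2)*q^13 + (-1)*q^14 + (2)*q^16 + (1)*q^17 + (-1)*q^18 + (-3)*q^19 + (2)*q^20 + (-2)*q^22 + (3)*q^23 + (1)*q^24 + (-1)*q^25 + (-2)*q^26 + (2)*q^27 + (-2)*q^28 + (1)*q^30)*y + ((1)*q^9 + (-2)*q^10 + (2)*q^11 + (-1)*q^12 + (-2)*q^13 + (3)*q^14 + (-1)*q^15 + (2)*q^16 + (-3)*q^17 + (2)*q^18 + (-2)*q^19 + (1)*q^21)*z)*hq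

theorem SDS4 {L : Type*} [Field L] (q : L) (hq : 1+q+q^2+q^3+q^4+q^5+q^6=0) (P : L × L × L) :
    Sm q (Dm (q^4) (Sm q P)) = sm (-(sqm7 q)) (Dm (q^3) (Sm q (Dm (q^3) P))) := by
  obtain ⟨x, y, z⟩ := P
  simp only [Sm, Dm, sm, Hm, sqm7, Prod.mk.injEq]
  refine ⟨?_, ?_, ?_⟩
  · linear_combination (((1)*q^6 + (-1)*q^7 + (1)*q^8 + (-2)*q^10 + (1)*q^14 + (2)*q^16 + (-2)*q^17 + (-1)*q^19 + (1)*q^20)*x + ((1)*q^7 + (-1)*q^8 + (-1)*q^10 + (1)*q^11 + (-2)*q^12 + (3)*q^13 + (-1)*q^16 + (-1)*q^19 + (1)*q^20)*y + ((-1)*q^8 + (2)*q^9 + (-1)*q^10 + (-1)*q^13 + (1)*q^14 + (1)*q^15 + (-1)*q^16 + (1)*q^17 + (-1)*q^18 + (-1)*q^20 + (1)*q^21)*z)*hq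
  · linear_combination (((1)*q^7 + (-1)*q^8 + (-1)*q^10 + (1)*q^11 + (-2)*q^12 + (3)*q^13 + (-1)*q^16 + (-1)*q^19 + (1)*q^20)*x + ((1)*q^8 + (-1)*q^9 + (1)*q^10 + (-3)*q^11 + (2)*q^12 + (1)*q^14 + (-2)*q^15 + (1)*q^16 + (1)*q^17 + (-3)*q^18 + (2)*q^19 + (1)*q^20 + (-1)*q^22 + (-2)*q^23 + (4)*q^24 + (-4)*q^25 + (2)*q^26 + (1)*q^27 + (-1)*q^28)*y + ((-1)*q^9 + (2)*q^10 + (-2)*q^13 + (1)*q^15 + (-2)*q^16 + (3)*q^17 + (1)*q^19 + (-3)*q^20 + (2)*q^21 + (-2)*q^22 + (1)*q^24)*z)*hq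
  · linear_combination (((-1)*q^8 + (2)*q^9 + (-1)*q^10 + (-1)*q^13 + (1)*q^14 + (1)*q^15 + (-1)*q^16 + (1)*q^17 + (-1)*q^18 + (-1)*q^20 + (1)*q^21)*x + ((-1)*q^9 + (2)*q^10 + (-2)*q^13 + (1)*q^15 + (-2)*q^16 + (3)*q^17 + (1)*q^19 + (-3)*q^20 + (2)*q^21 + (-2)*q^22 + (1)*q^24)*y + ((1)*q^10 + (-3)*q^11 + (4)*q^12 + (-2)*q^13 + (-1)*q^15 + (2)*q^16 + (-1)*q^17 + (-1)*q^21 + (1)*q^22)*z)*hq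

theorem SDS5 {L : Type*} [Field L] (q : L) (hq : 1+q+q^2+q^3+q^4+q^5+q^6=0) (P : L × L × L) :
    Sm q (Dm (q^5) (Sm q P)) = sm (-(sqm7 q)) (Dm (q^1) (Hm (Sm q (Dm (q^1) P)))) := by
  obtain ⟨x, y, z⟩ := P
  simp only [Sm, Dm, sm, Hm, sqm7, Prod.mk.injEq]
  refine ⟨?_, ?_, ?_⟩
  · linear_combination (((1)*q^5 + (-1)*q^7 + (-2)*q^9 + (2)*q^10 + (-1)*q^11 + (1)*q^12 + (2)*q^13 + (-2)*q^14 + (-1)*q^16 + (1)*q^18 + (2)*q^20 + (-2)*q^21 + (-1)*q^23 + (1)*q^24)*x + ((1)*q^8 + (-2)*q^9 + (1)*q^10 + (1)*q^11 + (-3)*q^12 + (3)*q^13 + (-2)*q^14 + (2)*q^15 + (-1)*q^16 + (1)*q^18 + (-2)*q^19 + (1)*q^20 + (-1)*q^21 + (2)*q^22 + (-1)*q^23)*y + ((1)*q^5 + (-2)*q^7 + (2)*q^8 + (-3)*q^9 + (1)*q^10 + (3)*q^12 + (-2)*q^13 + (1)*q^14 + (-1)*q^15 + (-1)*q^16 +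 (1)*q^18 + (1)*q^19 + (-1)*q^20 + (1)*q^21 + (-1)*q^22 + (-1)*q^24 + (1)*q^25)*z)*hq
  · linear_combination (((1)*q^8 + (-2)*q^9 + (1)*q^10 + (1)*q^11 + (-3)*q^12 + (3)*q^13 + (-2)*q^14 + (2)*q^15 + (-1)*q^16 + (1)*q^18 + (-2)*q^19 + (1)*q^20 + (-1)*q^21 + (2)*q^22 + (-1)*q^23)*x + ((1)*q^9 + (-3)*q^12 + (3)*q^13 + (-2)*q^14 + (1)*q^16 + (-1)*q^19 + (3)*q^20 + (-3)*q^21 + (1)*q^22)*y + ((1)*q^9 + (-1)*q^10 + (-1)*q^14 + (2)*q^16 + (-2)*q^18 + (1)*q^19 + (-1)*q^22 + (2)*q^23 + (-1)*q^24)*z)*hq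
  · linear_combination (((1)*q^5 + (-2)*q^7 + (2)*q^8 + (-3)*q^9 + (1)*q^10 + (3)*q^12 + (-2)*q^13 + (1)*q^14 + (-1)*q^15 + (-1)*q^16 + (1)*q^18 + (1)*q^19 + (-1)*q^20 + (1)*q^21 + (-1)*q^22 + (-1)*q^24 + (1)*q^25)*x + ((1)*q^9 + (-1)*q^10 + (-1)*q^14 + (2)*q^16 + (-2)*q^18 + (1)*q^19 + (-1)*q^22 + (2)*q^23 + (-1)*q^24)*y + ((-1)*q^8 + (1)*q^9 + (2)*q^10 + (-3)*q^11 + (1)*q^12 + (1)*q^13 + (-1)*q^14 + (-1)*q^15 + (1)*q^16 + (-1)*q^18 + (1)*q^19 + (2)*q^20 + (-2)*q^21 + (-1)*q^25 + (1)*q^26)*z)*hq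

theorem SDS6 {L : Type*} [Field L] (q : L) (hq : 1+q+q^2+q^3+q^4+q^5+q^6=0) (P : L × L × L) :
    Sm q (Dm (q^6) (Sm q P)) = sm (-(sqm7 q)) (Dm (q^2) (Hm (Hm (Sm q (Dm (q^2) P))))) := by
  obtain ⟨x, y, z⟩ := P
  simp only [Sm, Dm, sm, Hm, sqm7, Prod.mk.injEq]
  refine ⟨?_, ?_, ?_⟩
  · linear_combination (((2)*q^10 + (-4)*q^11 + (4)*q^12 + (-4)*q^13 + (1)*q^14 + (1)*q^15 + (2)*q^17 + (-2)*q^18 + (-1)*q^20 + (1)*q^22 + (2)*q^24 + (-2)*q^25 + (-1)*q^27 + (1)*q^28)*x + ((1)*q^9 + (-1)*q^10 + (1)*q^13 + (-3)*q^14 + (3)*q^15 + (-2)*q^16 + (1)*q^17 + (-1)*q^18 + (2)*q^19 + (-1)*q^20 + (1)*q^22 + (-2)*q^23 + (1)*q^24 + (-1)*q^25 + (2)*q^26 + (-1)*q^27)*y + ((1)*q^9 + (-1)*q^10 + (-2)*q^13 + (2)*q^14 + (1)*q^16 + (-1)*q^17 + (1)*q^18 + (-1)*q^19 + (-1)*q^20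 + (1)*q^22 + (1)*q^23 + (-1)*q^24 + (1)*q^25 + (-1)*q^26 + (-1)*q^28 + (1)*q^29)*z)*hq
  · linear_combination (((1)*q^9 + (-1)*q^10 + (1)*q^13 + (-3)*q^14 + (3)*q^15 + (-2)*q^16 + (1)*q^17 + (-1)*q^18 + (2)*q^19 + (-1)*q^20 + (1)*q^22 + (-2)*q^23 + (1)*q^24 + (-1)*q^25 + (2)*q^26 + (-1)*q^27)*x + ((1)*q^10 + (-1)*q^11 + (-2)*q^13 + (3)*q^14 + (-1)*q^15 + (1)*q^16 + (-1)*q^18 + (-1)*q^19 + (1)*q^21 + (-1)*q^23 + (3)*q^24 + (-3)*q^25 + (1)*q^26)*y + ((-1)*q^11 + (2)*q^12 + (-1)*q^13 + (1)*q^14 + (-1)*q^15 + (-1)*q^16 + (1)*q^17 + (-1)*q^19 + (2)*q^20 + (-2)*q^22 + (1)*q^23 + (-1)*q^26 + (2)*q^27 + (-1)*q^28)*z)*hq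
  · linear_combination (((1)*q^9 + (-1)*q^10 + (-2)*q^13 + (2)*q^14 + (1)*q^16 + (-1)*q^17 + (1)*q^18 + (-1)*q^19 + (-1)*q^20 + (1)*q^22 + (1)*q^23 + (-1)*q^24 + (1)*q^25 + (-1)*q^26 + (-1)*q^28 + (1)*q^29)*x + ((-1)*q^11 + (2)*q^12 + (-1)*q^13 + (1)*q^14 + (-1)*q^15 + (-1)*q^16 + (1)*q^17 + (-1)*q^19 + (2)*q^20 + (-2)*q^22 + (1)*q^23 + (-1)*q^26 + (2)*q^27 + (-1)*q^28)*y + ((1)*q^10 + (-1)*q^12 + (-1)*q^13 + (1)*q^14 + (-2)*q^15 + (2)*q^16 + (2)*q^17 + (-2)*q^18 + (-1)*q^19 + (1)*q^20 + (-1)*q^22 + (1)*q^23 + (2)*q^24 + (-2)*q^25 + (-1)*q^29 + (1)*q^30)*z)*hq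

theorem Schg2 {L : Type*} [Field L] (q : L) (h7 : q^7=1) (P : L × L × L) :
    Sm (q^2) P = Hm (Sm q P) := by
  obtain ⟨x, y, z⟩ := P
  simp only [Sm, sm, Hm, Prod.mk.injEq]
  refine ⟨?_, ?_, ?_⟩
  · linear_combination (((-1)*q^5)*x + ((-1)*q^3)*y + ((1)*q^1)*z)*h7
  · linear_combination (((-1)*q^3)*x + ((1)*q^1)*y + ((-1)*q^5)*z)*h7
  · linear_combination (((1)*q^1)*x + ((-1)*q^5)*y + ((-1)*q^3)*z)*h7

theorem Schg3 {L : Type*} [Field L] (q : L) (h7 : q^7=1) (P : L × L × L) :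
    Sm (q^3) P = sm (-1) (Hm (Hm (Sm q P))) := by
  obtain ⟨x, y, z⟩ := P
  simp only [Sm, sm, Hm, Prod.mk.injEq]
  refine ⟨?_, ?_, ?_⟩
  · linear_combination (((-1)*q^4 + (-1)*q^11)*x + ((-1)*q^1 + (-1)*q^8)*y + ((-1)*q^2 + (1)*q^5)*z)*h7
  · linear_combination (((-1)*q^1 + (-1)*q^8)*x + ((-1)*q^2 + (1)*q^5)*y + ((-1)*q^4 + (-1)*q^11)*z)*h7
  · linear_combination (((-1)*q^2 + (1)*q^5)*x + ((-1)*q^4 + (-1)*q^11)*y + ((-1)*q^1 + (-1)*q^8)*z)*h7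

theorem Schg4 {L : Type*} [Field L] (q : L) (h7 : q^7=1) (P : L × L × L) :
    Sm (q^4) P = Hm (Hm (Sm q P)) := by
  obtain ⟨x, y, z⟩ := P
  simp only [Sm, sm, Hm, Prod.mk.injEq]
  refine ⟨?_, ?_, ?_⟩
  · linear_combination (((-1)*q^3 + (-1)*q^10 + (-1)*q^17)*x + ((1)*q^1 + (-1)*q^6 + (-1)*q^13)*y + ((1)*q^2 + (-1)*q^5 + (1)*q^9)*z)*h7
  · linear_combination (((1)*q^1 + (-1)*q^6 + (-1)*q^13)*x + ((1)*q^2 + (-1)*q^5 + (1)*q^9)*y + ((-1)*q^3 + (-1)*q^10 + (-1)*q^17)*z)*h7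
  · linear_combination (((1)*q^2 + (-1)*q^5 + (1)*q^9)*x + ((-1)*q^3 + (-1)*q^10 + (-1)*q^17)*y + ((1)*q^1 + (-1)*q^6 + (-1)*q^13)*z)*h7

theorem Schg5 {L : Type*} [Field L] (q : L) (h7 : q^7=1) (P : L × L × L) :
    Sm (q^5) P = sm (-1) (Hm (Sm q P)) := by
  obtain ⟨x, y, z⟩ := P
  simp only [Sm, sm, Hm, Prod.mk.injEq]
  refine ⟨?_, ?_, ?_⟩
  · linear_combination (((-1)*q^2 + (-1)*q^9 + (-1)*q^16 + (-1)*q^23)*x + ((1)*q^3 + (-1)*q^4 + (-1)*q^11 + (-1)*q^18)*y + ((-1)*q^1 + (1)*q^6 + (-1)*q^8 + (1)*q^13)*z)*h7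
  · linear_combination (((1)*q^3 + (-1)*q^4 + (-1)*q^11 + (-1)*q^18)*x + ((-1)*q^1 + (1)*q^6 + (-1)*q^8 + (1)*q^13)*y + ((-1)*q^2 + (-1)*q^9 + (-1)*q^16 + (-1)*q^23)*z)*h7
  · linear_combination (((-1)*q^1 + (1)*q^6 + (-1)*q^8 + (1)*q^13)*x + ((-1)*q^2 + (-1)*q^9 + (-1)*q^16 + (-1)*q^23)*y + ((1)*q^3 + (-1)*q^4 + (-1)*q^11 + (-1)*q^18)*z)*h7

theorem Schg6 {L : Type*} [Field L] (q : L) (h7 : q^7=1) (P : L × L × L) :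
    Sm (q^6) P = sm (-1) (Sm q P) := by
  obtain ⟨x, y, z⟩ := P
  simp only [Sm, sm, Hm, Prod.mk.injEq]
  refine ⟨?_, ?_, ?_⟩
  · linear_combination (((-1)*q^1 + (-1)*q^8 + (-1)*q^15 + (-1)*q^22 + (-1)*q^29)*x + ((-1)*q^2 + (1)*q^5 + (-1)*q^9 + (-1)*q^16 + (-1)*q^23)*y + ((1)*q^3 + (-1)*q^4 + (1)*q^10 + (-1)*q^11 + (1)*q^17)*z)*h7
  · linear_combination (((-1)*q^2 + (1)*q^5 + (-1)*q^9 + (-1)*q^16 + (-1)*q^23)*x + ((1)*q^3 + (-1)*q^4 + (1)*q^10 + (-1)*q^11 + (1)*q^17)*y + ((-1)*q^1 + (-1)*q^8 + (-1)*q^15 + (-1)*q^22 + (-1)*q^29)*z)*h7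
  · linear_combination (((1)*q^3 + (-1)*q^4 + (1)*q^10 + (-1)*q^11 + (1)*q^17)*x + ((-1)*q^1 + (-1)*q^8 + (-1)*q^15 + (-1)*q^22 + (-1)*q^29)*y + ((-1)*q^2 + (1)*q^5 + (-1)*q^9 + (-1)*q^16 + (-1)*q^23)*z)*h7

end

section main_lemmas

theorem prime_seven_fact : Fact (Nat.Prime 7) := ⟨by norm_num⟩

attribute [local instance] prime_seven_fact


theorem stab_center (g : Matrix.GeneralLinearGroup (Fin 2) (ZMod 7))
    (h : ∀ a : OnePoint (ZMod 7), g • a = a) :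
    g ∈ Subgroup.center (Matrix.GeneralLinearGroup (Fin 2) (ZMod 7)) := by
  have h1 := OnePoint.smul_infty_eq_self_iff.mp (h OnePoint.infty)
  have h2 := h ((0 : ZMod 7) : OnePoint (ZMod 7))
  have h3 := h ((1 : ZMod 7) : OnePoint (ZMod 7))
  rw [OnePoint.smul_some_eq_ite] at h2 h3
  have hd : g 1 1 ≠ 0 := by
    intro h0
    simp [h0, h1] at h3
  simp [h1, hd] at h2 h3

  simp [h2] at h3
  rw [div_eq_iff hd, one_mul] at h3
  rw [Matrix.GeneralLinearGroup.mem_center_iff_val_mem_range_scalar]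
  refine ⟨g 0 0, ?_⟩
  ext i j
  fin_cases i <;> fin_cases j <;> simp [h1, h2, h3]

theorem center_stab (g : Matrix.GeneralLinearGroup (Fin 2) (ZMod 7))
    (hg : g ∈ Subgroup.center (Matrix.GeneralLinearGroup (Fin 2) (ZMod 7)))
    (a : OnePoint (ZMod 7)) : g • a = a := by
  rw [Matrix.GeneralLinearGroup.mem_center_iff_val_mem_range_scalar] at hg
  obtain ⟨c, hc⟩ := hg
  have h1 : g 1 0 = 0 := by rw [← hc]; simp
  have h2 : g 0 1 = 0 := by rw [← hc]; simp
  have h3 : g 0 0 = c := by rw [← hc]; simp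
  have h4 : g 1 1 = c := by rw [← hc]; simp
  have hc0 : c ≠ 0 := by
    rintro rfl
    apply g.det_ne_zero
    rw [Matrix.det_fin_two]; simp [h1, h2, h3]
  induction a using OnePoint.rec with
  | infty => exact OnePoint.smul_infty_eq_self_iff.mpr h1
  | coe k =>
    rw [OnePoint.smul_some_eq_ite]
    simp [h1, h2, h3, h4, hc0]

theorem group_part {G Ω : Type*} [Group G] [MulAction G Ω] (T : OnePoint (ZMod 7) → Ω)
    (hinj : Function.Injective T) (hfaith : ∀ σ : G, (∀ a, σ • T a = T a) → σ = 1)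
    (hM : ∀ σ : G, ∃ M : Matrix.GeneralLinearGroup (Fin 2) (ZMod 7), ∀ a, σ • T a = T (M • a)) :
    ∃ f : G →* PGL2F7, Function.Injective f := by
  choose M hM using hM
  refine ⟨MonoidHom.mk' (fun σ => (M σ : PGL2F7)) ?_, ?_⟩
  · intro σ τ
    rw [← QuotientGroup.mk_mul, eq_comm, QuotientGroup.eq]
    apply stab_center
    intro a
    rw [mul_smul, inv_smul_eq_iff]
    apply hinj
    rw [← hM, mul_smul, mul_smul, hM, hM]
  · rw [injective_iff_map_eq_one]
    intro σ hσ
    have h : M σ ∈ Subgroup.center (Matrix.GeneralLinearGroup (Fin 2) (ZMod 7)) := by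
      rw [← QuotientGroup.eq_one_iff]; exact hσ
    apply hfaith
    intro a
    rw [hM, center_stab _ h]


section geometry

variable {L : Type*} [Field L]

theorem q7_of {q : L} (hq : 1+q+q^2+q^3+q^4+q^5+q^6=0) : q^7 = 1 := by
  linear_combination (q-1)*hq

theorem sq_sqm7 {q : L} (hq : 1+q+q^2+q^3+q^4+q^5+q^6=0) : sqm7 q ^ 2 = -7 := by
  unfold sqm7
  linear_combination ((7 + (-7)*q^1 + (1)*q^2 + (1)*q^3 + (-3)*q^4 + (1)*q^5 + (1)*q^6))*hq

theorem sqm7_ne {q : L} (h7 : (7:L) ≠ 0) (hq : 1+q+q^2+q^3+q^4+q^5+q^6=0) : sqm7 q ≠ 0 := by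
  intro h
  have := sq_sqm7 hq
  rw [h] at this
  apply h7
  linear_combination this

theorem pow_mod7 {q : L} (hq : q^7 = 1) (n : ℕ) : q^(n%7) = q^n := by
  conv_rhs => rw [← Nat.mod_add_div n 7, pow_add, pow_mul, hq, one_pow, mul_one]

theorem qval_add {q : L} (hq : q^7 = 1) (a b : ZMod 7) :
    q^(a+b).val = q^a.val * q^b.val := by
  rw [ZMod.val_add, pow_mod7 hq, pow_add]

theorem qval_mul {q : L} (hq : q^7 = 1) (a b : ZMod 7) :
    q^(a*b).val = (q^a.val)^b.val := by
  rw [ZMod.val_mul, pow_mod7 hq, pow_mul]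

theorem tt_sm {c : L} (hc : c ≠ 0) (P : L × L × L) : tt (sm c P) = tt P := by
  have h1 : 49 * dl (sm c P)^2 = c^6 * (49 * dl P^2) := by simp only [dl, sm]; ring
  have h2 : nb (sm c P) = c^6 * nb P := by simp only [nb, sm]; ring
  unfold tt
  rw [h1, h2, mul_div_mul_left _ _ (pow_ne_zero 6 hc)]

theorem nb_Dm {r : L} (hr : r^7 = 1) (P : L × L × L) : nb (Dm r P) = nb P := by
  simp only [nb, Dm]
  linear_combination (P.1*P.2.1^5*(r^14+r^7+1)+P.2.1*P.2.2^5*(r^7+1)+P.2.2*P.1^5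
    -5*P.1^2*P.2.1^2*P.2.2^2*(r^7+1))*hr

theorem fK_Dm {r : L} (hr : r^7 = 1) (P : L × L × L) : fK (Dm r P) = fK P := by
  simp only [fK, Dm]
  linear_combination (P.1^3*P.2.1+P.2.1^3*P.2.2*(r^7+1)+P.2.2^3*P.1)*hr

theorem dl_Dm {r : L} (hr : r^7 = 1) (P : L × L × L) : dl (Dm r P) = dl P := by
  simp only [dl, Dm]
  linear_combination (P.1*P.2.1*P.2.2)*hr

theorem tt_Dm {r : L} (hr : r^7 = 1) (P : L × L × L) : tt (Dm r P) = tt P := by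
  unfold tt
  rw [nb_Dm hr, dl_Dm hr]

theorem nb_Hm (P : L × L × L) : nb (Hm P) = nb P := by
  simp only [nb, Hm]; ring

theorem fK_Hm (P : L × L × L) : fK (Hm P) = fK P := by
  simp only [fK, Hm]; ring

theorem dl_Hm (P : L × L × L) : dl (Hm P) = dl P := by
  simp only [dl, Hm]; ring

theorem tt_Hm (P : L × L × L) : tt (Hm P) = tt P := by
  unfold tt
  rw [nb_Hm, dl_Hm]

theorem Good.sm {c : L} (hc : c ≠ 0) {P : L × L × L} (h : Good P) : Good (sm c P) := by
  refine ⟨?_, ?_⟩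
  · have : fK (_root_.sm c P) = c^4 * fK P := by simp only [fK, _root_.sm]; ring
    rw [this, h.1, mul_zero]
  · have h2 : nb (_root_.sm c P) = c^6 * nb P := by simp only [nb, _root_.sm]; ring
    rw [h2]
    exact mul_ne_zero (pow_ne_zero 6 hc) h.2

theorem Good.Dm {r : L} (hr : r^7 = 1) {P : L × L × L} (h : Good P) : Good (Dm r P) :=
  ⟨by rw [fK_Dm hr, h.1], by rw [nb_Dm hr]; exact h.2⟩

theorem Good.Hm {P : L × L × L} (h : Good P) : Good (Hm P) :=
  ⟨by rw [fK_Hm, h.1], by rw [nb_Hm]; exact h.2⟩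

theorem nb_Sm {q : L} (hq : 1+q+q^2+q^3+q^4+q^5+q^6=0) (P : L × L × L) :
    nb (Sm q P) = -343 * nb P := id_nab q P.1 P.2.1 P.2.2 hq

theorem fK_Sm {q : L} (hq : 1+q+q^2+q^3+q^4+q^5+q^6=0) (P : L × L × L) :
    fK (Sm q P) = 49 * fK P := id_klein q P.1 P.2.1 P.2.2 hq

theorem Good.Sm (h7 : (7:L) ≠ 0) {q : L} (hq : 1+q+q^2+q^3+q^4+q^5+q^6=0) {P : L × L × L}
    (h : Good P) : Good (Sm q P) := by
  refine ⟨by rw [fK_Sm hq, h.1, mul_zero], ?_⟩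
  rw [nb_Sm hq]
  refine mul_ne_zero ?_ h.2
  rw [show (-343 : L) = -(7^3) by norm_num]
  exact neg_ne_zero.mpr (pow_ne_zero 3 h7)

theorem Good.x_ne {P : L × L × L} (h : Good P) : P.1 ≠ 0 := by
  intro h0
  obtain ⟨h1, h2⟩ := h
  apply h2
  simp only [fK, h0] at h1
  have h3 : P.2.1^3 * P.2.2 = 0 := by linear_combination h1
  simp only [nb, h0]
  rcases mul_eq_zero.mp h3 with h4 | h4
  · rw [pow_eq_zero_iff (by norm_num)] at h4
    rw [h4]; ring
  · rw [h4]; ring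

theorem Good.y_ne {P : L × L × L} (h : Good P) : P.2.1 ≠ 0 := h.Hm.x_ne
theorem Good.z_ne {P : L × L × L} (h : Good P) : P.2.2 ≠ 0 := h.Hm.Hm.x_ne

theorem Good.dl_ne {P : L × L × L} (h : Good P) : dl P ≠ 0 :=
  mul_ne_zero (mul_ne_zero h.x_ne h.y_ne) h.z_ne

/-- The cubic form conjugate to the product of the coordinates. -/
def mf (P : L × L × L) : L := P.1^3 - P.1^2*P.2.1 - 2*P.1^2*P.2.2 - 2*P.1*P.2.1^2
  - P.1*P.2.1*P.2.2 - P.1*P.2.2^2 + P.2.1^3 - P.2.1^2*P.2.2 - 2*P.2.1*P.2.2^2 + P.2.2^3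

theorem dl_Sm {q : L} (hq : 1+q+q^2+q^3+q^4+q^5+q^6=0) (P : L × L × L) :
    dl (Sm q P) = sqm7 q * mf P := by
  have := id_prod q P.1 P.2.1 P.2.2 hq
  simp only [dl, Sm, sqm7, mf]
  rw [this]; ring

theorem mf_ne (h7 : (7:L) ≠ 0) {q : L} (hq : 1+q+q^2+q^3+q^4+q^5+q^6=0) {P : L × L × L}
    (h : Good P) : mf P ≠ 0 := by
  intro h0
  apply (h.Sm h7 hq).dl_ne
  rw [dl_Sm hq, h0, mul_zero]

theorem tt_Sm (h7 : (7:L) ≠ 0) {q : L} (hq : 1+q+q^2+q^3+q^4+q^5+q^6=0) {P : L × L × L} :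
    tt (Sm q P) = mf P^2/nb P := by
  unfold tt
  rw [nb_Sm hq, dl_Sm hq, mul_pow, sq_sqm7 hq,
    show 49 * (-7 * mf P^2) = (-343) * mf P^2 by ring, mul_div_mul_left]
  rw [show (-343 : L) = -(7^3) by norm_num]
  exact neg_ne_zero.mpr (pow_ne_zero 3 h7)

/-- The numerator of the j-map. -/
def Pj (t : L) : L := (t^2+13*t+49)*(t^2+5*t+1)^3

theorem root_Sm (h7 : (7:L) ≠ 0) {q : L} (hq : 1+q+q^2+q^3+q^4+q^5+q^6=0) {P : L × L × L}
    (h : Good P) {J : L} (hJ : Pj (tt P) = J * tt P) : Pj (tt (Sm q P)) = J * tt (Sm q P) := by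
  have hm := mf_ne h7 hq h
  have hd := h.dl_ne
  have hn := h.2
  rw [tt_Sm h7 hq]
  unfold tt at hJ
  obtain ⟨w, w0, e1, e2, e3⟩ : ∃ w w0 : L,
      w^3 = (nb P^2+13*nb P*dl P^2+49*dl P^4)*dl P ∧
      w0^3 = (49*nb P^2+13*nb P*mf P^2+mf P^4)*mf P ∧
      w*(nb P^2+245*nb P*dl P^2+2401*dl P^4)*mf P
        = w0*(nb P^2+5*nb P*mf P^2+mf P^4)*dl P := by
    have i2 := id_w03 P.1 P.2.1 P.2.2 h.1
    have i3 := id_C P.1 P.2.1 P.2.2 h.1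
    have hmf : (1)*P.1^3 + (-1)*P.1^2*P.2.1 + (-2)*P.1^2*P.2.2 + (-2)*P.1*P.2.1^2
      + (-1)*P.1*P.2.1*P.2.2 + (-1)*P.1*P.2.2^2 + (1)*P.2.1^3 + (-1)*P.2.1^2*P.2.2
      + (-2)*P.2.1*P.2.2^2 + (1)*P.2.2^3 = mf P := by
      simp only [mf]; ring
    rw [hmf] at i2 i3
    exact ⟨_, _, id_w3 P.1 P.2.1 P.2.2 h.1, i2, i3⟩
  have a1 : Pj (49*dl P^2/nb P) =
      (w*(nb P^2+245*nb P*dl P^2+2401*dl P^4)/dl P)^3/nb P^7*(49*dl P^2/nb P) := by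
    unfold Pj
    have b1 : (49*dl P^2/nb P)^2+13*(49*dl P^2/nb P)+49 = 49*w^3/(dl P*nb P^2) := by
      rw [e1]; field_simp; ring
    have b2 : (49*dl P^2/nb P)^2+5*(49*dl P^2/nb P)+1 =
        (nb P^2+245*nb P*dl P^2+2401*dl P^4)/nb P^2 := by
      field_simp; ring
    rw [b1, b2]; field_simp
  have a2 : Pj (mf P^2/nb P) =
      (w0*(nb P^2+5*nb P*mf P^2+mf P^4)/mf P)^3/nb P^7*(mf P^2/nb P) := by
    unfold Pj
    have b1 : (mf P^2/nb P)^2+13*(mf P^2/nb P)+49 = w0^3/(mf P*nb P^2) := by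
      rw [e2]; field_simp; ring
    have b2 : (mf P^2/nb P)^2+5*(mf P^2/nb P)+1 =
        (nb P^2+5*nb P*mf P^2+mf P^4)/nb P^2 := by
      field_simp; ring
    rw [b1, b2]; field_simp
  have a3 : w*(nb P^2+245*nb P*dl P^2+2401*dl P^4)/dl P
      = w0*(nb P^2+5*nb P*mf P^2+mf P^4)/mf P := by
    rw [div_eq_div_iff hd hm, e3]
  have a4 : (49*dl P^2/nb P) ≠ 0 := by
    rw [show (49:L) = 7^2 by norm_num]
    exact div_ne_zero (mul_ne_zero (pow_ne_zero 2 h7) (pow_ne_zero 2 hd)) hn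
  rw [a1] at hJ
  rw [a2, ← a3, mul_right_cancel₀ a4 hJ]

theorem Sm_sm (q c : L) (P : L × L × L) : Sm q (sm c P) = sm c (Sm q P) := by
  simp only [Sm, sm, Prod.mk.injEq]; refine ⟨?_, ?_, ?_⟩ <;> ring

theorem Dm_sm (r c : L) (P : L × L × L) : Dm r (sm c P) = sm c (Dm r P) := by
  simp only [Dm, sm, Prod.mk.injEq]; refine ⟨?_, ?_, ?_⟩ <;> ring

theorem Dm_Dm (r s : L) (P : L × L × L) : Dm r (Dm s P) = Dm (r*s) P := by
  simp only [Dm, Prod.mk.injEq]; refine ⟨?_, ?_, ?_⟩ <;> ring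

theorem Dm_one (P : L × L × L) : Dm 1 P = P := by
  simp [Dm]

theorem Dm_Hm {r : L} (hr : r^7 = 1) (P : L × L × L) : Dm r (Hm P) = Hm (Dm (r^2) P) := by
  simp only [Dm, Hm, Prod.mk.injEq]
  refine ⟨?_, ?_, ?_⟩
  · linear_combination (-r*P.2.1)*hr
  · ring
  · trivial

theorem Sm_Hm (q : L) (P : L × L × L) : Sm q (Hm P) = Hm (Hm (Sm q P)) := by
  simp only [Sm, Hm, Prod.mk.injEq]; refine ⟨?_, ?_, ?_⟩ <;> ring

theorem Sm_Sm {q : L} (hq : 1+q+q^2+q^3+q^4+q^5+q^6=0) (P : L × L × L) :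
    Sm q (Sm q P) = sm (-7) P := by
  have e1 : (q-q^6)^2+(q^2-q^5)^2+(q^4-q^3)^2 = -7 := by
    linear_combination ((7 + (-7)*q^1 + (1)*q^2 + (-1)*q^3 + (1)*q^4 + (-1)*q^5 + (1)*q^6))*hq
  have e2 : (q-q^6)*(q^2-q^5)+(q^2-q^5)*(q^4-q^3)+(q^4-q^3)*(q-q^6) = 0 := by
    linear_combination (((1)*q^3 + (-2)*q^4 + (1)*q^5))*hq
  simp only [Sm, sm, Prod.mk.injEq]
  refine ⟨?_, ?_, ?_⟩
  · linear_combination P.1*e1+P.2.1*e2+P.2.2*e2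
  · linear_combination P.1*e2+P.2.1*e1+P.2.2*e2
  · linear_combination P.1*e2+P.2.1*e2+P.2.2*e1

/-- Two points are related when their eight conjugates differ by a projectivity. -/
def RelP (q : L) (P' P : L × L × L) : Prop :=
  ∃ M : Matrix.GeneralLinearGroup (Fin 2) (ZMod 7), ∀ a, Tl q P' a = Tl q P (M • a)

theorem RelP.refl (q : L) (P : L × L × L) : RelP q P P := ⟨1, fun a => by rw [one_smul]⟩

theorem RelP.trans {q : L} {P Q R : L × L × L} (h1 : RelP q P Q) (h2 : RelP q Q R) : RelP q P R := by
  obtain ⟨M, hM⟩ := h1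
  obtain ⟨N, hN⟩ := h2
  exact ⟨N * M, fun a => by rw [hM, hN, mul_smul]⟩

theorem Tl_infty (q : L) (P : L × L × L) : Tl q P OnePoint.infty = tt P := rfl

theorem Tl_coe (q : L) (P : L × L × L) (k : ZMod 7) :
    Tl q P (k : OnePoint (ZMod 7)) = tt (Sm q (Dm (q^k.val) P)) := rfl

theorem rel_sm (q : L) {c : L} (hc : c ≠ 0) (P : L × L × L) : RelP q (sm c P) P := by
  refine ⟨1, fun a => ?_⟩
  rw [one_smul]
  induction a using OnePoint.rec with
  | infty => rw [Tl_infty, Tl_infty, tt_sm hc]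
  | coe k => rw [Tl_coe, Tl_coe, Dm_sm, Sm_sm, tt_sm hc]

/-- A matrix as an element of the linear group. -/
def mk2 (a b c d : ZMod 7) (h : a*d-b*c ≠ 0) : Matrix.GeneralLinearGroup (Fin 2) (ZMod 7) :=
  Matrix.GeneralLinearGroup.mkOfDetNeZero !![a, b; c, d] (by rwa [Matrix.det_fin_two_of])

theorem mk2_infty (a b c d : ZMod 7) (h : a*d-b*c ≠ 0) :
    mk2 a b c d h • (OnePoint.infty : OnePoint (ZMod 7))
      = if c = 0 then OnePoint.infty else ((a/c : ZMod 7) : OnePoint (ZMod 7)) := by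
  rw [OnePoint.smul_infty_eq_ite]; rfl

theorem mk2_coe (a b c d : ZMod 7) (h : a*d-b*c ≠ 0) (k : ZMod 7) :
    mk2 a b c d h • (k : OnePoint (ZMod 7))
      = if c*k+d = 0 then OnePoint.infty
        else (((a*k+b)/(c*k+d) : ZMod 7) : OnePoint (ZMod 7)) := by
  rw [OnePoint.smul_some_eq_ite]; rfl

theorem rel_D {q : L} (h7 : q^7 = 1) (m : ZMod 7) (P : L × L × L) :
    RelP q (Dm (q^m.val) P) P := by
  have hm : (q^m.val)^7 = 1 := by rw [← pow_mul, mul_comm, pow_mul, h7, one_pow]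
  refine ⟨mk2 1 m 0 1 (by simp), fun a => ?_⟩
  induction a using OnePoint.rec with
  | infty => rw [mk2_infty, if_pos rfl, Tl_infty, Tl_infty, tt_Dm hm]
  | coe k =>
    rw [mk2_coe, if_neg (by simp), Tl_coe, Tl_coe, Dm_Dm, ← qval_add h7]
    simp

theorem rel_H {q : L} (h7 : q^7 = 1) (P : L × L × L) : RelP q (Hm P) P := by
  refine ⟨mk2 2 0 0 1 (by decide), fun a => ?_⟩
  induction a using OnePoint.rec with
  | infty => rw [mk2_infty, if_pos rfl, Tl_infty, Tl_infty, tt_Hm]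
  | coe k =>
    have hm : (q^k.val)^7 = 1 := by rw [← pow_mul, mul_comm, pow_mul, h7, one_pow]
    rw [mk2_coe, if_neg (by simp), Tl_coe, Tl_coe, Dm_Hm hm, Sm_Hm, tt_Hm, tt_Hm]
    have : (2*k+0)/(0*k+1) = k*2 := by simp [mul_comm]
    rw [this, qval_mul h7]
    rfl

theorem Tl_S (h70 : (7:L) ≠ 0) {q : L} (hq : 1+q+q^2+q^3+q^4+q^5+q^6=0) (P : L × L × L)
    (a : OnePoint (ZMod 7)) : Tl q (Sm q P) a = Tl q P (mk2 0 5 1 0 (by decide) • a) := by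
  have h7 := q7_of hq
  have hs : -(sqm7 q) ≠ 0 := neg_ne_zero.mpr (sqm7_ne h70 hq)
  have hp : ∀ n : ℕ, (q^n)^7 = 1 := fun n => by rw [← pow_mul, mul_comm, pow_mul, h7, one_pow]
  have v0 : (0 : ZMod 7).val = 0 := rfl
  induction a using OnePoint.rec with
  | infty =>
    rw [mk2_infty, if_neg (by decide), Tl_infty, Tl_coe, zero_div, v0, pow_zero, Dm_one]
  | coe k =>
    rw [mk2_coe]
    by_cases hk : k = 0
    · subst hk
      rw [if_pos (by simp), Tl_coe, Tl_infty, v0, pow_zero, Dm_one, Sm_Sm hq,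
        tt_sm (neg_ne_zero.mpr h70)]
    · rw [if_neg (by simpa using hk), Tl_coe, Tl_coe]
      have key : ∀ m n i : ℕ, ∀ X : L × L × L, k.val = m → (5:ZMod 7) = n * k → n < 7 →
          tt X = tt (Sm q (Dm (q^n) P)) →
          Sm q (Dm (q^m) (Sm q P)) = sm (-(sqm7 q)) (Dm (q^i) X) →
          tt (Sm q (Dm (q^k.val) (Sm q P))) = tt (Sm q (Dm (q^((0*k+5)/(1*k+0)).val) P)) := by
        intro m n i X e1 e2' hn e3 e4
        have e2 : ((0*k+5)/(1*k+0)).val = n := by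
          rw [zero_mul, zero_add, one_mul, add_zero, (div_eq_iff hk).mpr e2', ZMod.val_natCast,
            Nat.mod_eq_of_lt hn]
        rw [e1, e2, e4, tt_sm hs, tt_Dm (hp i), e3]
      revert hk key
      fin_cases k
      · intro hk; exact absurd rfl hk
      · intro _ key
        exact key 1 5 _ _ (by decide) (by decide) (by decide) (by simp only [tt_Hm]) (SDS1 q hq P)
      · intro _ key
        exact key 2 6 _ _ (by decide) (by decide) (by decide) (by simp only [tt_Hm]) (SDS2 q hq P)
      · intro _ key
        exact key 3 4 _ _ (by decide) (by decide) (by decide) rfl (SDS3 q hq P)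
      · intro _ key
        exact key 4 3 _ _ (by decide) (by decide) (by decide) rfl (SDS4 q hq P)
      · intro _ key
        exact key 5 1 _ _ (by decide) (by decide) (by decide) (by simp only [tt_Hm]) (SDS5 q hq P)
      · intro _ key
        exact key 6 2 _ _ (by decide) (by decide) (by decide) (by simp only [tt_Hm]) (SDS6 q hq P)

theorem rel_S (h70 : (7:L) ≠ 0) {q : L} (hq : 1+q+q^2+q^3+q^4+q^5+q^6=0) (P : L × L × L) :
    RelP q (Sm q P) P := ⟨_, Tl_S h70 hq P⟩

/-- Changing the root of unity is a projectivity. -/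
theorem Tl_chg {q : L} (h7 : q^7 = 1) (j : ℕ) (hj0 : j ≠ 0) (hj : j < 7) (P : L × L × L) :
    ∃ M : Matrix.GeneralLinearGroup (Fin 2) (ZMod 7), ∀ a, Tl (q^j) P a = Tl q P (M • a) := by
  have hj1 : (j : ZMod 7) ≠ 0 := by
    rw [Ne, ZMod.natCast_eq_zero_iff]; intro h
    exact absurd (Nat.le_of_dvd (Nat.pos_of_ne_zero hj0) h) (by omega)
  have hn : (-1 : L) ≠ 0 := neg_ne_zero.mpr one_ne_zero
  have key : ∀ X : L × L × L, tt (Sm (q^j) X) = tt (Sm q X) := by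
    intro X
    interval_cases j
    · exact absurd rfl hj0
    · rw [pow_one]
    · rw [Schg2 q h7, tt_Hm]
    · rw [Schg3 q h7, tt_sm hn, tt_Hm, tt_Hm]
    · rw [Schg4 q h7, tt_Hm, tt_Hm]
    · rw [Schg5 q h7, tt_sm hn, tt_Hm]
    · rw [Schg6 q h7, tt_sm hn]
  refine ⟨mk2 j 0 0 1 (by simpa using hj1), fun a => ?_⟩
  induction a using OnePoint.rec with
  | infty => rw [mk2_infty, if_pos rfl, Tl_infty, Tl_infty]
  | coe k =>
    rw [mk2_coe, if_neg (by simp), Tl_coe, Tl_coe, key]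
    have : ((j:ZMod 7)*k+0)/(0*k+1) = j*k := by simp
    rw [this, qval_mul h7, ZMod.val_natCast, Nat.mod_eq_of_lt hj]

/-- The invariant of the order 7 diagonal group. -/
def dd (P : L × L × L) : L := -(P.1^2*P.2.1)/P.2.2^3

theorem dd_E1 {P : L × L × L} (h : Good P) : P.1^2*P.2.1 + dd P * P.2.2^3 = 0 := by
  have := h.z_ne
  unfold dd; field_simp; ring

theorem dd_E2 {P : L × L × L} (h : Good P) : P.2.1^3 - (dd P - 1) * P.1 * P.2.2^2 = 0 := by
  have hz := h.z_ne
  have h1 := dd_E1 h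
  have h2 := h.1
  simp only [fK] at h2
  apply mul_left_cancel₀ hz
  linear_combination h2 - P.1*h1

theorem dd_ne_zero {P : L × L × L} (h : Good P) : dd P ≠ 0 := by
  intro h0
  have h1 := dd_E1 h
  rw [h0, zero_mul, add_zero] at h1
  exact mul_ne_zero (pow_ne_zero 2 h.x_ne) h.y_ne h1

theorem dd_Hm {P : L × L × L} (h : Good P) : dd (Hm P) = (dd P - 1) / dd P := by
  have h1 := dd_E1 h
  have h2 := dd_E2 h
  have hd := dd_ne_zero h
  have h3 : P.2.1^2*P.2.2 + dd (Hm P)*P.1^3 = 0 := dd_E1 h.Hm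
  have hx := h.x_ne
  have hy := h.y_ne
  have hz := h.z_ne
  rw [eq_div_iff hd]
  apply mul_left_cancel₀ (mul_ne_zero (pow_ne_zero 3 hx) (mul_ne_zero hy (pow_ne_zero 2 hz)))
  have h4 : dd (Hm P) * P.1^3 = -(P.2.1^2*P.2.2) := by
    linear_combination h3
  linear_combination dd P * (P.2.1*P.2.2^2) * h4 - P.1 * P.2.2^2 * (dd P - 1) * h1
    - dd P * P.2.2^3 * h2

theorem nb_dd {P : L × L × L} (h : Good P) :
    nb P * (dd P^2 - dd P) = dl P^2 * (dd P^3 - 8*dd P^2 + 5*dd P + 1) := by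
  have h1 := dd_E1 h
  have h2 := dd_E2 h
  apply mul_left_cancel₀ h.z_ne
  generalize dd P = d at *
  simp only [nb, dl]
  linear_combination (d^2-d)*P.2.2*P.1*P.2.1^2*h2 + (d-1)*P.2.1*P.2.2^3*h1 - d*P.1^4*h2
    + d*P.1^2*P.2.1^2*h1

theorem tt_dd {P : L × L × L} (h : Good P) :
    tt P * (dd P^3 - 8*dd P^2 + 5*dd P + 1) = 49 * (dd P^2 - dd P) := by
  have h1 := nb_dd h
  have h2 := h.2
  unfold tt
  rw [div_mul_eq_mul_div, div_eq_iff h2]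
  linear_combination -49*h1

theorem tt_ne (h7 : (7:L) ≠ 0) {P : L × L × L} (h : Good P) : tt P ≠ 0 := by
  unfold tt
  rw [show (49:L) = 7^2 by norm_num]
  exact div_ne_zero (mul_ne_zero (pow_ne_zero 2 h7) (pow_ne_zero 2 h.dl_ne)) h.2

theorem same_dd {P' P : L × L × L} (h' : Good P') (h : Good P) (hd : dd P' = dd P) :
    ∃ c r : L, c ≠ 0 ∧ r^7 = 1 ∧ P' = sm c (Dm r P) := by
  have a1 := dd_E1 h
  have a2 := dd_E2 h
  have b1 := dd_E1 h'
  have b2 := dd_E2 h'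
  rw [hd] at b1 b2
  have hx := h.x_ne
  have hy := h.y_ne
  have hz := h.z_ne
  have hx' := h'.x_ne
  have hy' := h'.y_ne
  have hz' := h'.z_ne
  clear hd h h'
  generalize dd P = d at *
  obtain ⟨x, y, z⟩ := P
  obtain ⟨u, v, w⟩ := P'
  simp only at *
  have cA : v^3*x*z^2 = y^3*u*w^2 := by linear_combination x*z^2*b2 - u*w^2*a2
  have cB : u^2*v*z^3 = x^2*y*w^3 := by linear_combination z^3*b1 - w^3*a1
  have cC : v^7*z^7 = w^7*y^7 := by
    apply mul_left_cancel₀ (mul_ne_zero (pow_ne_zero 2 hx) (pow_ne_zero 2 hx'))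
    linear_combination (v^3*x*z^2 + y^3*u*w^2)*u^2*v*z^3*cA + (y^3*u*w^2)^2*cB
  have hr : (v*z/(w*y))^7 = 1 := by
    rw [div_pow, mul_pow, mul_pow, cC, div_self]
    exact mul_ne_zero (pow_ne_zero 7 hz') (pow_ne_zero 7 hy)
  set r := v*z/(w*y) with hrd
  have hr0 : r ≠ 0 := by
    intro h0; rw [h0] at hr; simp at hr
  have hv : v*z = r*(w*y) := by rw [hrd]; field_simp
  have hu : u*z = r^3*(w*x) := by
    apply mul_left_cancel₀ (mul_ne_zero (pow_ne_zero 3 hy) (pow_ne_zero 2 hz'))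
    linear_combination (-z)*cA + x*((v*z)^2+(v*z)*(r*(w*y))+(r*(w*y))^2)*hv
  refine ⟨w/(z*r), r^4, div_ne_zero hz' (mul_ne_zero hz hr0), ?_, ?_⟩
  · rw [← pow_mul, mul_comm, pow_mul, hr, one_pow]
  · simp only [sm, Dm, Prod.mk.injEq]
    refine ⟨?_, ?_, ?_⟩
    · rw [div_mul_eq_mul_div, eq_div_iff (mul_ne_zero hz hr0)]
      linear_combination r*hu
    · rw [div_mul_eq_mul_div, eq_div_iff (mul_ne_zero hz hr0)]
      linear_combination r*hv - w*y*(r^9+r^2)*hr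
    · rw [div_mul_eq_mul_div, eq_div_iff (mul_ne_zero hz hr0)]
      linear_combination - w*z*r*hr

theorem fibre (h7 : (7:L) ≠ 0) {q : L} (hq : IsPrimitiveRoot q 7) {P' P : L × L × L}
    (h' : Good P') (h : Good P) (ht : tt P' = tt P) : RelP q P' P := by
  have key : ∀ Q : L × L × L, Good Q → dd P' = dd Q → RelP q P' Q := by
    intro Q hQ e
    obtain ⟨c, r, hc, hr, rfl⟩ := same_dd h' hQ e
    obtain ⟨k, hk, rfl⟩ := hq.eq_pow_of_pow_eq_one hr
    refine (rel_sm q hc _).trans ?_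
    have := rel_D hq.pow_eq_one (k : ZMod 7) Q
    rwa [ZMod.val_natCast, Nat.mod_eq_of_lt hk] at this
  have e1 := tt_dd h
  have e2 := tt_dd h'
  rw [ht] at e2
  have ht0 := tt_ne h7 h
  have hd0 := dd_ne_zero h
  have e3 : (dd P' - dd P) * (dd P' * (1 - dd P) - 1) * (dd P' * dd P - (dd P - 1)) = 0 := by
    apply mul_left_cancel₀ ht0
    linear_combination (1)*((dd P'^2 - dd P')*e1 - (dd P^2 - dd P)*e2)
  rcases mul_eq_zero.mp e3 with e4 | e4
  · rcases mul_eq_zero.mp e4 with e5 | e5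
    · exact key P h (sub_eq_zero.mp e5)
    · refine (key _ h.Hm.Hm ?_).trans ((rel_H hq.pow_eq_one _).trans (rel_H hq.pow_eq_one _))
      have hd1 : 1 - dd P ≠ 0 := by
        intro h0; rw [h0] at e5; simp at e5
      have hd2 : dd P - 1 ≠ 0 := by
        intro h0; apply hd1; linear_combination -h0
      rw [dd_Hm h.Hm, dd_Hm h, eq_div_iff (div_ne_zero hd2 hd0)]
      field_simp
      linear_combination -e5
  · refine (key _ h.Hm ?_).trans (rel_H hq.pow_eq_one _)
    rw [dd_Hm h, eq_div_iff hd0]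
    linear_combination e4

theorem alg_aux_pos (k : Type*) [Field k] [Algebra k L] {x y : L} (hf : x^3*y+y^3+x = 0)
    (hm : x^3 - x^2*y - 2*x^2 - 2*x*y^2 - x*y - x + y^3 - y^2 - 2*y + 1 - 7*(x*y) = 0) :
    IsAlgebraic k x := by
  have e : x^12 + 4*x^11 + 12*x^10 - 38*x^9 + 17*x^8 + 10*x^7 + 154*x^6 + 180*x^5 + 447*x^4 + 382*x^3 + 125*x^2 + 8*x + 1 = 0 := by
    linear_combination (x^9 + 7*x^8 + 2*x^7*y + 39*x^7 + 13*x^6*y + 90*x^6 + 52*x^5*y + 283*x^5 + 59*x^4*y + 250*x^4 + 142*x^3*y + 504*x^3 + 126*x^2*y + 368*x^2 + 42*x*y + 111*x + 5*y + 12)*hf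
      + (x^9 + 6*x^8 + 25*x^7 + x^6*y^2 + x^6*y + 16*x^6 + 6*x^5*y^2 - x^5*y + 54*x^5 + 23*x^4*y^2 + 4*x^4*y + 35*x^4 + 18*x^3*y^2 - 19*x^3*y + 33*x^3 + 62*x^2*y^2 - 23*x^2*y + 12*x^2 + 32*x*y^2 + 3*x*y - 2*x + 5*y^2 + 2*y + 1)*(hm - hf)
  refine IsIntegral.isAlgebraic ⟨X^12 + C 4 * X^11 + C 12 * X^10 - C 38 * X^9 + C 17 * X^8 + C 10 * X^7 + C 154 * X^6 + C 180 * X^5 + C 447 * X^4 + C 382 * X^3 + C 125 * X^2 + C 8 * X + C 1, ?_, ?_⟩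
  · monicity!
  · simp only [eval₂_add, eval₂_sub, eval₂_mul, eval₂_pow, eval₂_X, eval₂_ofNat, eval₂_one, map_ofNat, map_one]
    linear_combination e

theorem alg_aux_neg (k : Type*) [Field k] [Algebra k L] {x y : L} (hf : x^3*y+y^3+x = 0)
    (hm : x^3 - x^2*y - 2*x^2 - 2*x*y^2 - x*y - x + y^3 - y^2 - 2*y + 1 + 7*(x*y) = 0) :
    IsAlgebraic k x := by
  have e : x^12 + 4*x^11 - 16*x^10 - 10*x^9 + 59*x^8 - 102*x^7 + 28*x^6 + 124*x^5 - 253*x^4 + 214*x^3 - 85*x^2 + 8*x + 1 = 0 := by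
    linear_combination (x^9 + 7*x^8 + 2*x^7*y - 3*x^7 + 13*x^6*y - 50*x^6 - 4*x^5*y + 45*x^5 - 25*x^4*y + 68*x^4 + 58*x^3*y - 224*x^3 - 14*x^2*y + 200*x^2 - 14*x*y - 85*x + 5*y + 12)*hf
      + (x^9 + 6*x^8 - 3*x^7 + x^6*y^2 + x^6*y - 12*x^6 + 6*x^5*y^2 - x^5*y + 26*x^5 - 5*x^4*y^2 - 10*x^4*y - 21*x^4 - 10*x^3*y^2 + 9*x^3*y + 5*x^3 + 34*x^2*y^2 + 5*x^2*y - 2*x^2 - 24*x*y^2 - 11*x*y - 2*x + 5*y^2 + 2*y + 1)*(hm - hf)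
  refine IsIntegral.isAlgebraic ⟨X^12 + C 4 * X^11 - C 16 * X^10 - C 10 * X^9 + C 59 * X^8 - C 102 * X^7 + C 28 * X^6 + C 124 * X^5 - C 253 * X^4 + C 214 * X^3 - C 85 * X^2 + C 8 * X + C 1, ?_, ?_⟩
  · monicity!
  · simp only [eval₂_add, eval₂_sub, eval₂_mul, eval₂_pow, eval₂_X, eval₂_ofNat, eval₂_one, map_ofNat, map_one]
    linear_combination e

theorem alg_xz (k : Type*) [Field k] [Algebra k L] {P : L × L × L} (h : Good P)
    (hm : mf P^2 = 49 * dl P^2) : IsAlgebraic k (P.1/P.2.2) := by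
  have hz := h.z_ne
  have hf : (P.1/P.2.2)^3*(P.2.1/P.2.2)+(P.2.1/P.2.2)^3+(P.1/P.2.2) = 0 := by
    have := h.1
    simp only [fK] at this
    field_simp
    linear_combination this
  have hm2 : (mf P - 7 * dl P) * (mf P + 7 * dl P) = 0 := by linear_combination hm
  rcases mul_eq_zero.mp hm2 with e | e
  · apply alg_aux_pos k hf
    simp only [mf, dl] at e
    field_simp
    linear_combination e
  · apply alg_aux_neg k hf
    simp only [mf, dl] at e
    field_simp
    linear_combination e

theorem mf_Hm (P : L × L × L) : mf (Hm P) = mf P := by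
  simp only [mf, Hm]; ring

theorem tt_ne_tt_Sm (k : Type*) [Field k] [Algebra k L] (h7 : (7:L) ≠ 0) {q : L}
    (hq : 1+q+q^2+q^3+q^4+q^5+q^6=0) {P : L × L × L} (h : Good P)
    (ht : Transcendental k (tt P)) : tt P ≠ tt (Sm q P) := by
  intro e
  apply ht
  rw [tt_Sm h7 hq] at e
  unfold tt at e
  rw [div_left_inj' h.2] at e
  have a1 := alg_xz k h e.symm
  have a2 : IsAlgebraic k (P.2.1/P.1) := alg_xz k h.Hm (by rw [mf_Hm, dl_Hm, e])
  have hx := h.x_ne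
  have hz := h.z_ne
  have e2 : P = sm P.2.2 (P.1/P.2.2, P.2.1/P.1*(P.1/P.2.2), 1) := by
    obtain ⟨x, y, z⟩ := P
    simp only [sm, Prod.mk.injEq] at *
    refine ⟨?_, ?_, ?_⟩ <;> field_simp
  rw [e2, tt_sm hz]
  rw [← mem_algebraicClosure_iff] at a1 a2 ⊢
  generalize P.1/P.2.2 = X at *
  have a3 := mul_mem a2 a1
  generalize P.2.1/P.1*X = Y at *
  simp only [tt, dl, nb, mul_one, one_pow, one_mul]
  have n49 : (49:L) ∈ algebraicClosure k L := ofNat_mem _ 49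
  have n5 : (5:L) ∈ algebraicClosure k L := ofNat_mem _ 5
  exact div_mem (mul_mem n49 (pow_mem (mul_mem a1 a3) 2))
    (sub_mem (add_mem (add_mem (mul_mem a1 (pow_mem a3 5)) a3) (pow_mem a1 5))
      (mul_mem (mul_mem n5 (pow_mem a1 2)) (pow_mem a3 2)))

/-- Points above a given value of `J`. -/
def Gen (J : L) (P : L × L × L) : Prop := Good P ∧ Pj (tt P) = J * tt P

theorem Gen.transc {k : Type*} [Field k] [Algebra k L] (h7 : (7:L) ≠ 0) {J : L}
    (hJ : Transcendental k J) {P : L × L × L} (h : Gen J P) : Transcendental k (tt P) := by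
  intro ht
  apply hJ
  have e : J = Pj (tt P) / tt P := by
    rw [eq_div_iff (tt_ne h7 h.1), h.2]
  rw [e]
  rw [← mem_algebraicClosure_iff] at ht ⊢
  refine div_mem ?_ ht
  have n49 : (49:L) ∈ algebraicClosure k L := ofNat_mem _ 49
  have n13 : (13:L) ∈ algebraicClosure k L := ofNat_mem _ 13
  have n5 : (5:L) ∈ algebraicClosure k L := ofNat_mem _ 5
  unfold Pj
  exact mul_mem (add_mem (add_mem (pow_mem ht 2) (mul_mem n13 ht)) n49)
    (pow_mem (add_mem (add_mem (pow_mem ht 2) (mul_mem n5 ht)) (one_mem _)) 3)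

theorem Gen.Sm (h7 : (7:L) ≠ 0) {q : L} (hq : 1+q+q^2+q^3+q^4+q^5+q^6=0) {J : L}
    {P : L × L × L} (h : Gen J P) : Gen J (Sm q P) :=
  ⟨h.1.Sm h7 hq, root_Sm h7 hq h.1 h.2⟩

theorem Gen.Dm {r : L} (hr : r^7 = 1) {J : L} {P : L × L × L} (h : Gen J P) :
    Gen J (Dm r P) := ⟨h.1.Dm hr, by rw [tt_Dm hr]; exact h.2⟩

theorem qpow7 {q : L} (h7 : q^7 = 1) (n : ℕ) : (q^n)^7 = 1 := by
  rw [← pow_mul, mul_comm, pow_mul, h7, one_pow]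

theorem Tl_inj_infty {k : Type*} [Field k] [Algebra k L] (h7 : (7:L) ≠ 0) {q : L}
    (hq : 1+q+q^2+q^3+q^4+q^5+q^6=0) {J : L} (hJ : Transcendental k J) {P : L × L × L}
    (h : Gen J P) (m : ZMod 7) : Tl q P OnePoint.infty ≠ Tl q P (m : OnePoint (ZMod 7)) := by
  have hp := qpow7 (q7_of hq) m.val
  rw [Tl_infty, Tl_coe, ← tt_Dm hp]
  exact tt_ne_tt_Sm k h7 hq (h.Dm hp).1 ((h.Dm hp).transc h7 hJ)

theorem Tl_inj_zero {k : Type*} [Field k] [Algebra k L] (h7 : (7:L) ≠ 0) {q : L}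
    (hq : 1+q+q^2+q^3+q^4+q^5+q^6=0) {J : L} (hJ : Transcendental k J) {P : L × L × L}
    (h : Gen J P) (m : ZMod 7) (hm : m ≠ 0) :
    tt (Sm q P) ≠ tt (Sm q (Dm (q^m.val) P)) := by
  have e1 := Tl_S h7 hq (Sm q P) (m : OnePoint (ZMod 7))
  rw [mk2_coe, if_neg (by simpa using hm), Tl_coe, Sm_Sm hq, Dm_sm, Sm_sm,
    tt_sm (neg_ne_zero.mpr h7)] at e1
  rw [e1]
  exact Tl_inj_infty h7 hq hJ (h.Sm h7 hq) _

theorem Tl_injective {k : Type*} [Field k] [Algebra k L] (h7 : (7:L) ≠ 0) {q : L}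
    (hq : 1+q+q^2+q^3+q^4+q^5+q^6=0) {J : L} (hJ : Transcendental k J) {P : L × L × L}
    (h : Gen J P) : Function.Injective (Tl q P) := by
  intro a b hab
  induction a using OnePoint.rec with
  | infty =>
    induction b using OnePoint.rec with
    | infty => rfl
    | coe m => exact absurd hab (Tl_inj_infty h7 hq hJ h m)
  | coe n =>
    induction b using OnePoint.rec with
    | infty => exact absurd hab.symm (Tl_inj_infty h7 hq hJ h n)
    | coe m =>
      by_contra hne
      have hmn : m - n ≠ 0 := by
        intro h0; apply hne; rw [sub_eq_zero.mp h0]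
      apply Tl_inj_zero h7 hq hJ (h.Dm (qpow7 (q7_of hq) n.val)) (m-n) hmn
      rw [Dm_Dm, ← qval_add (q7_of hq), sub_add_cancel]
      exact hab

theorem Gen.Tl {q : L} (h7 : (7:L) ≠ 0) (hq : 1+q+q^2+q^3+q^4+q^5+q^6=0) {J : L} {P : L × L × L}
    (h : Gen J P) (a : OnePoint (ZMod 7)) : ∃ Q, Gen J Q ∧ tt Q = _root_.Tl q P a ∧ RelP q Q P := by
  induction a using OnePoint.rec with
  | infty => exact ⟨P, h, rfl, RelP.refl q P⟩
  | coe n =>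
    exact ⟨_, (h.Dm (qpow7 (q7_of hq) n.val)).Sm h7 hq, rfl,
      (rel_S h7 hq _).trans (rel_D (q7_of hq) n P)⟩

theorem Gen.root {q : L} (h7 : (7:L) ≠ 0) (hq : 1+q+q^2+q^3+q^4+q^5+q^6=0) {J : L} {P : L × L × L}
    (h : Gen J P) (a : OnePoint (ZMod 7)) : Pj (_root_.Tl q P a) = J * _root_.Tl q P a := by
  obtain ⟨Q, h1, h2, -⟩ := h.Tl h7 hq a
  rw [← h2]; exact h1.2

theorem exists_point [IsAlgClosed L] (h7 : (7:L) ≠ 0) {t : L} (ht : t ≠ 0) :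
    ∃ P : L × L × L, Good P ∧ tt P = t := by
  have h49 : (49:L) ≠ 0 := by
    rw [show (49:L) = 7^2 by norm_num]; exact pow_ne_zero 2 h7
  obtain ⟨d, hd⟩ : ∃ d : L, t * (d^3-8*d^2+5*d+1) = 49*(d^2-d) := by
    have hdeg : (C t * X^3 - C (8*t+49) * X^2 + C (5*t+49) * X + C t : L[X]).degree = 3 := by
      compute_degree!
    obtain ⟨d, hd⟩ := IsAlgClosed.exists_root
      (C t * X^3 - C (8*t+49) * X^2 + C (5*t+49) * X + C t : L[X]) (by rw [hdeg]; decide)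
    refine ⟨d, ?_⟩
    simp only [IsRoot.def, eval_add, eval_sub, eval_mul, eval_C, eval_X, eval_pow] at hd
    linear_combination hd
  have hd0 : d ≠ 0 := by
    rintro rfl; apply ht; linear_combination hd
  have hd1 : d - 1 ≠ 0 := by
    intro h0
    have h1 : d = 1 := by linear_combination h0
    subst h1
    apply ht; linear_combination -hd
  obtain ⟨y, hy⟩ := IsAlgClosed.exists_pow_nat_eq (-(d*(d-1)^2)) (n := 7) (by norm_num)
  have hy0 : y ≠ 0 := by
    rintro rfl
    have : d*(d-1)^2 = 0 := by linear_combination hy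
    exact mul_ne_zero hd0 (pow_ne_zero 2 hd1) this
  obtain ⟨x, hx⟩ : ∃ x : L, x = y^3/(d-1) := ⟨_, rfl⟩
  have hx0 : x ≠ 0 := by rw [hx]; exact div_ne_zero (pow_ne_zero 3 hy0) hd1
  have e2 : y^3 = (d-1)*x := by rw [hx]; field_simp
  have e1 : x^2*y + d = 0 := by
    apply mul_left_cancel₀ (pow_ne_zero 2 hd1)
    linear_combination hy - y*(y^3 + (d-1)*x)*e2
  have hn : nb (x,y,1) * (d^2-d) = dl (x,y,1)^2 * (d^3-8*d^2+5*d+1) := by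
    simp only [nb, dl]
    linear_combination (d^2-d)*x*y^2*e2 + (d-1)*y*e1 - d*x^4*e2 + d*x^2*y^2*e1
  have hdd : d^2 - d ≠ 0 := by
    rw [show d^2 - d = d*(d-1) by ring]; exact mul_ne_zero hd0 hd1
  have hdl : dl (x,y,1) ≠ 0 := by
    simp only [dl, mul_one]; exact mul_ne_zero hx0 hy0
  have hN : d^3-8*d^2+5*d+1 ≠ 0 := by
    intro h0; rw [h0, mul_zero] at hd; exact mul_ne_zero h49 hdd hd.symm
  have hnb : nb (x,y,1) ≠ 0 := by
    intro h0; rw [h0, zero_mul] at hn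
    exact mul_ne_zero (pow_ne_zero 2 hdl) hN hn.symm
  refine ⟨(x,y,1), ⟨?_, hnb⟩, ?_⟩
  · simp only [fK]
    linear_combination x*e1 + e2
  · unfold tt
    rw [div_eq_iff hnb]
    apply mul_right_cancel₀ hdd
    apply mul_right_cancel₀ hN
    linear_combination (-t)*(d^3-8*d^2+5*d+1)*hn - dl (x,y,1)^2*(d^3-8*d^2+5*d+1)*hd

/-- Applying a field homomorphism to a point. -/
def mapP (σ : L →+* L) (P : L × L × L) : L × L × L := (σ P.1, σ P.2.1, σ P.2.2)

theorem map_tt (σ : L →+* L) (P : L × L × L) : σ (tt P) = tt (mapP σ P) := by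
  simp [tt, dl, nb, mapP, map_ofNat]

theorem mapP_Sm (σ : L →+* L) (q : L) (P : L × L × L) :
    mapP σ (Sm q P) = Sm (σ q) (mapP σ P) := by
  simp [Sm, mapP]

theorem mapP_Dm (σ : L →+* L) (q : L) (P : L × L × L) :
    mapP σ (Dm q P) = Dm (σ q) (mapP σ P) := by
  simp [Dm, mapP]

theorem map_Tl (σ : L →+* L) (q : L) (P : L × L × L) (a : OnePoint (ZMod 7)) :
    σ (Tl q P a) = Tl (σ q) (mapP σ P) a := by
  induction a using OnePoint.rec with
  | infty => rw [Tl_infty, Tl_infty, map_tt]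
  | coe k => rw [Tl_coe, Tl_coe, map_tt, mapP_Sm, mapP_Dm, map_pow]

theorem Gen.map {σ : L →+* L} {J : L} (hσ : σ J = J) {P : L × L × L} (h : Gen J P) :
    Gen J (mapP σ P) := by
  refine ⟨⟨?_, ?_⟩, ?_⟩
  · have : fK (mapP σ P) = σ (fK P) := by simp [fK, mapP]
    rw [this, h.1.1, map_zero]
  · have : nb (mapP σ P) = σ (nb P) := by simp [nb, mapP, map_ofNat]
    rw [this]
    exact (map_ne_zero σ).mpr h.1.2
  · have e := congrArg σ h.2
    rw [map_mul, hσ, map_tt] at e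
    rw [← e, ← map_tt]
    simp [Pj, map_ofNat]

theorem gal_proj (h7 : (7:L) ≠ 0) {q : L} (hq : IsPrimitiveRoot q 7)
    (hq' : 1+q+q^2+q^3+q^4+q^5+q^6=0) {J : L} {P : L × L × L} (h : Gen J P)
    (hsurj : ∀ t : L, Pj t = J * t → ∃ a, Tl q P a = t) (σ : L →+* L) (hσ : σ J = J) :
    ∃ M : Matrix.GeneralLinearGroup (Fin 2) (ZMod 7),
      ∀ a, σ (Tl q P a) = Tl q P (M • a) := by
  have h' := h.map hσ
  have hq1 : (σ q)^7 = 1 := by rw [← map_pow, hq.pow_eq_one, map_one]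
  obtain ⟨j, hj, ej⟩ := hq.eq_pow_of_pow_eq_one hq1
  have hj0 : j ≠ 0 := by
    rintro rfl
    rw [pow_zero] at ej
    have : q = 1 := σ.injective (by rw [← ej, map_one])
    exact hq.ne_one (by norm_num) this
  obtain ⟨M1, hM1⟩ := Tl_chg hq.pow_eq_one j hj0 hj (mapP σ P)
  obtain ⟨b, hb⟩ := hsurj _ h'.2
  obtain ⟨Q, hQ1, hQ2, hQ3⟩ := h.Tl h7 hq' b
  obtain ⟨M2, hM2⟩ := (fibre h7 hq h'.1 hQ1.1 (by rw [hQ2, hb])).trans hQ3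
  refine ⟨M2 * M1, fun a => ?_⟩
  rw [map_Tl, ← ej, hM1, hM2, mul_smul]

theorem J_alg {k : Type*} [Field k] [Algebra k L] {J t : L} (ht : t ≠ 0) (h : Pj t = J * t)
    (ha : IsAlgebraic k t) : IsAlgebraic k J := by
  have e : J = Pj t / t := by rw [eq_div_iff ht, h]
  rw [e]
  rw [← mem_algebraicClosure_iff] at ha ⊢
  refine div_mem ?_ ha
  have n49 : (49:L) ∈ algebraicClosure k L := ofNat_mem _ 49
  have n13 : (13:L) ∈ algebraicClosure k L := ofNat_mem _ 13
  have n5 : (5:L) ∈ algebraicClosure k L := ofNat_mem _ 5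
  unfold Pj
  exact mul_mem (add_mem (add_mem (pow_mem ha 2) (mul_mem n13 ha)) n49)
    (pow_mem (add_mem (add_mem (pow_mem ha 2) (mul_mem n5 ha)) (one_mem _)) 3)

theorem root_ne_zero (h7 : (7:L) ≠ 0) {J t : L} (h : Pj t = J * t) : t ≠ 0 := by
  rintro rfl
  have : (7:L)^2 = 0 := by
    unfold Pj at h; linear_combination h
  exact pow_ne_zero 2 h7 this

theorem no_double {k : Type*} [Field k] [Algebra k L] (h7 : (7:L) ≠ 0) {J t : L}
    (hJ : Transcendental k J) (h : Pj t = J * t)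
    (h' : (2*t+13)*(t^2+5*t+1)^3 + (t^2+13*t+49)*(3*(t^2+5*t+1)^2*(2*t+5)) = J) : False := by
  apply hJ
  apply J_alg (root_ne_zero h7 h) h
  have e : 7*((t^4+14*t^3+63*t^2+70*t-7)*(t^2+5*t+1)^2) = 0 := by
    unfold Pj at h
    linear_combination t*h' - h
  have e2 := (mul_eq_zero.mp e).resolve_left h7
  rcases mul_eq_zero.mp e2 with e3 | e3
  · refine IsIntegral.isAlgebraic ⟨X^4+14*X^3+63*X^2+70*X-7, by monicity!, ?_⟩
    simp only [eval₂_add, eval₂_sub, eval₂_mul, eval₂_pow, eval₂_X, eval₂_ofNat]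
    exact e3
  · rw [pow_eq_zero_iff (by norm_num)] at e3
    refine IsIntegral.isAlgebraic ⟨X^2+5*X+1, by monicity!, ?_⟩
    simp only [eval₂_add, eval₂_mul, eval₂_pow, eval₂_X, eval₂_ofNat, eval₂_one]
    exact e3

end geometry

section final

theorem seven_ne (l : ℕ) [Fact (Nat.Prime l)] (hl : l ≠ 7) (Ω : Type*) [Field Ω]
    [Algebra (ZMod l) Ω] : (7:Ω) ≠ 0 := by
  have : CharP Ω l := charP_of_injective_algebraMap (algebraMap (ZMod l) Ω).injective l
  intro h
  have h1 : ((7:ℕ):Ω) = 0 := by exact_mod_cast h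
  rw [CharP.cast_eq_zero_iff Ω l] at h1
  exact hl ((Nat.prime_dvd_prime_iff_eq Fact.out (by norm_num)).mp h1)

theorem exists_root7 (Ω : Type*) [Field Ω] [IsAlgClosed Ω] (h7 : (7:Ω) ≠ 0) :
    ∃ q : Ω, IsPrimitiveRoot q 7 ∧ 1+q+q^2+q^3+q^4+q^5+q^6=0 := by
  have : NeZero ((7:ℕ):Ω) := ⟨by exact_mod_cast h7⟩
  obtain ⟨q, hq⟩ := IsAlgClosed.exists_root (cyclotomic 7 Ω)
    (by rw [degree_cyclotomic]; decide)
  rw [isRoot_cyclotomic_iff] at hq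
  refine ⟨q, hq, ?_⟩
  have := hq.geom_sum_eq_zero (by norm_num)
  simp only [Finset.sum_range_succ, Finset.sum_range_zero] at this
  linear_combination this

theorem F_natDegree (l : ℕ) [Fact (Nat.Prime l)] : (FzJmod l).natDegree = 8 := by
  unfold FzJmod
  compute_degree!

theorem F_aeval (l : ℕ) [Fact (Nat.Prime l)] {Ω : Type*} [Field Ω] [Algebra (RatFunc (ZMod l)) Ω]
    (z : Ω) : aeval z (FzJmod l)
      = Pj (z-8) - algebraMap (RatFunc (ZMod l)) Ω RatFunc.X * (z-8) := by
  simp only [FzJmod, Pj, map_sub, map_mul, map_add, map_pow, aeval_X, aeval_C, map_ofNat]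
  ring

theorem F_aeval' (l : ℕ) [Fact (Nat.Prime l)] {Ω : Type*} [Field Ω] [Algebra (RatFunc (ZMod l)) Ω]
    (z : Ω) : aeval z (derivative (FzJmod l))
      = (2*(z-8)+13)*((z-8)^2+5*(z-8)+1)^3
        + ((z-8)^2+13*(z-8)+49)*(3*((z-8)^2+5*(z-8)+1)^2*(2*(z-8)+5))
        - algebraMap (RatFunc (ZMod l)) Ω RatFunc.X := by
  simp only [FzJmod, derivative_sub, derivative_mul, derivative_pow, derivative_X,
    derivative_C, derivative_ofNat, map_sub, map_mul, map_add, map_pow, aeval_X, aeval_C,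
    map_ofNat, map_one, map_zero, map_natCast]
  push_cast
  ring

end final

end main_lemmas

/-- Lemma 3(b): for a prime `l ≠ 7`, `F(z,J)` is separable over `𝔽_l(J)` and the
Galois group of its splitting field over `𝔽_l(J)` is isomorphic to a subgroup of
`PGL₂(𝔽₇)`. -/
theorem FzJmod_gal_le_PGL2F7 (l : ℕ) [Fact (Nat.Prime l)] (hl : l ≠ 7) :
    (FzJmod l).Separable ∧
      ∃ f : (FzJmod l).Gal →* PGL2F7, Function.Injective f := by

  have := prime_seven_fact
  have h7 : (7 : AlgebraicClosure (RatFunc (ZMod l))) ≠ 0 := seven_ne l hl _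
  have hJ : Transcendental (ZMod l) (algebraMap (RatFunc (ZMod l))
      (AlgebraicClosure (RatFunc (ZMod l))) RatFunc.X) := by
    rw [transcendental_algebraMap_iff (RingHom.injective _)]
    exact RatFunc.transcendental_X
  have hF0 : FzJmod l ≠ 0 := by
    intro h0
    have := F_natDegree l
    rw [h0, natDegree_zero] at this
    omega
  refine ⟨?_, ?_⟩
  · rw [Separable, isCoprime_iff_aeval_ne_zero_of_isAlgClosed _
      (AlgebraicClosure (RatFunc (ZMod l)))]
    intro z
    by_contra! hz
    obtain ⟨h1, h2⟩ := hz
    rw [F_aeval] at h1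
    rw [F_aeval'] at h2
    exact no_double h7 hJ (sub_eq_zero.mp h1) (sub_eq_zero.mp h2)
  · obtain ⟨q, hq, hq'⟩ := exists_root7 (AlgebraicClosure (RatFunc (ZMod l))) h7
    obtain ⟨z, hz⟩ := IsAlgClosed.exists_aeval_eq_zero (AlgebraicClosure (RatFunc (ZMod l)))
      (FzJmod l) (by rw [degree_eq_natDegree hF0, F_natDegree]; decide)
    rw [F_aeval] at hz
    have hz' := sub_eq_zero.mp hz
    obtain ⟨P, hP, hPt⟩ := exists_point h7 (root_ne_zero h7 hz')
    have hG : Gen (algebraMap (RatFunc (ZMod l))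
      (AlgebraicClosure (RatFunc (ZMod l))) RatFunc.X) P := ⟨hP, by rw [hPt]; exact hz'⟩
    have hinj := Tl_injective h7 hq' hJ hG
    have hmem : ∀ a, Tl q P a + 8 ∈ (FzJmod l).rootSet (AlgebraicClosure (RatFunc (ZMod l))) := by
      intro a
      rw [mem_rootSet]
      refine ⟨hF0, ?_⟩
      rw [F_aeval, add_sub_cancel_right, hG.root h7 hq' a, sub_self]
    let T : OnePoint (ZMod 7) → (FzJmod l).rootSet (AlgebraicClosure (RatFunc (ZMod l))) :=
      fun a => ⟨Tl q P a + 8, hmem a⟩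
    have hT : Function.Injective T := by
      intro a b hab
      apply hinj
      have := congrArg Subtype.val hab
      exact add_right_cancel this
    have hTs : Function.Surjective T := by
      have hc : Nat.card ((FzJmod l).rootSet (AlgebraicClosure (RatFunc (ZMod l)))) ≤
          Nat.card (OnePoint (ZMod 7)) := by
        have e1 : Nat.card (OnePoint (ZMod 7)) = 8 := by
          change Nat.card (Option (ZMod 7)) = 8
          rw [Finite.card_option, Nat.card_zmod]
        rw [e1, Nat.card_coe_set_eq]
        exact (ncard_rootSet_le _ _).trans (F_natDegree l).le
      exact (hT.bijective_of_nat_card_le hc).2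
    have hsurj : ∀ t, Pj t = algebraMap (RatFunc (ZMod l))
        (AlgebraicClosure (RatFunc (ZMod l))) RatFunc.X * t → ∃ a, Tl q P a = t := by
      intro t ht
      obtain ⟨a, ha⟩ := hTs ⟨t + 8, by
        rw [mem_rootSet]
        refine ⟨hF0, ?_⟩
        rw [F_aeval, add_sub_cancel_right, ht, sub_self]⟩
      exact ⟨a, add_right_cancel (congrArg Subtype.val ha)⟩
    have : Fact (((FzJmod l).map (algebraMap (RatFunc (ZMod l))
        (AlgebraicClosure (RatFunc (ZMod l))))).Splits) := ⟨IsAlgClosed.splits _⟩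
    refine group_part T hT ?_ ?_
    · intro σ hσ
      apply Gal.galActionHom_injective (FzJmod l) (AlgebraicClosure (RatFunc (ZMod l)))
      rw [map_one]
      ext1 x
      obtain ⟨a, rfl⟩ := hTs x
      exact hσ a
    · intro σ
      obtain ⟨τ, rfl⟩ := Gal.restrict_surjective (FzJmod l)
        (AlgebraicClosure (RatFunc (ZMod l))) σ
      obtain ⟨M, hM⟩ := gal_proj h7 hq hq' hG hsurj (τ : _ →+* _) (τ.commutes _)
      refine ⟨M, fun a => Subtype.ext ?_⟩
      rw [Gal.restrict_smul]
      have e := hM a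
      change τ (Tl q P a + 8) = Tl q P (M • a) + 8
      rw [map_add, map_ofNat]
      exact congrArg (· + 8) e
end
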